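/- Let M = g⁻¹(0) be a nonempty compact hypersurface in ℝ⁴ (g : ℝ⁴ → ℝ smooth with dg_x ≠ 0 for all x ∈ M), and let Y be a Liouville vector field for ω_st defined on an open set U ⊆ ℝ⁴ containing M and transverse to M. Then the induced contact form α = (ι_Y ω_st)|TM has a closed Reeb orbit: there exist T > 0 and a nonconstant smooth map γ : ℝ → ℝ⁴ with image in M such that for all t ∈ ℝ one has γ(t + T) = γ(t), γ′(t) ∈ ker(dg_{γ(t)}), ω_st(γ′(t), v) = 0 for all v ∈ ker(dg_{γ(t)}), and ω_st(Y(γ(t)), γ′(t)) = 1. -/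

import Mathlib

noncomputable section

open scoped ContDiff
open Real

/-- ℝ⁴ with the Euclidean inner product. -/
abbrev R4 : Type := EuclideanSpace ℝ (Fin 4)

/-- The standard symplectic form ω_st = dx₁∧dy₁ + dx₂∧dy₂ on ℝ⁴. -/
def omegaSt (u v : R4) : ℝ := u 0 * v 1 - u 1 * v 0 + u 2 * v 3 - u 3 * v 2

section Brouwer

open MeasureTheory Metric Set Filter Topology

/-- A small multiple of a compactly supported perturbation of the identity preserves integrals
over a ball containing the support. -/
theorem integral_det_perturbation_small {n : ℕ}
    (u : EuclideanSpace ℝ (Fin n) → EuclideanSpace ℝ (Fin n)) (hu : ContDiff ℝ 1 u) {R : ℝ}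
    (hsupp : ∀ x, x ∉ closedBall (0 : EuclideanSpace ℝ (Fin n)) R → u x = 0)
    (ψ : EuclideanSpace ℝ (Fin n) → ℝ) :
    ∀ᶠ t : ℝ in 𝓝 0,
      ∫ x in closedBall 0 R, (ContinuousLinearMap.id ℝ _ + t • fderiv ℝ u x).det * ψ (x + t • u x)
        = ∫ x in closedBall 0 R, ψ x := by
  have hcs : HasCompactSupport u :=
    HasCompactSupport.intro (isCompact_closedBall 0 R) hsupp
  obtain ⟨K, hK⟩ := hu.lipschitzWith_of_hasCompactSupport hcs one_ne_zero
  have hdet : ∀ᶠ A : EuclideanSpace ℝ (Fin n) →L[ℝ] EuclideanSpace ℝ (Fin n) in 𝓝 0,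
      0 < (ContinuousLinearMap.id ℝ _ + A).det := by
    have hc : Continuous fun A : EuclideanSpace ℝ (Fin n) →L[ℝ] EuclideanSpace ℝ (Fin n) =>
        (ContinuousLinearMap.id ℝ _ + A).det :=
      ContinuousLinearMap.continuous_det.comp (continuous_const.add continuous_id)
    refine (continuousAt_const (y := (0 : ℝ))).eventually_lt hc.continuousAt ?_
    simp [ContinuousLinearMap.det]
  obtain ⟨δ, hδ, hdet⟩ := Metric.eventually_nhds_iff.1 hdet
  have hbd : ∀ x, ‖fderiv ℝ u x‖ ≤ K := fun x => norm_fderiv_le_of_lipschitz ℝ hK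
  have h1 : ∀ᶠ t : ℝ in 𝓝 0, |t| * (K + 1) < min δ 1 := by
    have : Continuous fun t : ℝ => |t| * ((K : ℝ) + 1) := by fun_prop
    refine this.continuousAt.eventually_lt continuousAt_const ?_
    simp [hδ]
  filter_upwards [h1] with t ht
  have hK0 : (0 : ℝ) ≤ K := K.2
  have htK : |t| * K < 1 := by
    have := min_le_right δ 1
    nlinarith [abs_nonneg t]
  have hlip : ∀ x y, ‖t • u x - t • u y‖ ≤ |t| * K * ‖x - y‖ := fun x y => by
    rw [← smul_sub, norm_smul, Real.norm_eq_abs, mul_assoc]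
    gcongr
    simpa [dist_eq_norm] using hK.dist_le_mul x y
  have hinj : Function.Injective fun x => x + t • u x := by
    intro x y hxy
    have h2 : x - y = -(t • u x - t • u y) := by
      have : x + t • u x = y + t • u y := hxy
      rw [neg_sub, sub_eq_sub_iff_add_eq_add, this, add_comm]
    have h3 := hlip x y
    rw [← norm_neg (t • u x - t • u y), ← h2] at h3
    have : ‖x - y‖ = 0 := by nlinarith [norm_nonneg (x - y)]
    exact sub_eq_zero.1 (norm_eq_zero.1 this)
  have hsurj : Function.Surjective fun x => x + t • u x := by
    intro y
    have hc : ContractingWith (⟨|t| * K, by positivity⟩ : NNReal) fun z => y - t • u z := by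
      refine ⟨by exact_mod_cast htK, LipschitzWith.of_dist_le_mul fun a b => ?_⟩
      simp only [dist_eq_norm, sub_sub_sub_cancel_left]
      rw [norm_sub_rev a b]
      exact hlip b a
    refine ⟨hc.fixedPoint, ?_⟩
    have := hc.fixedPoint_isFixedPt
    have h4 : y - t • u hc.fixedPoint = hc.fixedPoint := this
    simp only
    nth_rewrite 1 [← h4]
    simp
  have himage : (fun x => x + t • u x) '' closedBall 0 R = closedBall 0 R := by
    have hout : ∀ x, x ∉ closedBall (0 : EuclideanSpace ℝ (Fin n)) R → x + t • u x = x :=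
      fun x hx => by simp [hsupp x hx]
    apply Subset.antisymm
    · rintro _ ⟨x, hx, rfl⟩
      by_contra h
      have := hinj (hout _ h)
      simp only at this h
      rw [this] at h
      exact h hx
    · intro y hy
      obtain ⟨x, rfl⟩ := hsurj y
      refine ⟨x, ?_, rfl⟩
      by_contra h
      simp only [hout x h] at hy
      exact h hy
  have hd : ∀ x ∈ closedBall (0 : EuclideanSpace ℝ (Fin n)) R,
      HasFDerivWithinAt (fun x => x + t • u x) (ContinuousLinearMap.id ℝ _ + t • fderiv ℝ u x)
        (closedBall 0 R) x := fun x _ =>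
    ((hasFDerivAt_id x).add
      (((hu.differentiable one_ne_zero) x).hasFDerivAt.const_smul t)).hasFDerivWithinAt
  have key := integral_image_eq_integral_abs_det_fderiv_smul volume
    (measurableSet_closedBall) hd hinj.injOn ψ
  rw [himage] at key
  rw [key]
  refine setIntegral_congr_fun measurableSet_closedBall fun x _ => ?_
  have hp : 0 < (ContinuousLinearMap.id ℝ _ + t • fderiv ℝ u x).det := by
    apply hdet
    rw [dist_zero_right, norm_smul, Real.norm_eq_abs]
    have := min_le_left δ 1
    have := hbd x
    nlinarith [abs_nonneg t]
  simp only [smul_eq_mul]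
  rw [abs_of_pos hp]

/-- A family of functions depending polynomially on `t` with continuous coefficients has an
integral depending polynomially on `t`. -/
theorem exists_polynomial_integral {X : Type*} [TopologicalSpace X] [MeasurableSpace X]
    [OpensMeasurableSpace X] (μ : Measure X) [IsFiniteMeasureOnCompacts μ] {B : Set X}
    (hB : IsCompact B) (hBm : MeasurableSet B) (P : Polynomial C(X, ℝ)) :
    ∃ q : Polynomial ℝ, ∀ t : ℝ,
      q.eval t = ∫ x in B, (P.eval (ContinuousMap.const X t)) x ∂μ := by
  induction P using Polynomial.induction_on' with
  | add p q hp hq =>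
    obtain ⟨a, ha⟩ := hp
    obtain ⟨b, hb⟩ := hq
    refine ⟨a + b, fun t => ?_⟩
    rw [Polynomial.eval_add, ha, hb, ← integral_add]
    · simp
    · exact (ContinuousMap.continuous _).continuousOn.integrableOn_compact' hB hBm
    · exact (ContinuousMap.continuous _).continuousOn.integrableOn_compact' hB hBm
  | monomial k a =>
    refine ⟨Polynomial.monomial k (∫ x in B, a x ∂μ), fun t => ?_⟩
    simp [Polynomial.eval_monomial, integral_mul_const]

/-- The pull-back of a polynomial density by `x + t • u x` has constant integral. -/
theorem integral_det_perturbation {n : ℕ}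
    (u : EuclideanSpace ℝ (Fin n) → EuclideanSpace ℝ (Fin n)) (hu : ContDiff ℝ 1 u) {R : ℝ}
    (hsupp : ∀ x, x ∉ closedBall (0 : EuclideanSpace ℝ (Fin n)) R → u x = 0)
    (y : EuclideanSpace ℝ (Fin n)) (c : ℝ) (m : ℕ) :
    ∫ x in closedBall 0 R, (ContinuousLinearMap.id ℝ _ + fderiv ℝ u x).det *
        (1 - c * ‖x + u x - y‖ ^ 2) ^ m
      = ∫ x in closedBall 0 R, (1 - c * ‖x - y‖ ^ 2) ^ m := by
  have hDu : Continuous (fderiv ℝ u) := hu.continuous_fderiv one_ne_zero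
  have huc : Continuous u := hu.continuous
  let A : Matrix (Fin n) (Fin n) C(EuclideanSpace ℝ (Fin n), ℝ) := fun i j =>
    ⟨fun x => (fderiv ℝ u x (EuclideanSpace.single j 1)) i, by fun_prop⟩
  let M : Matrix (Fin n) (Fin n) (Polynomial C(EuclideanSpace ℝ (Fin n), ℝ)) := fun i j =>
    (if i = j then 1 else 0) + Polynomial.X * Polynomial.C (A i j)
  let N : Polynomial C(EuclideanSpace ℝ (Fin n), ℝ) := ∑ i, (Polynomial.C ⟨fun x => x i, by fun_prop⟩ +
    Polynomial.X * Polynomial.C ⟨fun x => u x i, by fun_prop⟩ -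
      Polynomial.C (ContinuousMap.const _ (y i))) ^ 2
  let P : Polynomial C(EuclideanSpace ℝ (Fin n), ℝ) :=
    M.det * (1 - Polynomial.C (ContinuousMap.const _ c) * N) ^ m
  have hM : ∀ (t : ℝ) (x : EuclideanSpace ℝ (Fin n)), (M.det.eval (ContinuousMap.const _ t)) x =
      (ContinuousLinearMap.id ℝ _ + t • fderiv ℝ u x).det := by
    intro t x
    let φ : Polynomial C(EuclideanSpace ℝ (Fin n), ℝ) →+* ℝ :=
      ((ContinuousMap.evalAlgHom ℝ ℝ x : C(EuclideanSpace ℝ (Fin n), ℝ) →ₐ[ℝ] ℝ) : C(EuclideanSpace ℝ (Fin n), ℝ) →+* ℝ).comp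
        (Polynomial.evalRingHom (ContinuousMap.const _ t))
    have h1 : (M.det.eval (ContinuousMap.const _ t)) x = φ M.det := rfl
    rw [h1, RingHom.map_det, ContinuousLinearMap.det,
      ← LinearMap.det_toMatrix (EuclideanSpace.basisFun (Fin n) ℝ).toBasis]
    congr 1
    ext i j
    change φ (M i j) = _
    by_cases hij : i = j <;>
    simp [φ, M, A, LinearMap.toMatrix_apply, hij, mul_comm t]
  have hP : ∀ (t : ℝ) (x : EuclideanSpace ℝ (Fin n)), (P.eval (ContinuousMap.const _ t)) x =
      (ContinuousLinearMap.id ℝ _ + t • fderiv ℝ u x).det *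
        (1 - c * ‖x + t • u x - y‖ ^ 2) ^ m := by
    intro t x
    simp only [P, Polynomial.eval_mul, ContinuousMap.mul_apply, hM]
    congr 1
    simp [N, Polynomial.eval_finsetSum, EuclideanSpace.norm_sq_eq, mul_comm t]
  obtain ⟨q, hq⟩ := exists_polynomial_integral volume (isCompact_closedBall (0 : EuclideanSpace ℝ (Fin n)) R)
    measurableSet_closedBall P
  have hsmall := integral_det_perturbation_small u hu hsupp
    fun z => (1 - c * ‖z - y‖ ^ 2) ^ m
  have hconst : q = Polynomial.C (∫ x in closedBall (0 : EuclideanSpace ℝ (Fin n)) R, (1 - c * ‖x - y‖ ^ 2) ^ m) := by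
    apply Polynomial.eq_of_infinite_eval_eq
    refine Set.Infinite.mono (s := {t : ℝ | _}) ?_ (infinite_of_mem_nhds (0 : ℝ) hsmall)
    intro t ht
    simp only [Set.mem_ofPred_eq, Polynomial.eval_C] at ht ⊢
    rw [hq, ← ht]
    simp only [hP]
  have h1 := hq 1
  rw [hconst, Polynomial.eval_C] at h1
  rw [h1]
  simp only [hP, one_smul]

/-- A compactly supported `C^1` perturbation of the identity is surjective. -/
theorem surjective_id_add_of_contDiff {n : ℕ}
    (u : EuclideanSpace ℝ (Fin n) → EuclideanSpace ℝ (Fin n)) (hu : ContDiff ℝ 1 u)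
    (hcs : HasCompactSupport u) (y : EuclideanSpace ℝ (Fin n)) : ∃ x, x + u x = y := by
  by_contra! hne
  obtain ⟨R₀, hR₀⟩ := hcs.isCompact.isBounded.subset_closedBall 0
  set R := max R₀ (‖y‖ + 1) with hR
  have hsupp : ∀ x, x ∉ closedBall (0 : EuclideanSpace ℝ (Fin n)) R → u x = 0 := by
    intro x hx
    by_contra h
    exact hx (closedBall_subset_closedBall (le_max_left _ _)
      (hR₀ (subset_tsupport _ (Function.mem_support.2 h))))
  have hyB : y ∈ closedBall (0 : EuclideanSpace ℝ (Fin n)) R := by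
    rw [mem_closedBall_zero_iff, hR]
    exact le_trans (by linarith) (le_max_right _ _)
  have hBc := isCompact_closedBall (0 : EuclideanSpace ℝ (Fin n)) R
  have huc := hu.continuous
  have hDu : Continuous (fderiv ℝ u) := hu.continuous_fderiv one_ne_zero
  have hfc : Continuous fun x => ‖x + u x - y‖ := by fun_prop
  obtain ⟨x₀, -, hx₀⟩ := hBc.exists_isMinOn ⟨y, hyB⟩ hfc.continuousOn
  obtain ⟨S, hS⟩ := hBc.bddAbove_image hfc.continuousOn
  set ε := min ‖x₀ + u x₀ - y‖ 1 with hε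
  have hεpos : 0 < ε := lt_min (norm_pos_iff.2 (sub_ne_zero.2 (hne x₀))) one_pos
  have hεle : ∀ x ∈ closedBall (0 : EuclideanSpace ℝ (Fin n)) R, ε ≤ ‖x + u x - y‖ :=
    fun x hx => (min_le_left _ _).trans (hx₀ hx)
  have hSle : ∀ x ∈ closedBall (0 : EuclideanSpace ℝ (Fin n)) R, ‖x + u x - y‖ ≤ S :=
    fun x hx => hS (mem_image_of_mem _ hx)
  have hdetc : Continuous fun x => (ContinuousLinearMap.id ℝ _ + fderiv ℝ u x).det :=
    ContinuousLinearMap.continuous_det.comp (continuous_const.add hDu)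
  obtain ⟨D, hD⟩ := hBc.bddAbove_image hdetc.abs.continuousOn
  have hDle : ∀ x ∈ closedBall (0 : EuclideanSpace ℝ (Fin n)) R,
      |(ContinuousLinearMap.id ℝ _ + fderiv ℝ u x).det| ≤ D :=
    fun x hx => hD (mem_image_of_mem _ hx)
  have hRpos : 0 < R := lt_of_lt_of_le (by positivity) (le_max_right R₀ (‖y‖ + 1))
  set c := (S ^ 2 + (2 * R) ^ 2)⁻¹ with hc
  have hcpos : 0 < c := by positivity
  have hcS : ∀ r, 0 ≤ r → (r ≤ S ∨ r ≤ 2 * R) → c * r ^ 2 ≤ 1 := by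
    intro r hr h
    rw [hc, inv_mul_le_iff₀ (by positivity), mul_one]
    rcases h with h | h
    · nlinarith
    · nlinarith [sq_nonneg S]
  have hεS : ε ≤ S := (hεle y hyB).trans (hSle y hyB)
  have ha : 0 ≤ 1 - c * ε ^ 2 := by linarith [hcS ε hεpos.le (Or.inl hεS)]
  have hab : 1 - c * ε ^ 2 < 1 - c * (ε / 2) ^ 2 := by
    nlinarith [mul_pos hcpos (pow_pos hεpos 2)]
  set a := 1 - c * ε ^ 2
  set b := 1 - c * (ε / 2) ^ 2
  have hb : 0 < b := ha.trans_lt hab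
  set V := volume.real (ball y (ε / 2)) with hV
  have hVpos : 0 < V := ENNReal.toReal_pos (measure_ball_pos _ _ (by positivity)).ne'
    measure_ball_lt_top.ne
  have hsub : ball y (ε / 2) ⊆ closedBall (0 : EuclideanSpace ℝ (Fin n)) R := by
    intro x hx
    rw [mem_closedBall_zero_iff]
    rw [mem_ball_iff_norm] at hx
    have h1 : ε ≤ 1 := min_le_right _ _
    have h2 : ‖y‖ + 1 ≤ R := le_max_right _ _
    have h3 : ‖x‖ ≤ ‖x - y‖ + ‖y‖ := norm_le_norm_sub_add _ _
    linarith
  have key : ∀ m : ℕ, V * b ^ m ≤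
      D * volume.real (closedBall (0 : EuclideanSpace ℝ (Fin n)) R) * a ^ m := by
    intro m
    have h_integral : IntegrableOn (fun x => (1 - c * ‖x - y‖ ^ 2) ^ m)
        (closedBall (0 : EuclideanSpace ℝ (Fin n)) R) :=
      (by fun_prop : Continuous _).continuousOn.integrableOn_compact hBc
    have h1 : V * b ^ m ≤ ∫ x in closedBall 0 R, (1 - c * ‖x - y‖ ^ 2) ^ m := by
      have h2 : ∫ x in ball y (ε / 2), b ^ m ≤
          ∫ x in ball y (ε / 2), (1 - c * ‖x - y‖ ^ 2) ^ m := by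
        refine setIntegral_mono_on (integrableOn_const measure_ball_lt_top.ne)
          (h_integral.mono_set hsub) measurableSet_ball fun x hx => ?_
        rw [mem_ball_iff_norm] at hx
        simp only [b]
        gcongr
      rw [setIntegral_const, smul_eq_mul] at h2
      refine h2.trans (setIntegral_mono_set h_integral ?_ hsub.eventuallyLE)
      refine (ae_restrict_iff' measurableSet_closedBall).2 (Eventually.of_forall fun x hx => ?_)
      refine pow_nonneg (sub_nonneg.2 (hcS _ (norm_nonneg _) (Or.inr ?_))) m
      rw [mem_closedBall_zero_iff] at hx hyB
      linarith [norm_sub_le x y]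
    refine h1.trans ?_
    rw [← integral_det_perturbation u hu hsupp y c m]
    refine (le_abs_self _).trans ?_
    have h3 := norm_setIntegral_le_of_norm_le_const (μ := volume)
      (s := closedBall (0 : EuclideanSpace ℝ (Fin n)) R)
      (f := fun x => (ContinuousLinearMap.id ℝ _ + fderiv ℝ u x).det *
        (1 - c * ‖x + u x - y‖ ^ 2) ^ m) (C := D * a ^ m) measure_closedBall_lt_top ?_
    · rw [Real.norm_eq_abs] at h3
      linarith
    · intro x hx
      rw [norm_mul, norm_pow]
      have h0 : 0 ≤ 1 - c * ‖x + u x - y‖ ^ 2 :=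
        sub_nonneg.2 (hcS _ (norm_nonneg _) (Or.inl (hSle x hx)))
      have hD0 : 0 ≤ D := (abs_nonneg _).trans (hDle x hx)
      have h4 : ‖1 - c * ‖x + u x - y‖ ^ 2‖ ≤ a := by
        rw [Real.norm_of_nonneg h0]
        simp only [a]
        have := hεle x hx
        gcongr
      gcongr
      exact hDle x hx
  have hlim : Tendsto (fun m : ℕ => D * volume.real
      (closedBall (0 : EuclideanSpace ℝ (Fin n)) R) * (a / b) ^ m) atTop (𝓝 0) := by
    simpa using (tendsto_pow_atTop_nhds_zero_of_lt_one (div_nonneg ha hb.le)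
      ((div_lt_one hb).2 hab)).const_mul
        (D * volume.real (closedBall (0 : EuclideanSpace ℝ (Fin n)) R))
  have := ge_of_tendsto' hlim (b := V) fun m => by
    rw [div_pow, mul_div_assoc', le_div_iff₀ (pow_pos hb m)]
    exact key m
  linarith

/-- A compactly supported continuous perturbation of the identity is surjective. -/
theorem surjective_id_add_of_continuous {E : Type*} [NormedAddCommGroup E] [NormedSpace ℝ E]
    [FiniteDimensional ℝ E] (u : E → E) (hu : Continuous u) (hcs : HasCompactSupport u) (y : E) :
    ∃ x, x + u x = y := by
  let e : E ≃L[ℝ] EuclideanSpace ℝ (Fin (Module.finrank ℝ E)) :=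
    ContinuousLinearEquiv.ofFinrankEq (by simp)
  set v : EuclideanSpace ℝ (Fin (Module.finrank ℝ E)) → _ := fun z => e (u (e.symm z)) with hv
  have hvc : Continuous v := by fun_prop
  have hvs : HasCompactSupport v := by
    have h1 : HasCompactSupport (u ∘ e.symm) :=
      hcs.comp_homeomorph e.symm.toHomeomorph
    exact h1.comp_left (g := e) (map_zero e)
  suffices h : ∃ z, z + v z = e y by
    obtain ⟨z, hz⟩ := h
    refine ⟨e.symm z, e.injective ?_⟩
    rw [map_add, ← hz]
    simp [hv]
  by_contra! hne
  obtain ⟨R₀, hR₀⟩ := hvs.isCompact.isBounded.subset_closedBall 0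
  set R := max R₀ (‖e y‖ + 1)
  have hsupp : ∀ x, x ∉ closedBall 0 R → v x = 0 := by
    intro x hx
    by_contra h
    exact hx (closedBall_subset_closedBall (le_max_left _ _)
      (hR₀ (subset_tsupport _ (Function.mem_support.2 h))))
  have hBc := isCompact_closedBall (0 : EuclideanSpace ℝ (Fin (Module.finrank ℝ E))) R
  have hyR : ‖e y‖ + 1 ≤ R := le_max_right _ _
  have hfc : Continuous fun x => ‖x + v x - e y‖ := by fun_prop
  obtain ⟨x₀, -, hx₀⟩ := hBc.exists_isMinOn ⟨e y, by simp; linarith⟩ hfc.continuousOn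
  set ε := min ‖x₀ + v x₀ - e y‖ 1 with hε
  have hεpos : 0 < ε := lt_min (norm_pos_iff.2 (sub_ne_zero.2 (hne x₀))) one_pos
  obtain ⟨w, hw, hwv, hws⟩ := hvc.exists_contDiff_approx 1 (continuous_const (y := ε))
    fun _ => hεpos
  obtain ⟨z, hz⟩ := surjective_id_add_of_contDiff w hw (hvs.mono hws) (e y)
  have h1 : ‖z + v z - e y‖ < ε := by
    rw [← hz, add_sub_add_left_eq_sub, ← dist_eq_norm, dist_comm]
    exact hwv z
  by_cases hzB : z ∈ closedBall 0 R
  · exact absurd ((min_le_left _ _).trans (hx₀ hzB)) (not_le.2 h1)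
  · rw [hsupp z hzB, add_zero] at h1
    rw [mem_closedBall_zero_iff] at hzB
    have h2 : ε ≤ 1 := min_le_right _ _
    have h3 : ‖z‖ ≤ ‖z - e y‖ + ‖e y‖ := norm_le_norm_sub_add _ _
    linarith

/-- A continuous map of a closed ball which is the identity on the sphere covers the ball. -/
theorem exists_eq_of_eqOn_sphere {E : Type*} [NormedAddCommGroup E] [NormedSpace ℝ E]
    [FiniteDimensional ℝ E] {c : E} {r : ℝ} (f : E → E) (hf : Continuous f)
    (hid : ∀ x ∈ sphere c r, f x = x) {y : E} (hy : y ∈ ball c r) :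
    ∃ x ∈ closedBall c r, f x = y := by
  classical
  set u : E → E := fun x => if x ∈ closedBall c r then f x - x else 0 with hu
  have huc : Continuous u := by
    refine continuous_if ?_ (by fun_prop) continuousOn_const
    intro x hx
    have : x ∈ sphere c r := frontier_closedBall_subset_sphere hx
    rw [hid x this, sub_self]
  have hus : HasCompactSupport u :=
    HasCompactSupport.intro (isCompact_closedBall c r) fun x hx => by simp only [hu, if_neg hx]
  obtain ⟨x, hx⟩ := surjective_id_add_of_continuous u huc hus y
  by_cases hxB : x ∈ closedBall c r
  · refine ⟨x, hxB, ?_⟩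
    simpa only [hu, if_pos hxB, add_sub_cancel] using hx
  · simp only [hu, if_neg hxB, add_zero] at hx
    exact absurd (ball_subset_closedBall (hx ▸ hy)) hxB

end Brouwer

section Linking

open Metric Set Filter Topology

/-- A linking theorem for functions with uniformly continuous coercive gradient. -/
theorem exists_critical_point_of_linking
    {X : Type*} [NormedAddCommGroup X] [InnerProductSpace ℝ X] [FiniteDimensional ℝ X]
    {W : Type*} [NormedAddCommGroup W] [NormedSpace ℝ W] [FiniteDimensional ℝ W]
    (ι : W × ℝ → X) (hι : Continuous ι) (pr : X → W × ℝ) (hpr : Continuous pr)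
    (hprι : ∀ w s, 0 ≤ s → pr (ι (w, s)) = (w, s))
    (F : X → ℝ) (G : X → X) (hF : ∀ x, HasGradientAt F (G x) x) (hG : UniformContinuous G)
    {d C : ℝ} (hd : 0 < d) (hcoer : ∀ x, d * ‖x‖ - C ≤ ‖G x‖)
    {τ α : ℝ} (hα : 0 < α) (hατ : α < 2 * τ)
    (hbd : ∀ w s, ‖w‖ ≤ τ → 0 ≤ s → s ≤ 2 * τ → (‖w‖ = τ ∨ s = 0 ∨ s = 2 * τ) →
      F (ι (w, s)) ≤ 0)
    {η : ℝ} (hη : 0 < η) (hlink : ∀ x, pr x = (0, α) → 2 * η ≤ F x) :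
    ∃ x, G x = 0 ∧ η ≤ F x := by
  by_contra! hno
  have hFc : Continuous F := continuous_iff_continuousAt.2 fun x =>
    (hF x).differentiableAt.continuousAt
  have hGc : Continuous G := hG.continuous
  obtain ⟨δ, hδ, hδG⟩ : ∃ δ > 0, ∀ x, η ≤ F x → δ ≤ ‖G x‖ := by
    have hK : IsCompact ({x | η ≤ F x} ∩ closedBall 0 ((C + 1) / d)) :=
      (isCompact_closedBall _ _).inter_left (isClosed_le continuous_const hFc)
    have hfar : ∀ x, x ∉ closedBall (0 : X) ((C + 1) / d) → 1 ≤ ‖G x‖ := by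
      intro x hx
      rw [mem_closedBall_zero_iff, not_le, div_lt_iff₀ hd] at hx
      linarith [hcoer x]
    rcases Set.eq_empty_or_nonempty ({x | η ≤ F x} ∩ closedBall 0 ((C + 1) / d)) with h | h
    · refine ⟨1, one_pos, fun x hx => hfar x fun hx' => ?_⟩
      have : x ∈ ({x | η ≤ F x} ∩ closedBall 0 ((C + 1) / d)) := ⟨hx, hx'⟩
      rw [h] at this
      exact this
    · obtain ⟨x₀, hx₀, hmin⟩ := hK.exists_isMinOn h hGc.norm.continuousOn
      refine ⟨min 1 ‖G x₀‖, lt_min one_pos (norm_pos_iff.2 fun h0 =>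
        absurd hx₀.1 (not_le.2 (hno x₀ h0))), fun x hx => ?_⟩
      by_cases hx' : x ∈ closedBall (0 : X) ((C + 1) / d)
      · exact (min_le_right _ _).trans (hmin ⟨hx, hx'⟩)
      · exact (min_le_left _ _).trans (hfar x hx')
  obtain ⟨ρ, hρ, hρG⟩ := Metric.uniformContinuous_iff.1 hG (δ / 2) (half_pos hδ)
  set cut : X → ℝ := fun x => min 1 (max 0 ((F x - η) / η)) with hcut
  have hcutc : Continuous cut := by fun_prop
  have hcut0 : ∀ x, 0 ≤ cut x := fun x => le_min zero_le_one (le_max_left _ _)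
  have hcut1 : ∀ x, cut x ≤ 1 := fun x => min_le_left _ _
  set D : X → X := fun x => x - (ρ / 2 * cut x) • ((max ‖G x‖ δ)⁻¹ • G x) with hD
  have hmax : ∀ x, max ‖G x‖ δ ≠ 0 := fun x => (lt_max_of_lt_right hδ).ne'
  have hDc : Continuous D := by
    refine continuous_id.sub ((continuous_const.mul hcutc).smul (Continuous.smul ?_ hGc))
    exact (hGc.norm.max continuous_const).inv₀ hmax
  have hDid : ∀ x, F x ≤ 0 → D x = x := by
    intro x hx
    have : cut x = 0 := by
      have h1 : (F x - η) / η ≤ 0 := div_nonpos_of_nonpos_of_nonneg (by linarith) hη.le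
      simp [hcut, max_eq_left h1]
    simp [hD, this]
  have hdec : ∀ x, F (D x) ≤ F x - ρ / 2 * cut x * (δ / 2) := by
    intro x
    rcases (hcut0 x).eq_or_lt with h0 | hpos
    · simp [hD, ← h0]
    have hFx : η ≤ F x := by
      by_contra! hlt
      have h1 : (F x - η) / η ≤ 0 := div_nonpos_of_nonpos_of_nonneg (by linarith) hη.le
      simp [hcut, max_eq_left h1] at hpos
    have hGx := hδG x hFx
    have hGpos : 0 < ‖G x‖ := hδ.trans_le hGx
    set n : X := ‖G x‖⁻¹ • G x with hn
    have hn1 : ‖n‖ = 1 := by rw [hn, norm_smul, norm_inv, norm_norm, inv_mul_cancel₀ hGpos.ne']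
    have hDx : D x = x - (ρ / 2 * cut x) • n := by simp [hD, hn, max_eq_left hGx]
    set σ := ρ / 2 * cut x with hσ
    have hσ0 : 0 ≤ σ := by positivity
    have hσρ : σ < ρ := by nlinarith [hcut1 x]
    have hderiv : ∀ r : ℝ, HasDerivAt (fun r : ℝ => F (x - r • n))
        (inner ℝ (G (x - r • n)) (-n)) r := by
      intro r
      have h1 : HasDerivAt (fun r : ℝ => x - r • n) (-n) r := by
        simpa using ((hasDerivAt_id r).smul_const n).const_sub x
      exact (hF _).hasFDerivAt.comp_hasDerivAt r h1
    have hmv := (convex_Icc (0 : ℝ) σ).image_sub_le_mul_sub_of_deriv_le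
      (f := fun r : ℝ => F (x - r • n)) (C := -(δ / 2))
      (fun r _ => (hderiv r).continuousAt.continuousWithinAt)
      (fun r _ => (hderiv r).differentiableAt.differentiableWithinAt)
      (fun r hr => by
        rw [interior_Icc] at hr
        rw [(hderiv r).deriv, inner_neg_right]
        have h2 : dist (x - r • n) x < ρ := by
          rw [dist_eq_norm, sub_sub_cancel_left, norm_neg, norm_smul, hn1, mul_one,
            Real.norm_of_nonneg hr.1.le]
          exact hr.2.trans hσρ
        have h3 := hρG h2
        rw [dist_eq_norm] at h3
        have h4 : inner ℝ (G x) n = ‖G x‖ := by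
          rw [hn, inner_smul_right, real_inner_self_eq_norm_sq]
          field_simp
        have h5 : |inner ℝ (G (x - r • n) - G x) n| ≤ δ / 2 := by
          refine (abs_real_inner_le_norm _ _).trans ?_
          rw [hn1, mul_one]
          exact h3.le
        rw [inner_sub_left, h4] at h5
        have := (abs_le.1 h5).1
        linarith)
      0 ⟨le_rfl, hσ0⟩ σ ⟨hσ0, le_rfl⟩ hσ0
    rw [hDx]
    simp only [zero_smul, sub_zero] at hmv
    linarith
  have hmono : ∀ x, F (D x) ≤ F x := fun x => by
    have h1 := hdec x
    have h2 : 0 ≤ ρ / 2 * cut x * (δ / 2) := by have := hcut0 x; positivity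
    linarith
  have hiter : ∀ (k : ℕ) x, 2 * η ≤ F (D^[k] x) → F (D^[k] x) ≤ F x - k * (ρ / 2 * (δ / 2)) := by
    intro k
    induction k with
    | zero => intro x _; simp
    | succ k ih =>
      intro x hx
      rw [Function.iterate_succ_apply'] at hx ⊢
      have h1 : 2 * η ≤ F (D^[k] x) := hx.trans (hmono _)
      have h2 := ih x h1
      have h3 : cut (D^[k] x) = 1 := by
        have : 1 ≤ (F (D^[k] x) - η) / η := by rw [le_div_iff₀ hη]; linarith
        simp [hcut, this]
      have h4 := hdec (D^[k] x)
      rw [h3] at h4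
      push_cast
      linarith
  have hτ : 0 < τ := by linarith
  obtain ⟨Mx, hMx⟩ := (isCompact_closedBall ((0 : W), τ) τ).bddAbove_image
    (hFc.comp hι).continuousOn
  obtain ⟨k, hk⟩ := exists_nat_gt (Mx / (ρ / 2 * (δ / 2)))
  have hmem : ∀ p : W × ℝ, p ∈ closedBall ((0 : W), τ) τ ↔ ‖p.1‖ ≤ τ ∧ |p.2 - τ| ≤ τ := by
    intro p
    simp [mem_closedBall, Prod.dist_eq, Real.dist_eq]
  have hiterid : ∀ (k : ℕ) x, F x ≤ 0 → D^[k] x = x := by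
    intro k x hx
    exact Function.iterate_fixed (hDid x hx) k
  obtain ⟨p, hp, hpy⟩ := exists_eq_of_eqOn_sphere (c := ((0 : W), τ)) (r := τ)
    (fun p => pr (D^[k] (ι p))) (hpr.comp ((hDc.iterate k).comp hι))
    (fun p hp => by
      have hp' := (hmem p).1 (sphere_subset_closedBall hp)
      have hs := abs_le.1 hp'.2
      have hcase : ‖p.1‖ = τ ∨ p.2 = 0 ∨ p.2 = 2 * τ := by
        rw [mem_sphere, Prod.dist_eq, dist_zero_right, Real.dist_eq] at hp
        rcases max_choice ‖p.1‖ |p.2 - τ| with h | h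
        · exact Or.inl (by rw [← h]; exact hp)
        · have h1 : |p.2 - τ| = τ := by rw [← h]; exact hp
          rcases (abs_eq hτ.le).1 h1 with h2 | h2
          · exact Or.inr (Or.inr (by linarith))
          · exact Or.inr (Or.inl (by linarith))
      have h0 := hbd p.1 p.2 hp'.1 (by linarith) (by linarith) hcase
      show pr (D^[k] (ι p)) = p
      rw [hiterid k _ h0]
      exact hprι p.1 p.2 (by linarith))
    (y := ((0 : W), α)) (by
      rw [mem_ball, Prod.dist_eq, dist_self, Real.dist_eq]
      exact max_lt hτ (abs_lt.2 ⟨by linarith, by linarith⟩))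
  have h1 := hlink _ hpy
  have h2 := hiter k _ h1
  have h3 : F (ι p) ≤ Mx := hMx (mem_image_of_mem _ hp)
  rw [div_lt_iff₀ (by positivity)] at hk
  linarith

end Linking

section Loops

open MeasureTheory Metric Set Filter Topology

variable {E : Type*} [NormedAddCommGroup E] [InnerProductSpace ℝ E]

/-- The rotation by angle `θ` attached to a complex structure `J`. -/
def rot (J : E →L[ℝ] E) (θ : ℝ) : E →L[ℝ] E :=
  cos θ • ContinuousLinearMap.id ℝ E + sin θ • J

theorem rot_apply (J : E →L[ℝ] E) (θ : ℝ) (x : E) : rot J θ x = cos θ • x + sin θ • J x := by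
  simp [rot]

theorem rot_zero (J : E →L[ℝ] E) (x : E) : rot J 0 x = x := by simp [rot_apply]

theorem rot_add {J : E →L[ℝ] E} (hJ : ∀ x, J (J x) = -x) (a b : ℝ) (x : E) :
    rot J (a + b) x = rot J a (rot J b x) := by
  simp only [rot_apply, cos_add, sin_add, map_add, map_smul, hJ]
  module

theorem inner_rot {J : E →L[ℝ] E} (hJs : ∀ x y, inner ℝ (J x) y = -inner ℝ x (J y))
    (a : ℝ) (x y : E) : inner ℝ (rot J a x) y = inner ℝ x (rot J (-a) y) := by
  simp only [rot_apply, inner_add_left, inner_add_right, inner_smul_left, inner_smul_right, hJs,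
    cos_neg, sin_neg, RCLike.conj_to_real]
  ring

theorem norm_rot {J : E →L[ℝ] E} (hJ : ∀ x, J (J x) = -x)
    (hJs : ∀ x y, inner ℝ (J x) y = -inner ℝ x (J y)) (a : ℝ) (x : E) : ‖rot J a x‖ = ‖x‖ := by
  have h : inner ℝ (rot J a x) (rot J a x) = inner ℝ x x := by
    rw [inner_rot hJs, ← rot_add hJ, neg_add_cancel, rot_zero]
  rw [real_inner_self_eq_norm_sq, real_inner_self_eq_norm_sq] at h
  exact (sq_eq_sq₀ (norm_nonneg _) (norm_nonneg _)).1 h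

theorem rot_two_pi_int (J : E →L[ℝ] E) (m : ℤ) (x : E) : rot J (2 * π * m) x = x := by
  have h1 : cos (2 * π * m) = 1 := by rw [mul_comm]; exact cos_int_mul_two_pi m
  have h2 : sin (2 * π * m) = 0 := by
    rw [show 2 * π * m = ((2 * m : ℤ) : ℝ) * π by push_cast; ring]; exact sin_int_mul_pi _
  simp [rot_apply, h1, h2]

theorem hasDerivAt_rot {J : E →L[ℝ] E} (hJ : ∀ x, J (J x) = -x) (c : ℝ) (x : E) (t : ℝ) :
    HasDerivAt (fun t => rot J (c * t) x) (c • J (rot J (c * t) x)) t := by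
  simp only [rot_apply, map_add, map_smul, hJ]
  have h0 : HasDerivAt (fun t : ℝ => c * t) c t := by simpa using (hasDerivAt_id t).const_mul c
  have h1 := ((hasDerivAt_cos (c * t)).comp t h0).smul_const x
  have h2 := ((hasDerivAt_sin (c * t)).comp t h0).smul_const (J x)
  exact (h1.add h2).congr_deriv (by module)

@[fun_prop]
theorem Continuous.rot_comp {T : Type*} [TopologicalSpace T] (J : E →L[ℝ] E) {f : T → ℝ}
    {u : T → E} (hf : Continuous f) (hu : Continuous u) :
    Continuous fun t => rot J (f t) (u t) := by
  simp only [rot_apply]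
  fun_prop

theorem integral_rot [CompleteSpace E] {J : E →L[ℝ] E} (hJ : ∀ x, J (J x) = -x) (m : ℤ) (x : E) :
    ∫ t in (0 : ℝ)..1, rot J (2 * π * m * t) x = if m = 0 then x else 0 := by
  split_ifs with hm
  · simp [hm, rot_zero]
  · have hc : (2 * π * m : ℝ) ≠ 0 := by
      have : (m : ℝ) ≠ 0 := by exact_mod_cast hm
      have := pi_ne_zero
      positivity
    have hd : ∀ t ∈ uIcc (0 : ℝ) 1, HasDerivAt
        (fun t => -((2 * π * m : ℝ)⁻¹ • J (rot J (2 * π * m * t) x)))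
        (rot J (2 * π * m * t) x) t := by
      intro t _
      have h1 := (((J.hasFDerivAt).comp_hasDerivAt t
        (hasDerivAt_rot hJ (2 * π * m) x t)).const_smul ((2 * π * m : ℝ)⁻¹)).neg
      refine h1.congr_deriv ?_
      rw [map_smul, hJ, smul_smul, inv_mul_cancel₀ hc, one_smul, neg_neg]
    rw [intervalIntegral.integral_eq_sub_of_hasDerivAt hd
      (Continuous.intervalIntegrable (by fun_prop) _ _)]
    simp [rot_two_pi_int, rot_zero]

variable {I : Type*} [Fintype I]

/-- The trigonometric loop with frequencies `κ i` and coefficients `a i`. -/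
def trigLoop (J : E →L[ℝ] E) (κ : I → ℤ) (a : I → E) (t : ℝ) : E :=
  ∑ i, rot J (2 * π * κ i * t) (a i)

@[fun_prop]
theorem continuous_trigLoop (J : E →L[ℝ] E) (κ : I → ℤ) (a : I → E) :
    Continuous (trigLoop J κ a) := by
  unfold trigLoop
  fun_prop

theorem trigLoop_add (J : E →L[ℝ] E) (κ : I → ℤ) (a b : I → E) (t : ℝ) :
    trigLoop J κ (a + b) t = trigLoop J κ a t + trigLoop J κ b t := by
  simp [trigLoop, Finset.sum_add_distrib]

theorem trigLoop_sub (J : E →L[ℝ] E) (κ : I → ℤ) (a b : I → E) (t : ℝ) :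
    trigLoop J κ (a - b) t = trigLoop J κ a t - trigLoop J κ b t := by
  simp [trigLoop, Finset.sum_sub_distrib]

theorem trigLoop_periodic {J : E →L[ℝ] E} (hJ : ∀ x, J (J x) = -x) (κ : I → ℤ) (a : I → E)
    (t : ℝ) : trigLoop J κ a (t + 1) = trigLoop J κ a t := by
  refine Finset.sum_congr rfl fun i _ => ?_
  rw [mul_add, rot_add hJ, mul_one, rot_two_pi_int]

theorem norm_trigLoop_le {J : E →L[ℝ] E} (hJ : ∀ x, J (J x) = -x)
    (hJs : ∀ x y, inner ℝ (J x) y = -inner ℝ x (J y)) (κ : I → ℤ) (a : I → E) (t : ℝ) :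
    ‖trigLoop J κ a t‖ ≤ ∑ i, ‖a i‖ :=
  (norm_sum_le _ _).trans (Finset.sum_le_sum fun _ _ => (norm_rot hJ hJs _ _).le)

theorem hasDerivAt_trigLoop {J : E →L[ℝ] E} (hJ : ∀ x, J (J x) = -x) (κ : I → ℤ) (a : I → E)
    (t : ℝ) : HasDerivAt (trigLoop J κ a)
      (J (trigLoop J κ (fun i => (2 * π * κ i) • a i) t)) t := by
  have h := HasDerivAt.fun_sum (u := Finset.univ)
    fun i _ => hasDerivAt_rot hJ (2 * π * κ i) (a i) t
  refine h.congr_deriv ?_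
  simp [trigLoop, map_sum]

/-- The Fourier coefficient of `w` at frequency `k`. -/
def rotCoeff (J : E →L[ℝ] E) (w : ℝ → E) (k : ℤ) : E :=
  ∫ t in (0 : ℝ)..1, rot J (-(2 * π * k * t)) (w t)

theorem rotCoeff_trigLoop [CompleteSpace E] {J : E →L[ℝ] E} (hJ : ∀ x, J (J x) = -x) {κ : I → ℤ}
    (hκ : Function.Injective κ) (a : I → E) (i : I) :
    rotCoeff J (trigLoop J κ a) (κ i) = a i := by
  classical
  have h1 : ∀ t, rot J (-(2 * π * κ i * t)) (trigLoop J κ a t) =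
      ∑ j, rot J (2 * π * (κ j - κ i : ℤ) * t) (a j) := by
    intro t
    rw [trigLoop, map_sum]
    refine Finset.sum_congr rfl fun j _ => ?_
    rw [← rot_add hJ]
    congr 2
    push_cast
    ring
  rw [rotCoeff]
  simp_rw [h1]
  rw [intervalIntegral.integral_finsetSum
    fun j _ => Continuous.intervalIntegrable (by fun_prop) _ _]
  simp_rw [integral_rot hJ, sub_eq_zero, hκ.eq_iff]
  simp

theorem integral_inner_trigLoop [CompleteSpace E] {J : E →L[ℝ] E}
    (hJs : ∀ x y, inner ℝ (J x) y = -inner ℝ x (J y)) (κ : I → ℤ) (a : I → E) {w : ℝ → E}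
    (hw : Continuous w) :
    ∫ t in (0 : ℝ)..1, inner ℝ (w t) (trigLoop J κ a t) =
      ∑ i, inner ℝ (rotCoeff J w (κ i)) (a i) := by
  have h1 : ∀ t, inner ℝ (w t) (trigLoop J κ a t) =
      ∑ i, inner ℝ (rot J (-(2 * π * κ i * t)) (w t)) (a i) := by
    intro t
    rw [trigLoop, inner_sum]
    refine Finset.sum_congr rfl fun i _ => ?_
    rw [inner_rot hJs, neg_neg]
  simp_rw [h1]
  rw [intervalIntegral.integral_finsetSum
    fun j _ => Continuous.intervalIntegrable (by fun_prop) _ _]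
  refine Finset.sum_congr rfl fun i _ => ?_
  rw [rotCoeff, real_inner_comm]
  simp_rw [real_inner_comm (a i)]
  exact ((innerSL ℝ (a i)).intervalIntegral_comp_comm
    (Continuous.intervalIntegrable (by fun_prop) _ _))

theorem integral_norm_sq_trigLoop [CompleteSpace E] {J : E →L[ℝ] E} (hJ : ∀ x, J (J x) = -x)
    (hJs : ∀ x y, inner ℝ (J x) y = -inner ℝ x (J y)) {κ : I → ℤ}
    (hκ : Function.Injective κ) (a : I → E) :
    ∫ t in (0 : ℝ)..1, ‖trigLoop J κ a t‖ ^ 2 = ∑ i, ‖a i‖ ^ 2 := by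
  have := integral_inner_trigLoop hJs κ a (continuous_trigLoop J κ a)
  simpa only [rotCoeff_trigLoop hJ hκ, real_inner_self_eq_norm_sq] using this

theorem sum_norm_sq_rotCoeff_le [CompleteSpace E] {J : E →L[ℝ] E} (hJ : ∀ x, J (J x) = -x)
    (hJs : ∀ x y, inner ℝ (J x) y = -inner ℝ x (J y)) {κ : I → ℤ}
    (hκ : Function.Injective κ) {w : ℝ → E} (hw : Continuous w) {C : ℝ} (hC : ∀ t, ‖w t‖ ≤ C) :
    ∑ i, ‖rotCoeff J w (κ i)‖ ^ 2 ≤ C ^ 2 := by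
  set b : I → E := fun i => rotCoeff J w (κ i) with hb
  have h1 := integral_inner_trigLoop hJs κ b hw
  have h2 := integral_norm_sq_trigLoop hJ hJs hκ b
  simp only [hb, real_inner_self_eq_norm_sq] at h1
  have h3 : ∫ t in (0 : ℝ)..1, (2 * inner ℝ (w t) (trigLoop J κ b t) - ‖trigLoop J κ b t‖ ^ 2) ≤
      ∫ t in (0 : ℝ)..1, C ^ 2 := by
    refine intervalIntegral.integral_mono_on zero_le_one
      (Continuous.intervalIntegrable (by fun_prop) _ _) (by simp) fun t _ => ?_
    have h4 := norm_sub_sq_real (w t) (trigLoop J κ b t)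
    have h5 := sq_nonneg ‖w t - trigLoop J κ b t‖
    have h6 : ‖w t‖ ^ 2 ≤ C ^ 2 := pow_le_pow_left₀ (norm_nonneg _) (hC t) 2
    linarith
  rw [intervalIntegral.integral_sub (Continuous.intervalIntegrable (by fun_prop) _ _)
    (Continuous.intervalIntegrable (by fun_prop) _ _), intervalIntegral.integral_const_mul, h2] at h3
  simp only [hb] at h3
  rw [h1] at h3
  simp at h3
  linarith

end Loops

section ActionFunctional

open MeasureTheory Metric Set Filter Topology

variable {E : Type*} [NormedAddCommGroup E] [InnerProductSpace ℝ E] [CompleteSpace E]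

theorem exists_uniform_gradient_bound {H : E → ℝ} {G : E → E}
    (hH : ∀ x, HasGradientAt H (G x) x) (hG : UniformContinuous G) {ε : ℝ} (hε : 0 < ε) :
    ∃ δ > 0, ∀ x h, ‖h‖ < δ → |H (x + h) - H x - inner ℝ (G x) h| ≤ ε * ‖h‖ := by
  obtain ⟨δ, hδ, hδG⟩ := Metric.uniformContinuous_iff.1 hG ε hε
  refine ⟨δ, hδ, fun x h hh => ?_⟩
  have h1 := (convex_ball x δ).norm_image_sub_le_of_norm_hasFDerivWithin_le'
    (f := H) (φ := InnerProductSpace.toDual ℝ E (G x)) (C := ε)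
    (f' := fun y => InnerProductSpace.toDual ℝ E (G y))
    (fun y _ => (hH y).hasFDerivAt.hasFDerivWithinAt)
    (fun y hy => by
      rw [← map_sub, LinearIsometryEquiv.norm_map, ← dist_eq_norm]
      exact (hδG hy).le) (mem_ball_self hδ) (y := x + h) (by simpa using hh)
  simpa using h1

variable {I : Type*} [Fintype I]

/-- The Hamiltonian action of a trigonometric loop. -/
def loopAction (J : E →L[ℝ] E) (H : E → ℝ) (κ : I → ℤ) (a : PiLp 2 fun _ : I => E) : ℝ :=
  π * ∑ i, κ i * ‖a i‖ ^ 2 - ∫ t in (0 : ℝ)..1, H (trigLoop J κ a t)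

/-- The gradient of the Hamiltonian action of a trigonometric loop. -/
def loopActionGrad (J : E →L[ℝ] E) (G : E → E) (κ : I → ℤ) (a : PiLp 2 fun _ : I => E) :
    PiLp 2 fun _ : I => E :=
  WithLp.toLp 2 fun i => (2 * π * κ i) • a i - rotCoeff J (fun t => G (trigLoop J κ a t)) (κ i)

theorem sum_norm_le_card_mul {I E : Type*} [Fintype I] [NormedAddCommGroup E] (a : PiLp 2 fun _ : I => E) :
    ∑ i, ‖a i‖ ≤ Fintype.card I * ‖a‖ := by
  have h := Finset.sum_le_card_nsmul Finset.univ (fun i => ‖a i‖) ‖a‖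
    fun i _ => PiLp.norm_apply_le a i
  simpa using h

theorem hasGradientAt_loopAction {J : E →L[ℝ] E} (hJ : ∀ x, J (J x) = -x)
    (hJs : ∀ x y, inner ℝ (J x) y = -inner ℝ x (J y)) {H : E → ℝ} {G : E → E}
    (hH : ∀ x, HasGradientAt H (G x) x) (hG : UniformContinuous G) (κ : I → ℤ)
    (a : PiLp 2 fun _ : I => E) :
    HasGradientAt (loopAction J H κ) (loopActionGrad J G κ a) a := by
  have hHc : Continuous H := continuous_iff_continuousAt.2 fun x =>
    (hH x).differentiableAt.continuousAt
  have hGc : Continuous G := hG.continuous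
  have key : ∀ h : PiLp 2 fun _ : I => E,
      loopAction J H κ (a + h) - loopAction J H κ a - inner ℝ (loopActionGrad J G κ a) h =
      π * ∑ i, κ i * ‖h i‖ ^ 2 - ∫ t in (0 : ℝ)..1, (H (trigLoop J κ a t + trigLoop J κ h t) -
        H (trigLoop J κ a t) - inner ℝ (G (trigLoop J κ a t)) (trigLoop J κ h t)) := by
    intro h
    rw [intervalIntegral.integral_sub, intervalIntegral.integral_sub,
      integral_inner_trigLoop hJs κ h (w := fun t => G (trigLoop J κ a t)) (by fun_prop)]
    rotate_left
    iterate 4 exact Continuous.intervalIntegrable (by fun_prop) _ _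
    simp only [loopAction, loopActionGrad, PiLp.inner_apply, WithLp.ofLp_add, trigLoop_add,
      inner_sub_left, Finset.sum_sub_distrib, Pi.add_apply, norm_add_sq_real, inner_smul_left,
      RCLike.conj_to_real, Finset.mul_sum, mul_add, Finset.sum_add_distrib]
    have : ∑ i, π * (κ i * (2 * inner ℝ (a i) (h i))) =
      ∑ i, 2 * π * κ i * inner ℝ (a i) (h i) := Finset.sum_congr rfl fun i _ => by ring
    rw [this]
    ring
  rw [hasGradientAt_iff_isLittleO, Asymptotics.isLittleO_iff]
  intro c hc
  set N : ℝ := Fintype.card I + 1 with hN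
  have hNpos : 0 < N := by positivity
  obtain ⟨δ, hδ, hδH⟩ := exists_uniform_gradient_bound hH hG (ε := c / (2 * N)) (by positivity)
  set K : ℝ := π * ∑ i, |(κ i : ℝ)| + 1 with hK
  have hK0 : 0 < K := by
    have := pi_pos
    have : 0 ≤ ∑ i, |(κ i : ℝ)| := Finset.sum_nonneg fun i _ => abs_nonneg _
    positivity
  have hball : ball a (min (δ / N) (c / (2 * K))) ∈ 𝓝 a :=
    ball_mem_nhds _ (lt_min (by positivity) (by positivity))
  filter_upwards [hball] with b hb
  obtain ⟨h, rfl⟩ : ∃ h, b = a + h := ⟨b - a, by abel⟩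
  rw [mem_ball, dist_eq_norm, add_sub_cancel_left] at hb
  rw [add_sub_cancel_left, key h, Real.norm_eq_abs]
  have hl : ∀ t, ‖trigLoop J κ h t‖ ≤ N * ‖h‖ := fun t =>
    (norm_trigLoop_le hJ hJs κ h t).trans ((sum_norm_le_card_mul h).trans (by
      rw [hN]; nlinarith [norm_nonneg h]))
  have h1 : |π * ∑ i, κ i * ‖h i‖ ^ 2| ≤ c / 2 * ‖h‖ := by
    have h2 : |∑ i, κ i * ‖h i‖ ^ 2| ≤ (∑ i, |(κ i : ℝ)|) * ‖h‖ ^ 2 := by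
      rw [Finset.sum_mul]
      refine (Finset.abs_sum_le_sum_abs _ _).trans (Finset.sum_le_sum fun i _ => ?_)
      rw [abs_mul, abs_of_nonneg (sq_nonneg ‖h i‖)]
      have := PiLp.norm_apply_le h i
      gcongr
    have h3 : ‖h‖ < c / (2 * K) := hb.trans_le (min_le_right _ _)
    rw [lt_div_iff₀ (by positivity)] at h3
    rw [abs_mul, abs_of_pos pi_pos]
    have h4 : π * |∑ i, κ i * ‖h i‖ ^ 2| ≤ π * ((∑ i, |(κ i : ℝ)|) * ‖h‖ ^ 2) :=
      mul_le_mul_of_nonneg_left h2 pi_pos.le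
    have h5 : π * ((∑ i, |(κ i : ℝ)|) * ‖h‖ ^ 2) = (K - 1) * ‖h‖ * ‖h‖ := by rw [hK]; ring
    nlinarith [norm_nonneg h]
  have h2 : |∫ t in (0 : ℝ)..1, (H (trigLoop J κ a t + trigLoop J κ h t) -
        H (trigLoop J κ a t) - inner ℝ (G (trigLoop J κ a t)) (trigLoop J κ h t))| ≤
      c / 2 * ‖h‖ := by
    have := intervalIntegral.norm_integral_le_of_norm_le_const (a := (0 : ℝ)) (b := 1)
      (C := c / 2 * ‖h‖) (f := fun t => (H (trigLoop J κ a t + trigLoop J κ h t) -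
        H (trigLoop J κ a t) - inner ℝ (G (trigLoop J κ a t)) (trigLoop J κ h t))) (by
      intro t _
      have h3 : ‖h‖ < δ / N := hb.trans_le (min_le_left _ _)
      rw [lt_div_iff₀ hNpos] at h3
      refine (hδH _ _ (by linarith [hl t])).trans ?_
      calc c / (2 * N) * ‖trigLoop J κ h t‖ ≤ c / (2 * N) * (N * ‖h‖) := by gcongr; exact hl t
        _ = c / 2 * ‖h‖ := by field_simp)
    simpa using this
  refine (abs_sub _ _).trans ?_
  linarith

theorem uniformContinuous_loopActionGrad {E : Type*} [NormedAddCommGroup E]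
    [InnerProductSpace ℝ E] {J : E →L[ℝ] E} (hJ : ∀ x, J (J x) = -x)
    (hJs : ∀ x y, inner ℝ (J x) y = -inner ℝ x (J y)) {G : E → E} (hG : UniformContinuous G)
    (κ : I → ℤ) : UniformContinuous (loopActionGrad J G κ) := by
  have hGc : Continuous G := hG.continuous
  refine (PiLp.uniformContinuous_toLp 2 _).comp (uniformContinuous_pi.2 fun i => ?_)
  have hproj : UniformContinuous fun a : PiLp 2 fun _ : I => E => a i :=
    ((uniformContinuous_pi.1 (PiLp.uniformContinuous_ofLp 2 fun _ : I => E)) i)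
  refine (hproj.const_smul _).sub (Metric.uniformContinuous_iff.2 fun ε hε => ?_)
  obtain ⟨δ, hδ, hδG⟩ := Metric.uniformContinuous_iff.1 hG (ε / 2) (half_pos hε)
  have hNpos : (0 : ℝ) < Fintype.card I + 1 := by positivity
  refine ⟨δ / (Fintype.card I + 1), by positivity, fun {a b} hab => ?_⟩
  rw [dist_eq_norm] at hab ⊢
  have hl : ∀ t, dist (trigLoop J κ a t) (trigLoop J κ b t) < δ := fun t => by
    rw [dist_eq_norm, ← trigLoop_sub]
    refine (norm_trigLoop_le hJ hJs κ _ t).trans_lt ((sum_norm_le_card_mul (a - b)).trans_lt ?_)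
    rw [lt_div_iff₀ hNpos] at hab
    nlinarith [norm_nonneg (a - b)]
  rw [rotCoeff, rotCoeff, ← intervalIntegral.integral_sub
    (Continuous.intervalIntegrable (by fun_prop) _ _)
    (Continuous.intervalIntegrable (by fun_prop) _ _)]
  have := intervalIntegral.norm_integral_le_of_norm_le_const (a := (0 : ℝ)) (b := 1)
      (C := ε / 2) (f := fun t => rot J (-(2 * π * κ i * t)) (G (trigLoop J κ a t)) -
        rot J (-(2 * π * κ i * t)) (G (trigLoop J κ b t))) (by
    intro t _
    rw [← map_sub, norm_rot hJ hJs, ← dist_eq_norm]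
    exact (hδG (hl t)).le)
  simp only [sub_zero, abs_one, mul_one] at this
  linarith

/-- Splitting of the gradient into its linear part at infinity and a bounded part. -/
theorem loopActionGrad_apply {J : E →L[ℝ] E} (hJ : ∀ x, J (J x) = -x) {G : E → E}
    (hGc : Continuous G) {κ : I → ℤ} (hκ : Function.Injective κ) (q : ℝ)
    (a : PiLp 2 fun _ : I => E) (i : I) :
    loopActionGrad J G κ a i = (2 * π * κ i - 2 * q) • a i -
      rotCoeff J (fun t => G (trigLoop J κ a t) - (2 * q) • trigLoop J κ a t) (κ i) := by
  have h1 : rotCoeff J (fun t => G (trigLoop J κ a t) - (2 * q) • trigLoop J κ a t) (κ i) =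
      rotCoeff J (fun t => G (trigLoop J κ a t)) (κ i) - (2 * q) • a i := by
    conv_rhs => rw [← rotCoeff_trigLoop hJ hκ a i]
    rw [rotCoeff, rotCoeff, rotCoeff, ← intervalIntegral.integral_smul,
      ← intervalIntegral.integral_sub (Continuous.intervalIntegrable (by fun_prop) _ _)
      (Continuous.intervalIntegrable (by fun_prop) _ _)]
    simp
  rw [h1, loopActionGrad, sub_smul]
  simp only
  abel

theorem norm_rotCoeff_vector_le {J : E →L[ℝ] E} (hJ : ∀ x, J (J x) = -x)
    (hJs : ∀ x y, inner ℝ (J x) y = -inner ℝ x (J y)) {κ : I → ℤ}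
    (hκ : Function.Injective κ) {w : ℝ → E} (hw : Continuous w) {C : ℝ} (hC : ∀ t, ‖w t‖ ≤ C) :
    ‖(WithLp.toLp 2 fun i => rotCoeff J w (κ i) : PiLp 2 fun _ : I => E)‖ ≤ C := by
  have hC0 : 0 ≤ C := (norm_nonneg _).trans (hC 0)
  have := sum_norm_sq_rotCoeff_le hJ hJs hκ hw hC
  rw [PiLp.norm_eq_of_L2]
  exact Real.sqrt_le_iff.2 ⟨hC0, this⟩

theorem le_norm_loopActionGrad {J : E →L[ℝ] E} (hJ : ∀ x, J (J x) = -x)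
    (hJs : ∀ x y, inner ℝ (J x) y = -inner ℝ x (J y)) {G : E → E}
    (hGc : Continuous G) {κ : I → ℤ} (hκ : Function.Injective κ) {q C d : ℝ} (hd : 0 ≤ d)
    (hdq : ∀ k : ℤ, d ≤ |2 * π * k - 2 * q|) (hC : ∀ x, ‖G x - (2 * q) • x‖ ≤ C)
    (a : PiLp 2 fun _ : I => E) : d * ‖a‖ - C ≤ ‖loopActionGrad J G κ a‖ := by
  set w : ℝ → E := fun t => G (trigLoop J κ a t) - (2 * q) • trigLoop J κ a t with hw
  have h1 : loopActionGrad J G κ a = (WithLp.toLp 2 fun i => (2 * π * κ i - 2 * q) • a i) -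
      (WithLp.toLp 2 fun i => rotCoeff J w (κ i)) := by
    ext i
    exact loopActionGrad_apply hJ hGc hκ q a i
  have h2 : d * ‖a‖ ≤ ‖(WithLp.toLp 2 fun i => (2 * π * κ i - 2 * q) • a i :
      PiLp 2 fun _ : I => E)‖ := by
    rw [← abs_of_nonneg hd, ← Real.norm_eq_abs, ← norm_smul, PiLp.norm_eq_of_L2,
      PiLp.norm_eq_of_L2]
    refine Real.sqrt_le_sqrt (Finset.sum_le_sum fun i _ => ?_)
    simp only [PiLp.smul_apply, norm_smul, Real.norm_eq_abs, abs_of_nonneg hd]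
    gcongr
    exact hdq _
  have h3 := norm_rotCoeff_vector_le hJ hJs hκ (w := w) (by fun_prop) fun t => hC _
  rw [h1]
  refine le_trans ?_ (norm_sub_norm_le _ _)
  linarith

end ActionFunctional

section LoopCritical

open MeasureTheory Metric Set Filter Topology

variable {E : Type*} [NormedAddCommGroup E] [InnerProductSpace ℝ E] [CompleteSpace E]
variable {I : Type} [Fintype I]

/-- The action is bounded above by its quadratic part at infinity. -/
theorem loopAction_le_of_quadratic {J : E →L[ℝ] E} (hJ : ∀ x, J (J x) = -x)
    (hJs : ∀ x y, inner ℝ (J x) y = -inner ℝ x (J y)) {H : E → ℝ} (hHc : Continuous H)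
    {κ : I → ℤ} (hκ : Function.Injective κ) {q C : ℝ} (hq : ∀ z, q * ‖z‖ ^ 2 - C ≤ H z)
    (a : PiLp 2 fun _ : I => E) :
    loopAction J H κ a ≤ ∑ i, (π * κ i - q) * ‖a i‖ ^ 2 + C := by
  have h1 : ∫ t in (0 : ℝ)..1, (q * ‖trigLoop J κ a t‖ ^ 2 - C) ≤
      ∫ t in (0 : ℝ)..1, H (trigLoop J κ a t) :=
    intervalIntegral.integral_mono_on zero_le_one
      (Continuous.intervalIntegrable (by fun_prop) _ _)
      (Continuous.intervalIntegrable (by fun_prop) _ _) fun t _ => hq _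
  rw [intervalIntegral.integral_sub (Continuous.intervalIntegrable (by fun_prop) _ _)
    (Continuous.intervalIntegrable (by fun_prop) _ _), intervalIntegral.integral_const_mul,
    integral_norm_sq_trigLoop hJ hJs hκ] at h1
  simp only [intervalIntegral.integral_const, sub_zero, one_smul] at h1
  simp only [loopAction, sub_mul, Finset.sum_sub_distrib, mul_assoc, ← Finset.mul_sum]
  linarith

/-- Lower bound for the action on a small sphere of positive modes. -/
theorem le_loopAction_of_small {J : E →L[ℝ] E} (hJ : ∀ x, J (J x) = -x)
    (hJs : ∀ x y, inner ℝ (J x) y = -inner ℝ x (J y)) {H : E → ℝ} (hHc : Continuous H)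
    {κ : I → ℤ} (hκ : Function.Injective κ) {r C : ℝ} (hr : 0 < r) (hC : 0 ≤ C)
    (hH0 : ∀ z, ‖z‖ ≤ r → H z = 0) (hHC : ∀ z, H z ≤ C * ‖z‖ ^ 2) {K : ℕ} (hK : 0 < K)
    (hKC : 8 * C ≤ π * K) (a : PiLp 2 fun _ : I => E) (ha0 : ∀ i, κ i ≤ 0 → a i = 0)
    (ha : ∑ i, max (κ i : ℝ) 0 * ‖a i‖ ^ 2 = (r / (2 * K)) ^ 2) :
    π / 2 * (r / (2 * K)) ^ 2 ≤ loopAction J H κ a := by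
  classical
  set α := r / (2 * K) with hα
  have hKpos : (0 : ℝ) < K := by exact_mod_cast hK
  set low : I → E := fun i => if κ i < K then a i else 0 with hlow
  set high : I → E := fun i => if κ i < K then 0 else a i with hhigh
  have hsplit : ∀ t, trigLoop J κ a t = trigLoop J κ low t + trigLoop J κ high t := by
    intro t
    rw [← trigLoop_add]
    congr 1
    ext i
    simp only [hlow, hhigh, Pi.add_apply]
    split_ifs <;> simp
  have hsum : ∑ i, κ i * ‖a i‖ ^ 2 = α ^ 2 := by
    rw [← ha]
    refine Finset.sum_congr rfl fun i _ => ?_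
    rcases le_or_gt (κ i) 0 with h | h
    · simp [ha0 i h]
    · rw [max_eq_left (by exact_mod_cast h.le)]
  have hnn : ∀ i, 0 ≤ (κ i : ℝ) * ‖a i‖ ^ 2 := by
    intro i
    rcases le_or_gt (κ i) 0 with h | h
    · simp [ha0 i h]
    · have : (0 : ℝ) < κ i := by exact_mod_cast h
      positivity
  have hhighsq : ∑ i, ‖high i‖ ^ 2 ≤ α ^ 2 / K := by
    rw [le_div_iff₀ hKpos, Finset.sum_mul, ← hsum]
    refine Finset.sum_le_sum fun i _ => ?_
    simp only [hhigh]
    split_ifs with h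
    · simpa using hnn i
    · have : (K : ℝ) ≤ κ i := by exact_mod_cast not_lt.1 h
      rw [mul_comm]
      gcongr
  have hlowsum : ∑ i, ‖low i‖ ≤ r / 2 := by
    set A : Finset I := Finset.univ.filter fun i => 0 < κ i ∧ κ i < K with hA
    have h1 : ∑ i, ‖low i‖ = ∑ i ∈ A, ‖a i‖ := by
      rw [hA, Finset.sum_filter]
      refine Finset.sum_congr rfl fun i _ => ?_
      simp only [hlow]
      rcases le_or_gt (κ i) 0 with h | h
      · simp [ha0 i h]
      · by_cases h' : κ i < K <;> simp [h, h']
    have hcard : A.card ≤ K := by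
      have h2 : (A.image κ) ⊆ Finset.Ioo (0 : ℤ) K := by
        intro k hk
        obtain ⟨i, hi, rfl⟩ := Finset.mem_image.1 hk
        simpa [hA] using hi
      have h3 := Finset.card_le_card h2
      rw [Finset.card_image_of_injective _ hκ, Int.card_Ioo] at h3
      omega
    have h2 : (∑ i ∈ A, ‖a i‖) ^ 2 ≤ (K * α) ^ 2 := by
      calc (∑ i ∈ A, ‖a i‖) ^ 2 ≤ A.card * ∑ i ∈ A, ‖a i‖ ^ 2 := sq_sum_le_card_mul_sum_sq
        _ ≤ K * ∑ i ∈ A, κ i * ‖a i‖ ^ 2 := by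
          gcongr with i hi
          have h3 : (1 : ℝ) ≤ κ i := by
            have := (Finset.mem_filter.1 hi).2.1
            exact_mod_cast this
          nlinarith [sq_nonneg ‖a i‖]
        _ ≤ K * ∑ i, κ i * ‖a i‖ ^ 2 := by
          gcongr
          · exact fun i _ _ => hnn i
          · exact Finset.subset_univ _
        _ = K * α ^ 2 := by rw [hsum]
        _ ≤ (K * α) ^ 2 := by
          have : (1 : ℝ) ≤ K := by exact_mod_cast hK
          rw [mul_pow]
          gcongr
          nlinarith
    rw [h1]
    have h3 : (K : ℝ) * α = r / 2 := by rw [hα]; field_simp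
    rw [h3] at h2
    exact (sq_le_sq₀ (Finset.sum_nonneg fun i _ => norm_nonneg _) (by positivity)).1 h2
  have hpt : ∀ t, H (trigLoop J κ a t) ≤ 4 * C * ‖trigLoop J κ high t‖ ^ 2 := by
    intro t
    rcases le_or_gt ‖trigLoop J κ a t‖ r with h | h
    · rw [hH0 _ h]; positivity
    · refine (hHC _).trans ?_
      have h1 := (norm_trigLoop_le hJ hJs κ low t).trans hlowsum
      have h2 : ‖trigLoop J κ a t‖ ≤ ‖trigLoop J κ low t‖ + ‖trigLoop J κ high t‖ := by
        rw [hsplit t]; exact norm_add_le _ _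
      have h3 : ‖trigLoop J κ a t‖ ≤ 2 * ‖trigLoop J κ high t‖ := by linarith
      calc C * ‖trigLoop J κ a t‖ ^ 2 ≤ C * (2 * ‖trigLoop J κ high t‖) ^ 2 := by gcongr
        _ = _ := by ring
  have h_integral : ∫ t in (0 : ℝ)..1, H (trigLoop J κ a t) ≤ 4 * C * (α ^ 2 / K) := by
    have h1 : ∫ t in (0 : ℝ)..1, H (trigLoop J κ a t) ≤
        ∫ t in (0 : ℝ)..1, 4 * C * ‖trigLoop J κ high t‖ ^ 2 :=
      intervalIntegral.integral_mono_on zero_le_one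
        (Continuous.intervalIntegrable (by fun_prop) _ _)
        (Continuous.intervalIntegrable (by fun_prop) _ _) fun t _ => hpt t
    rw [intervalIntegral.integral_const_mul, integral_norm_sq_trigLoop hJ hJs hκ] at h1
    exact h1.trans (by gcongr)
  have h5 : 4 * C * (α ^ 2 / K) ≤ π / 2 * α ^ 2 := by
    rw [← mul_div_assoc, div_le_iff₀ hKpos]
    nlinarith [sq_nonneg α]
  rw [loopAction, hsum]
  linarith

theorem exists_dist_two_pi_int {q : ℝ} (hq1 : π < q) (hq2 : q < 2 * π) :
    ∃ d > 0, ∀ k : ℤ, d ≤ |2 * π * k - 2 * q| := by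
  refine ⟨min (2 * q - 2 * π) (4 * π - 2 * q), lt_min (by linarith) (by linarith), fun k => ?_⟩
  rcases le_or_gt k 1 with h | h
  · refine (min_le_left _ _).trans (le_abs.2 (Or.inr ?_))
    have : (k : ℝ) ≤ 1 := by exact_mod_cast h
    nlinarith [pi_pos]
  · refine (min_le_right _ _).trans (le_abs.2 (Or.inl ?_))
    have : (2 : ℝ) ≤ k := by exact_mod_cast h
    nlinarith [pi_pos]

theorem exists_critical_trigLoop [FiniteDimensional ℝ E] [Nontrivial E]
    {J : E →L[ℝ] E} (hJ : ∀ x, J (J x) = -x)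
    (hJs : ∀ x y, inner ℝ (J x) y = -inner ℝ x (J y)) {H : E → ℝ} {G : E → E}
    (hH : ∀ x, HasGradientAt H (G x) x) (hG : UniformContinuous G)
    (hHnn : ∀ z, 0 ≤ H z) {r C q : ℝ} (hr : 0 < r) (hC : 0 ≤ C)
    (hH0 : ∀ z, ‖z‖ ≤ r → H z = 0) (hHC : ∀ z, H z ≤ C * ‖z‖ ^ 2)
    (hq1 : π < q) (hq2 : q < 2 * π) (hHq : ∀ z, q * ‖z‖ ^ 2 - C ≤ H z)
    (hGq : ∀ z, ‖G z - (2 * q) • z‖ ≤ C) :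
    ∃ η > 0, ∀ {I : Type} [Fintype I] (κ : I → ℤ), Function.Injective κ → (∃ i, κ i = 1) →
      ∃ a : PiLp 2 fun _ : I => E, loopActionGrad J G κ a = 0 ∧ η ≤ loopAction J H κ a := by
  classical
  have hHc : Continuous H := continuous_iff_continuousAt.2 fun x =>
    (hH x).differentiableAt.continuousAt
  have hpi := pi_pos
  obtain ⟨K, hKC⟩ := exists_nat_gt (8 * C / π + 1)
  have hK : 0 < K := by
    have : (0 : ℝ) < K := lt_of_le_of_lt (by positivity) hKC
    exact_mod_cast this
  have hKpos : (0 : ℝ) < K := by exact_mod_cast hK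
  have hKC' : 8 * C ≤ π * K := by
    have : 8 * C / π ≤ K := by linarith
    rw [div_le_iff₀ hpi] at this
    linarith
  set α := r / (2 * K) with hα
  have hαpos : 0 < α := by positivity
  obtain ⟨d, hd, hdq⟩ := exists_dist_two_pi_int hq1 hq2
  refine ⟨π / 4 * α ^ 2, by positivity, fun {I} _ κ hκ ⟨i₁, hi₁⟩ => ?_⟩
  obtain ⟨e, he⟩ := exists_norm_eq E zero_le_one
  set τ := 1 + α + C / q + C / (q - π) with hτ
  have hqp : 0 < q - π := by linarith
  have hq0 : 0 < q := by linarith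
  have hC1 : 0 ≤ C / q := by positivity
  have hC2 : 0 ≤ C / (q - π) := by positivity
  have hτ1 : 1 ≤ τ := by linarith
  have hτq : C ≤ q * τ ^ 2 := by
    have : C / q ≤ τ ^ 2 := by nlinarith
    rwa [div_le_iff₀ hq0, mul_comm] at this
  have hτq' : C ≤ (q - π) * τ ^ 2 := by
    have : C / (q - π) ≤ τ ^ 2 := by nlinarith
    rwa [div_le_iff₀ hqp, mul_comm] at this
  refine exists_critical_point_of_linking
    (W := PiLp 2 fun _ : {i : I // κ i ≤ 0} => E)
    (fun p => WithLp.toLp 2 fun i => if h : κ i ≤ 0 then p.1 ⟨i, h⟩ else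
      if i = i₁ then p.2 • e else 0) ?_
    (fun a => (WithLp.toLp 2 fun j => a j.1, √(∑ i, max (κ i : ℝ) 0 * ‖a i‖ ^ 2))) ?_ ?_
    (loopAction J H κ) (loopActionGrad J G κ) (hasGradientAt_loopAction hJ hJs hH hG κ)
    (uniformContinuous_loopActionGrad hJ hJs hG κ) hd
    (le_norm_loopActionGrad hJ hJs hG.continuous hκ hd.le hdq hGq) (τ := τ) hαpos (by linarith)
    ?_ (by positivity) ?_
  · refine (PiLp.continuous_toLp 2 _).comp (continuous_pi fun i => ?_)
    split_ifs <;> fun_prop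
  · fun_prop
  · intro w s hs
    refine Prod.ext ?_ ?_
    · ext j
      simp [j.2]
    · simp only
      rw [Finset.sum_eq_single i₁]
      · simp [hi₁, norm_smul, he, Real.sqrt_sq hs]
      · intro i _ hi
        by_cases h : κ i ≤ 0
        · rw [max_eq_right (by exact_mod_cast h)]; simp
        · simp [h, hi]
      · simp
  · intro w s hw hs0 hs2 hcase
    set a : PiLp 2 fun _ : I => E := WithLp.toLp 2 fun i => if h : κ i ≤ 0 then w ⟨i, h⟩ else
      if i = i₁ then s • e else 0 with ha
    have hai : ∀ i, a i = if h : κ i ≤ 0 then w ⟨i, h⟩ else if i = i₁ then s • e else 0 :=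
      fun i => rfl
    by_cases hs : s = 0
    · have h1 : ∑ i, κ i * ‖a i‖ ^ 2 ≤ 0 := by
        refine Finset.sum_nonpos fun i _ => ?_
        by_cases h : κ i ≤ 0
        · exact mul_nonpos_of_nonpos_of_nonneg (by exact_mod_cast h) (sq_nonneg _)
        · simp [hai, h, hs]
      have h2 : 0 ≤ ∫ t in (0 : ℝ)..1, H (trigLoop J κ a t) :=
        intervalIntegral.integral_nonneg zero_le_one fun t _ => hHnn _
      show loopAction J H κ a ≤ 0
      rw [loopAction]
      nlinarith
    · have h1 := loopAction_le_of_quadratic hJ hJs hHc hκ hHq a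
      set u : I → ℝ := fun i => if h : κ i ≤ 0 then ‖w ⟨i, h⟩‖ ^ 2 else 0 with hu
      have hsumu : ∑ i, u i = ‖w‖ ^ 2 := by
        rw [PiLp.norm_sq_eq_of_L2]
        have h3 : ∑ i, u i = ∑ i ∈ Finset.univ.filter (fun i => κ i ≤ 0), u i := by
          rw [Finset.sum_filter]
          refine Finset.sum_congr rfl fun i _ => ?_
          split_ifs with h
          · rfl
          · simp [hu, h]
        rw [h3, Finset.sum_subtype (p := fun i => κ i ≤ 0) _ (by simp)]
        refine Finset.sum_congr rfl fun j _ => ?_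
        simp [hu, j.2]
      have h2 : ∑ i, (π * κ i - q) * ‖a i‖ ^ 2 ≤
          ∑ i, (-q * u i + if i = i₁ then (π - q) * s ^ 2 else 0) := by
        refine Finset.sum_le_sum fun i _ => ?_
        by_cases h : κ i ≤ 0
        · have h4 : i ≠ i₁ := by rintro rfl; omega
          have h5 : (κ i : ℝ) ≤ 0 := by exact_mod_cast h
          simp only [hai, hu, h, dif_pos, h4, if_false, add_zero]
          have h6 : π * κ i ≤ 0 := mul_nonpos_of_nonneg_of_nonpos hpi.le h5
          nlinarith [sq_nonneg ‖w ⟨i, h⟩‖]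
        · by_cases h4 : i = i₁
          · subst h4
            simp [hai, hu, hi₁, norm_smul, he]
          · simp [hai, hu, h, h4]
      rw [Finset.sum_add_distrib, ← Finset.mul_sum, hsumu] at h2
      simp only [Finset.sum_ite_eq', Finset.mem_univ, if_true] at h2
      show loopAction J H κ a ≤ 0
      rcases hcase with h | h | h
      · rw [h] at h2
        nlinarith [sq_nonneg s]
      · exact absurd h hs
      · rw [h] at h2
        nlinarith [sq_nonneg ‖w‖, sq_nonneg τ]
  · intro a ha
    have h1 := congrArg Prod.fst ha
    have h2 := congrArg Prod.snd ha
    simp only at h1 h2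
    have h3 : ∑ i, max (κ i : ℝ) 0 * ‖a i‖ ^ 2 = α ^ 2 := by
      rw [← h2, Real.sq_sqrt]
      exact Finset.sum_nonneg fun i _ => mul_nonneg (le_max_right _ _) (sq_nonneg _)
    have h4 : ∀ i, κ i ≤ 0 → a i = 0 := by
      intro i hi
      have := congrArg (fun w : PiLp 2 fun _ : {i : I // κ i ≤ 0} => E => w ⟨i, hi⟩) h1
      simpa using this
    have := le_loopAction_of_small hJ hJs hHc hκ hr hC hH0 hHC hK hKC' a h4 h3
    linarith

end LoopCritical

section FourierODE

open MeasureTheory Metric Set Filter Topology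

/-- A continuous real function of period one with vanishing nonconstant Fourier coefficients
is constant. -/
theorem eq_of_integral_cos_sin_eq_zero {f : ℝ → ℝ} (hf : Continuous f)
    (hper : Function.Periodic f 1)
    (hcos : ∀ k : ℤ, k ≠ 0 → ∫ t in (0 : ℝ)..1, cos (2 * π * k * t) * f t = 0)
    (hsin : ∀ k : ℤ, k ≠ 0 → ∫ t in (0 : ℝ)..1, sin (2 * π * k * t) * f t = 0) (s t : ℝ) :
    f s = f t := by
  have hper' : Function.Periodic (fun t => (f t : ℂ)) 1 := fun t => by simp [hper t]
  set F : C(AddCircle (1 : ℝ), ℂ) :=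
    ⟨hper'.lift, continuous_coinduced_dom.2 (by exact Complex.continuous_ofReal.comp hf)⟩ with hF
  have hFc : ∀ t : ℝ, F (t : AddCircle (1 : ℝ)) = f t := fun t => rfl
  have hcoef : ∀ k : ℤ, k ≠ 0 → fourierCoeff F k = 0 := by
    intro k hk
    rw [fourierCoeff_eq_intervalIntegral F k 0]
    have h1 : ∀ t : ℝ, (fourier (-k) (t : AddCircle (1 : ℝ)) : ℂ) • F (t : AddCircle (1 : ℝ)) =
        ((cos (2 * π * k * t) * f t : ℝ) : ℂ) -
          Complex.I * ((sin (2 * π * k * t) * f t : ℝ) : ℂ) := by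
      intro t
      rw [fourier_coe_apply, hFc]
      have : 2 * (π : ℂ) * Complex.I * ((-k : ℤ) : ℂ) * (t : ℂ) / ((1 : ℝ) : ℂ) =
          -((2 * π * k * t : ℝ) : ℂ) * Complex.I := by push_cast; ring
      rw [this, Complex.exp_mul_I, Complex.cos_neg, Complex.sin_neg, ← Complex.ofReal_cos,
        ← Complex.ofReal_sin, smul_eq_mul]
      push_cast
      ring
    simp_rw [h1]
    rw [intervalIntegral.integral_sub (Continuous.intervalIntegrable (by fun_prop) _ _)
      (Continuous.intervalIntegrable (by fun_prop) _ _), intervalIntegral.integral_const_mul,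
      intervalIntegral.integral_ofReal, intervalIntegral.integral_ofReal, zero_add, hcos k hk,
      hsin k hk]
    simp
  have hconst : ∀ t : ℝ, F (t : AddCircle (1 : ℝ)) = fourierCoeff F 0 := by
    intro t
    have hsum : Summable (fourierCoeff F) :=
      summable_of_ne_finset_zero (s := {0}) fun k hk => hcoef k (by simpa using hk)
    have h1 := has_pointwise_sum_fourier_series_of_summable hsum (t : AddCircle (1 : ℝ))
    have h2 := hasSum_single (f := fun i => fourierCoeff F i • (fourier i
      (t : AddCircle (1 : ℝ)) : ℂ)) 0 fun k hk => by rw [hcoef k hk, zero_smul]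
    rw [h1.unique h2]
    simp
  have := (hconst s).trans (hconst t).symm
  rw [hFc, hFc] at this
  exact_mod_cast this

variable {E : Type*} [NormedAddCommGroup E] [InnerProductSpace ℝ E] [CompleteSpace E]

theorem eq_of_rotCoeff_eq_zero {J : E →L[ℝ] E} (hJ : ∀ x, J (J x) = -x) {u : ℝ → E}
    (hu : Continuous u) (hper : Function.Periodic u 1)
    (h0 : ∀ k : ℤ, k ≠ 0 → rotCoeff J u k = 0) (s t : ℝ) : u s = u t := by
  have hcos : ∀ k : ℤ, k ≠ 0 → ∫ t in (0 : ℝ)..1, cos (2 * π * k * t) • u t = 0 := by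
    intro k hk
    have h1 : rotCoeff J u k + rotCoeff J u (-k) =
        (2 : ℝ) • ∫ t in (0 : ℝ)..1, cos (2 * π * k * t) • u t := by
      rw [rotCoeff, rotCoeff, ← intervalIntegral.integral_smul,
        ← intervalIntegral.integral_add (Continuous.intervalIntegrable (by fun_prop) _ _)
        (Continuous.intervalIntegrable (by fun_prop) _ _)]
      refine intervalIntegral.integral_congr fun t _ => ?_
      have e1 : -(2 * π * ((-k : ℤ) : ℝ) * t) = 2 * π * k * t := by push_cast; ring
      simp only [rot_apply, e1, cos_neg, sin_neg]
      module
    rw [h0 k hk, h0 (-k) (neg_ne_zero.2 hk), add_zero, eq_comm, smul_eq_zero] at h1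
    exact h1.resolve_left two_ne_zero
  have hsin : ∀ k : ℤ, k ≠ 0 → ∫ t in (0 : ℝ)..1, sin (2 * π * k * t) • u t = 0 := by
    intro k hk
    have h1 : rotCoeff J u (-k) - rotCoeff J u k =
        J ((2 : ℝ) • ∫ t in (0 : ℝ)..1, sin (2 * π * k * t) • u t) := by
      rw [rotCoeff, rotCoeff, ← intervalIntegral.integral_smul,
        ← intervalIntegral.integral_sub (Continuous.intervalIntegrable (by fun_prop) _ _)
        (Continuous.intervalIntegrable (by fun_prop) _ _),
        ← J.intervalIntegral_comp_comm (Continuous.intervalIntegrable (by fun_prop) _ _)]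
      refine intervalIntegral.integral_congr fun t _ => ?_
      have e1 : -(2 * π * ((-k : ℤ) : ℝ) * t) = 2 * π * k * t := by push_cast; ring
      simp only [rot_apply, e1, cos_neg, sin_neg, map_smul]
      module
    rw [h0 k hk, h0 (-k) (neg_ne_zero.2 hk), sub_zero] at h1
    have h2 := congrArg J h1
    rw [hJ, map_zero, eq_comm, neg_eq_zero, smul_eq_zero] at h2
    exact h2.resolve_left two_ne_zero
  refine ext_inner_left ℝ fun v => ?_
  refine eq_of_integral_cos_sin_eq_zero (f := fun t => inner ℝ v (u t)) (by fun_prop)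
    (fun t => by simp only [hper t]) (fun k hk => ?_) (fun k hk => ?_) s t
  · have := (innerSL ℝ v).intervalIntegral_comp_comm (μ := volume) (a := (0 : ℝ)) (b := 1)
      (f := fun t => cos (2 * π * k * t) • u t) (Continuous.intervalIntegrable (by fun_prop) _ _)
    rw [hcos k hk, map_zero] at this
    refine Eq.trans ?_ this
    refine intervalIntegral.integral_congr fun t _ => ?_
    simp
  · have := (innerSL ℝ v).intervalIntegral_comp_comm (μ := volume) (a := (0 : ℝ)) (b := 1)
      (f := fun t => sin (2 * π * k * t) • u t) (Continuous.intervalIntegrable (by fun_prop) _ _)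
    rw [hsin k hk, map_zero] at this
    refine Eq.trans ?_ this
    refine intervalIntegral.integral_congr fun t _ => ?_
    simp

/-- A loop whose Fourier coefficients satisfy the equation `x' = J w` mode by mode solves it. -/
theorem hasDerivAt_of_rotCoeff {J : E →L[ℝ] E} (hJ : ∀ x, J (J x) = -x) {y w : ℝ → E}
    (hy : Continuous y) (hw : Continuous w) (hyp : Function.Periodic y 1)
    (hwp : Function.Periodic w 1)
    (h : ∀ k : ℤ, (2 * π * k) • rotCoeff J y k = rotCoeff J w k) (t : ℝ) :
    HasDerivAt y (J (w t)) t := by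
  set Y : ℝ → E := fun t => ∫ s in (0 : ℝ)..t, J (w s) with hYdef
  have hY : ∀ t, HasDerivAt Y (J (w t)) t := fun t =>
    intervalIntegral.integral_hasDerivAt_right (Continuous.intervalIntegrable (by fun_prop) _ _)
      ((by fun_prop : Continuous fun s => J (w s)).stronglyMeasurableAtFilter _ _) (by fun_prop)
  have hYc : Continuous Y := continuous_iff_continuousAt.2 fun t => (hY t).continuousAt
  have hY1 : Y 1 = 0 := by
    have h1 := h 0
    simp only [Int.cast_zero, mul_zero, zero_smul, rotCoeff, zero_mul, neg_zero, rot_zero] at h1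
    rw [hYdef]
    simp only
    rw [J.intervalIntegral_comp_comm (Continuous.intervalIntegrable (by fun_prop) _ _), ← h1,
      map_zero]
  have hYp : Function.Periodic Y 1 := by
    intro t
    have h1 : Function.Periodic (fun s => J (w s)) 1 := fun s => by simp only [hwp s]
    have h2 := h1.intervalIntegral_add_eq t 0
    rw [zero_add] at h2
    have h3 := intervalIntegral.integral_add_adjacent_intervals (μ := volume)
      (f := fun s => J (w s)) (a := 0) (b := t) (c := t + 1)
      (Continuous.intervalIntegrable (by fun_prop) _ _)
      (Continuous.intervalIntegrable (by fun_prop) _ _)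
    rw [h2] at h3
    simp only [hYdef]
    rw [← h3]
    have : ∫ s in (0 : ℝ)..1, J (w s) = 0 := hY1
    rw [this, add_zero]
  have hYcoef : ∀ k : ℤ, (2 * π * k) • rotCoeff J Y k = rotCoeff J w k := by
    intro k
    set c : ℝ := 2 * π * k with hc
    have hd : ∀ t ∈ uIcc (0 : ℝ) 1, HasDerivAt (fun t => rot J (-(c * t)) (Y t))
        (J (rot J (-(c * t)) (w t)) - c • J (rot J (-(c * t)) (Y t))) t := by
      intro t _
      simp only [rot_apply, map_add, map_smul, hJ, cos_neg, sin_neg]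
      have h0 : HasDerivAt (fun t : ℝ => c * t) c t := by simpa using (hasDerivAt_id t).const_mul c
      have h1 := ((hasDerivAt_cos (c * t)).comp t h0).smul (hY t)
      have h2 := (((hasDerivAt_sin (c * t)).comp t h0).neg).smul
        (J.hasFDerivAt.comp_hasDerivAt t (hY t))
      refine (h1.add h2).congr_deriv ?_
      simp only [Function.comp_apply, Pi.neg_apply, hJ]
      module
    have h1 := intervalIntegral.integral_eq_sub_of_hasDerivAt hd
      (Continuous.intervalIntegrable (by fun_prop) _ _)
    have h2 : Y 0 = 0 := by simp [hYdef]
    rw [hY1, h2, map_zero, map_zero, sub_zero, intervalIntegral.integral_sub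
      (Continuous.intervalIntegrable (by fun_prop) _ _)
      (Continuous.intervalIntegrable (by fun_prop) _ _), intervalIntegral.integral_smul,
      J.intervalIntegral_comp_comm (Continuous.intervalIntegrable (by fun_prop) _ _),
      J.intervalIntegral_comp_comm (Continuous.intervalIntegrable (by fun_prop) _ _),
      ← map_smul, sub_eq_zero] at h1
    have h3 := congrArg J h1
    rw [hJ, hJ, neg_inj] at h3
    exact h3.symm
  have hu := eq_of_rotCoeff_eq_zero hJ (u := fun t => y t - Y t) (by fun_prop)
    (fun t => by simp only [hyp t, hYp t]) (fun k hk => by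
      have hk' : (2 * π * k : ℝ) ≠ 0 := by
        have : (k : ℝ) ≠ 0 := by exact_mod_cast hk
        have := pi_ne_zero
        positivity
      have h1 : rotCoeff J (fun t => y t - Y t) k = rotCoeff J y k - rotCoeff J Y k := by
        simp only [rotCoeff, map_sub]
        rw [intervalIntegral.integral_sub (Continuous.intervalIntegrable (by fun_prop) _ _)
          (Continuous.intervalIntegrable (by fun_prop) _ _)]
      rw [h1, sub_eq_zero]
      refine smul_right_injective E hk' ?_
      simp only
      rw [h k, hYcoef k])
  have hy' : y = fun t => Y t + (y 0 - Y 0) := by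
    funext t
    have := hu t 0
    rw [← this]
    abel
  rw [hy']
  exact (hY t).add_const _

end FourierODE

section PeriodicOrbit

open MeasureTheory Metric Set Filter Topology

/-- A pointwise version of the Arzelà–Ascoli theorem on the line. -/
theorem exists_pointwise_limit_of_equicontinuous {E : Type*} [NormedAddCommGroup E]
    [NormedSpace ℝ E] [FiniteDimensional ℝ E] {x : ℕ → ℝ → E} {B : ℝ} (hB : ∀ n t, ‖x n t‖ ≤ B)
    (hx : ∀ ε > 0, ∃ δ > 0, ∀ n s t, |s - t| < δ → ‖x n s - x n t‖ ≤ ε) :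
    ∃ (φ : ℕ → ℕ) (y : ℝ → E), StrictMono φ ∧ Continuous y ∧
      ∀ t, Tendsto (fun j => x (φ j) t) atTop (𝓝 (y t)) := by
  have hcpt : IsCompact (Set.pi univ fun _ : ℚ => closedBall (0 : E) B) :=
    isCompact_univ_pi fun _ => isCompact_closedBall _ _
  obtain ⟨z, -, φ, hφ, hz⟩ := hcpt.tendsto_subseq (x := fun n (r : ℚ) => x n r)
    (fun n r _ => by simpa using hB n r)
  rw [tendsto_pi_nhds] at hz
  have hcau : ∀ t, CauchySeq fun j => x (φ j) t := by
    intro t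
    rw [Metric.cauchySeq_iff]
    intro ε hε
    obtain ⟨δ, hδ, hδx⟩ := hx (ε / 4) (by positivity)
    obtain ⟨r, hr1, hr2⟩ := exists_rat_btwn (show t < t + δ by linarith)
    have hrt : |(r : ℝ) - t| < δ := abs_lt.2 ⟨by linarith, by linarith⟩
    obtain ⟨N, hN⟩ := Metric.cauchySeq_iff.1 (hz r).cauchySeq (ε / 4) (by positivity)
    refine ⟨N, fun m hm n hn => ?_⟩
    have h1 := hN m hm n hn
    have h2 := hδx (φ m) r t hrt
    have h3 := hδx (φ n) r t hrt
    rw [← dist_eq_norm] at h2 h3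
    simp only [Function.comp_apply] at h1
    have h4 := dist_triangle4 (x (φ m) t) (x (φ m) r) (x (φ n) r) (x (φ n) t)
    rw [dist_comm (x (φ m) t) (x (φ m) r)] at h4
    linarith
  choose y hy using fun t => cauchySeq_tendsto_of_complete (hcau t)
  refine ⟨φ, y, hφ, ?_, hy⟩
  rw [Metric.continuous_iff]
  intro t ε hε
  obtain ⟨δ, hδ, hδx⟩ := hx (ε / 2) (by positivity)
  refine ⟨δ, hδ, fun s hs => ?_⟩
  have h1 : ‖y s - y t‖ ≤ ε / 2 :=
    le_of_tendsto ((hy s).sub (hy t)).norm (Eventually.of_forall fun j => hδx _ _ _ hs)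
  rw [dist_eq_norm]
  linarith

theorem tendsto_integral_comp_of_bounded {E F : Type*} [NormedAddCommGroup E]
    [NormedSpace ℝ E] [FiniteDimensional ℝ E] [NormedAddCommGroup F] [NormedSpace ℝ F]
    {x : ℕ → ℝ → E} {y : ℝ → E} {B : ℝ} (hxc : ∀ n, Continuous (x n)) (hB : ∀ n t, ‖x n t‖ ≤ B)
    (hxy : ∀ t, Tendsto (fun n => x n t) atTop (𝓝 (y t))) {Φ : ℝ × E → F} (hΦ : Continuous Φ) :
    Tendsto (fun n => ∫ t in (0 : ℝ)..1, Φ (t, x n t)) atTop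
      (𝓝 (∫ t in (0 : ℝ)..1, Φ (t, y t))) := by
  obtain ⟨D, hD⟩ := ((isCompact_Icc (a := (0 : ℝ)) (b := 1)).prod
    (isCompact_closedBall (0 : E) B)).exists_bound_of_continuousOn hΦ.continuousOn
  refine intervalIntegral.tendsto_integral_filter_of_dominated_convergence (fun _ => D)
    (Eventually.of_forall fun n => ?_) (Eventually.of_forall fun n =>
      Eventually.of_forall fun t ht => ?_) (by simp) (Eventually.of_forall fun t _ => ?_)
  · have := hxc n
    exact (by fun_prop : Continuous fun t => Φ (t, x n t)).aestronglyMeasurable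
  · rw [uIoc_of_le zero_le_one] at ht
    exact hD _ ⟨⟨ht.1.le, ht.2⟩, by simpa using hB n t⟩
  · exact (hΦ.tendsto (t, y t)).comp ((tendsto_const_nhds).prodMk_nhds (hxy t))

variable {E : Type*} [NormedAddCommGroup E] [InnerProductSpace ℝ E]

theorem norm_complexStructure {J : E →L[ℝ] E} (hJ : ∀ x, J (J x) = -x)
    (hJs : ∀ x y, inner ℝ (J x) y = -inner ℝ x (J y)) (x : E) : ‖J x‖ = ‖x‖ := by
  have h : inner ℝ (J x) (J x) = inner ℝ x x := by
    rw [hJs, hJ, inner_neg_right, neg_neg]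
  rw [real_inner_self_eq_norm_sq, real_inner_self_eq_norm_sq] at h
  exact (sq_eq_sq₀ (norm_nonneg _) (norm_nonneg _)).1 h

/-- A Sobolev-type modulus of continuity for trigonometric loops. -/
theorem norm_trigLoop_sub_le [CompleteSpace E] {I : Type*} [Fintype I] {J : E →L[ℝ] E}
    (hJ : ∀ x, J (J x) = -x)
    (hJs : ∀ x y, inner ℝ (J x) y = -inner ℝ x (J y)) {κ : I → ℤ} (hκ : Function.Injective κ)
    (a : I → E) {A ε : ℝ} (hε : 0 < ε) (hA : ∑ i, ‖(2 * π * κ i) • a i‖ ^ 2 ≤ A) {s t : ℝ}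
    (hst : s ≤ t) (hst1 : t ≤ s + 1) :
    ‖trigLoop J κ a t - trigLoop J κ a s‖ ≤ (t - s) / (2 * ε) + ε * A / 2 := by
  set b : I → E := fun i => (2 * π * κ i) • a i with hb
  have h1 : ∫ u in s..t, J (trigLoop J κ b u) = trigLoop J κ a t - trigLoop J κ a s :=
    intervalIntegral.integral_eq_sub_of_hasDerivAt (fun u _ => hasDerivAt_trigLoop hJ κ a u)
      (Continuous.intervalIntegrable (by fun_prop) _ _)
  rw [← h1]
  have hper : Function.Periodic (fun u => ‖trigLoop J κ b u‖ ^ 2) 1 := fun u => by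
    simp only [trigLoop_periodic hJ]
  have h2 : ∫ u in s..t, ‖trigLoop J κ b u‖ ^ 2 ≤ A := by
    have h3 := hper.intervalIntegral_add_eq s 0
    rw [zero_add, integral_norm_sq_trigLoop hJ hJs hκ] at h3
    refine le_trans ?_ (h3.le.trans hA)
    exact intervalIntegral.integral_mono_interval le_rfl hst hst1
      (Eventually.of_forall fun u => sq_nonneg _)
      (Continuous.intervalIntegrable (by fun_prop) _ _)
  have h4 : ‖∫ u in s..t, J (trigLoop J κ b u)‖ ≤
      ∫ u in s..t, (1 / (2 * ε) + ε / 2 * ‖trigLoop J κ b u‖ ^ 2) := by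
    refine intervalIntegral.norm_integral_le_of_norm_le hst (Eventually.of_forall fun u _ => ?_)
      (Continuous.intervalIntegrable (by fun_prop) _ _)
    rw [norm_complexStructure hJ hJs]
    have h5 : 1 / (2 * ε) + ε / 2 * ‖trigLoop J κ b u‖ ^ 2 - ‖trigLoop J κ b u‖ =
        (ε * ‖trigLoop J κ b u‖ - 1) ^ 2 / (2 * ε) := by field_simp; ring
    have h6 : 0 ≤ (ε * ‖trigLoop J κ b u‖ - 1) ^ 2 / (2 * ε) := by positivity
    linarith
  refine h4.trans ?_
  rw [intervalIntegral.integral_add (Continuous.intervalIntegrable (by fun_prop) _ _)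
    (Continuous.intervalIntegrable (by fun_prop) _ _), intervalIntegral.integral_const_mul,
    intervalIntegral.integral_const, smul_eq_mul]
  have h7 := mul_le_mul_of_nonneg_left h2 (show 0 ≤ ε / 2 by positivity)
  have h8 : (t - s) * (1 / (2 * ε)) = (t - s) / (2 * ε) := by ring
  linarith

/-- Asymptotically quadratic autonomous Hamiltonians which vanish near the origin and grow faster
than the first resonance have a one-periodic orbit of positive action. -/
theorem exists_periodic_orbit_of_hamiltonian [FiniteDimensional ℝ E] [Nontrivial E]
    {J : E →L[ℝ] E} (hJ : ∀ x, J (J x) = -x)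
    (hJs : ∀ x y, inner ℝ (J x) y = -inner ℝ x (J y)) {H : E → ℝ} {G : E → E}
    (hH : ∀ x, HasGradientAt H (G x) x) (hG : UniformContinuous G)
    (hHnn : ∀ z, 0 ≤ H z) {r C q : ℝ} (hr : 0 < r) (hC : 0 ≤ C)
    (hH0 : ∀ z, ‖z‖ ≤ r → H z = 0) (hHC : ∀ z, H z ≤ C * ‖z‖ ^ 2)
    (hq1 : π < q) (hq2 : q < 2 * π) (hHq : ∀ z, q * ‖z‖ ^ 2 - C ≤ H z)
    (hGq : ∀ z, ‖G z - (2 * q) • z‖ ≤ C) :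
    ∃ y : ℝ → E, Function.Periodic y 1 ∧ (∀ t, HasDerivAt y (J (G (y t))) t) ∧
      0 < ∫ t in (0 : ℝ)..1, ((1 / 2 : ℝ) * inner ℝ (G (y t)) (y t) - H (y t)) := by
  have hHc : Continuous H := continuous_iff_continuousAt.2 fun x =>
    (hH x).differentiableAt.continuousAt
  have hGc : Continuous G := hG.continuous
  obtain ⟨η, hη, hcrit⟩ := exists_critical_trigLoop hJ hJs hH hG hHnn hr hC hH0 hHC hq1 hq2 hHq hGq
  obtain ⟨d, hd, hdq⟩ := exists_dist_two_pi_int hq1 hq2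
  have hq0 : 0 < q := pi_pos.trans hq1
  set κ : ∀ n : ℕ, Finset.Icc (-(n + 1 : ℤ)) (n + 1) → ℤ := fun n k => k.1 with hκdef
  have hκ : ∀ n, Function.Injective (κ n) := fun n => Subtype.val_injective
  choose a ha hact using fun n : ℕ => hcrit (κ n) (hκ n)
    ⟨⟨1, by simp only [Finset.mem_Icc]; omega⟩, rfl⟩
  set x : ℕ → ℝ → E := fun n => trigLoop J (κ n) (a n) with hxdef
  have hxc : ∀ n, Continuous (x n) := fun n => continuous_trigLoop _ _ _
  have hcoef : ∀ n i, (2 * π * κ n i) • a n i = rotCoeff J (fun t => G (x n t)) (κ n i) := by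
    intro n i
    have := congrArg (fun b : PiLp 2 fun _ => E => b i) (ha n)
    simpa [loopActionGrad, sub_eq_zero] using this
  have hnorm : ∀ n, ‖a n‖ ≤ C / d := by
    intro n
    have := le_norm_loopActionGrad hJ hJs hGc (hκ n) hd.le hdq hGq (a n)
    rw [ha n, norm_zero] at this
    rw [le_div_iff₀ hd]
    linarith
  set A : ℝ := (C + 2 * q * (C / d)) ^ 2 with hAdef
  have hA : ∀ n, ∑ i, ‖(2 * π * κ n i) • a n i‖ ^ 2 ≤ A := by
    intro n
    set w : ℝ → E := fun t => G (x n t) - (2 * q) • x n t with hw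
    have h1 : (WithLp.toLp 2 fun i => (2 * π * κ n i) • a n i : PiLp 2 fun _ => E) =
        (WithLp.toLp 2 fun i => rotCoeff J w (κ n i)) + (2 * q) • a n := by
      ext i
      have h2 := loopActionGrad_apply hJ hGc (hκ n) q (a n) i
      rw [ha n] at h2
      simp only [PiLp.zero_apply] at h2
      simp only [PiLp.add_apply, PiLp.smul_apply]
      have h3 := (sub_eq_zero.1 h2.symm)
      rw [← h3, ← add_smul, sub_add_cancel]
    have h2 := norm_rotCoeff_vector_le hJ hJs (hκ n) (w := w) (by fun_prop) fun t => hGq _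
    have h3 : ‖(WithLp.toLp 2 fun i => (2 * π * κ n i) • a n i : PiLp 2 fun _ => E)‖ ≤
        C + 2 * q * (C / d) := by
      rw [h1]
      refine (norm_add_le _ _).trans (add_le_add h2 ?_)
      rw [norm_smul, Real.norm_of_nonneg (by positivity)]
      gcongr
      exact hnorm n
    have h4 := pow_le_pow_left₀ (norm_nonneg _) h3 2
    rwa [PiLp.norm_sq_eq_of_L2] at h4
  have hA0 : 0 ≤ A := sq_nonneg _
  have hosc : ∀ ε > 0, ∀ n s t, |s - t| ≤ 1 →
      ‖x n s - x n t‖ ≤ |s - t| / (2 * ε) + ε * A / 2 := by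
    intro ε hε n s t hst
    rcases le_total s t with h | h
    · rw [norm_sub_rev, abs_sub_comm, abs_of_nonneg (sub_nonneg.2 h)]
      rw [abs_sub_comm, abs_of_nonneg (sub_nonneg.2 h)] at hst
      exact norm_trigLoop_sub_le hJ hJs (hκ n) (a n) hε (hA n) h (by linarith)
    · rw [abs_of_nonneg (sub_nonneg.2 h)] at hst ⊢
      exact norm_trigLoop_sub_le hJ hJs (hκ n) (a n) hε (hA n) h (by linarith)
  set B : ℝ := (1 + (C / d) ^ 2) / 2 + (1 / 2 + A / 2) with hB
  have hbound : ∀ n t, ‖x n t‖ ≤ B := by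
    intro n t
    have hper : Function.Periodic (fun u => ‖x n u‖ ^ 2) 1 := fun u => by
      simp only [hxdef, trigLoop_periodic hJ]
    have h1 : ∫ s in t..t + 1, ‖x n s‖ ^ 2 ≤ (C / d) ^ 2 := by
      have h3 := hper.intervalIntegral_add_eq t 0
      rw [zero_add] at h3
      rw [h3]
      simp only [hxdef]
      rw [integral_norm_sq_trigLoop hJ hJs (hκ n), ← PiLp.norm_sq_eq_of_L2]
      exact pow_le_pow_left₀ (norm_nonneg _) (hnorm n) 2
    have h2 : ∫ s in t..t + 1, ‖x n t‖ ≤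
        ∫ s in t..t + 1, ((1 / 2 : ℝ) * ‖x n s‖ ^ 2 + (1 + A / 2)) := by
      have := hxc n
      refine intervalIntegral.integral_mono_on (by linarith) (by simp)
        (Continuous.intervalIntegrable (by fun_prop) _ _) fun s hs => ?_
      have h4 : |t - s| ≤ 1 := abs_le.2 ⟨by linarith [hs.2], by linarith [hs.1]⟩
      have h3 := hosc 1 one_pos n t s h4
      have h5 : ‖x n t‖ ≤ ‖x n t - x n s‖ + ‖x n s‖ := by
        simpa using norm_add_le (x n t - x n s) (x n s)
      nlinarith [sq_nonneg (‖x n s‖ - 1)]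
    have := hxc n
    rw [intervalIntegral.integral_add (Continuous.intervalIntegrable (by fun_prop) _ _)
      (by simp), intervalIntegral.integral_const_mul] at h2
    simp only [intervalIntegral.integral_const, add_sub_cancel_left, one_smul] at h2
    linarith
  obtain ⟨φ, y, hφ, hyc, hxy⟩ := exists_pointwise_limit_of_equicontinuous hbound (by
    intro ε hε
    have hA1 : 0 < A + 1 := by linarith
    set ε' := ε / (A + 1) with hε'
    have hε'0 : 0 < ε' := by positivity
    refine ⟨min 1 (ε' * ε), by positivity, fun n s t hst => ?_⟩
    refine (hosc ε' hε'0 n s t (hst.le.trans (min_le_left _ _))).trans ?_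
    have h1 : |s - t| / (2 * ε') ≤ ε / 2 := by
      rw [div_le_iff₀ (by positivity)]
      have := hst.le.trans (min_le_right _ _)
      linarith
    have h2 : ε' * A / 2 ≤ ε / 2 := by
      have : ε' * (A + 1) = ε := by rw [hε']; field_simp
      linarith
    linarith)
  have hyp : Function.Periodic y 1 := by
    intro t
    refine tendsto_nhds_unique (hxy (t + 1)) ?_
    simp only [hxdef, trigLoop_periodic hJ]
    exact hxy t
  refine ⟨y, hyp, ?_, ?_⟩
  · refine hasDerivAt_of_rotCoeff hJ hyc (w := fun t => G (y t)) (by fun_prop) hyp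
      (fun t => by simp only [hyp t]) fun k => ?_
    have h1 := tendsto_integral_comp_of_bounded (fun n => hxc (φ n)) (fun n => hbound (φ n)) hxy
      (Φ := fun p : ℝ × E => rot J (-(2 * π * k * p.1)) p.2) (by fun_prop)
    have h2 := tendsto_integral_comp_of_bounded (fun n => hxc (φ n)) (fun n => hbound (φ n)) hxy
      (Φ := fun p : ℝ × E => rot J (-(2 * π * k * p.1)) (G p.2)) (by fun_prop)
    refine tendsto_nhds_unique_of_eventuallyEq (h1.const_smul (2 * π * k)) h2 ?_
    filter_upwards [eventually_ge_atTop k.natAbs] with n hn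
    have hn' : k.natAbs ≤ φ n := hn.trans (hφ.id_le n)
    have hk : k ∈ Finset.Icc (-(φ n + 1 : ℤ)) (φ n + 1) := by
      simp only [Finset.mem_Icc]; omega
    have h3 := hcoef (φ n) ⟨k, hk⟩
    have h4 := rotCoeff_trigLoop hJ (hκ (φ n)) (a (φ n)) ⟨k, hk⟩
    rw [← h4] at h3
    exact h3
  · have h1 := tendsto_integral_comp_of_bounded (fun n => hxc (φ n)) (fun n => hbound (φ n)) hxy
      (Φ := fun p : ℝ × E => (1 / 2 : ℝ) * inner ℝ (G p.2) p.2 - H p.2) (by fun_prop)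
    refine lt_of_lt_of_le hη (ge_of_tendsto h1 (Eventually.of_forall fun n => ?_))
    have h2 := hact (φ n)
    have h3 := integral_inner_trigLoop hJs (κ (φ n)) (a (φ n)) (w := fun t => G (x (φ n) t))
      (by have := hxc (φ n); fun_prop)
    simp only [← hcoef, inner_smul_left, RCLike.conj_to_real, real_inner_self_eq_norm_sq,
      mul_assoc, ← Finset.mul_sum] at h3
    have := hxc (φ n)
    rw [intervalIntegral.integral_sub (Continuous.intervalIntegrable (by fun_prop) _ _)
      (Continuous.intervalIntegrable (by fun_prop) _ _), intervalIntegral.integral_const_mul]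
    rw [loopAction] at h2
    have h4 : ∫ t in (0 : ℝ)..1, inner ℝ (G (x (φ n) t)) (x (φ n) t) =
      2 * (π * ∑ i, κ (φ n) i * ‖a (φ n) i‖ ^ 2) := h3
    rw [h4]
    linarith

end PeriodicOrbit

section Flow

open Set Filter Topology

/-- Pointwise application of a continuous family of operators, as a bilinear map. -/
def pointwiseApplyCLM (α E : Type*) [TopologicalSpace α] [CompactSpace α]
    [NormedAddCommGroup E] [NormedSpace ℝ E] :
    C(α, E →L[ℝ] E) →L[ℝ] C(α, E) →L[ℝ] C(α, E) :=
  LinearMap.mkContinuous₂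
    (LinearMap.mk₂ ℝ (fun (A : C(α, E →L[ℝ] E)) (h : C(α, E)) =>
      (⟨fun t => A t (h t), A.continuous.clm_apply h.continuous⟩ : C(α, E)))
      (fun _ _ _ => rfl) (fun _ _ _ => rfl)
      (fun A h k => by ext t; exact map_add (A t) (h t) (k t))
      (fun c A h => by ext t; exact map_smul (A t) c (h t))) 1
    (fun A h => by
      rw [one_mul]
      refine (ContinuousMap.norm_le _ (by positivity)).2 fun t => ?_
      exact ((A t).le_opNorm (h t)).trans
        (by gcongr; exacts [A.norm_coe_le_norm t, h.norm_coe_le_norm t]))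

variable {E : Type*} [NormedAddCommGroup E] [NormedSpace ℝ E]

@[simp] theorem pointwiseApplyCLM_apply {α : Type*} [TopologicalSpace α] [CompactSpace α]
    (A : C(α, E →L[ℝ] E)) (h : C(α, E)) (t : α) :
    pointwiseApplyCLM α E A h t = A t (h t) := rfl

/-- The superposition operator `γ ↦ V ∘ γ` is differentiable. -/
theorem hasFDerivAt_postcomp {α : Type*} [TopologicalSpace α] [CompactSpace α]
    {V : C(E, E)} {A : C(E, E →L[ℝ] E)} (hV : ∀ x, HasFDerivAt V (A x) x)
    (hA : UniformContinuous A) (γ : C(α, E)) :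
    HasFDerivAt (fun γ : C(α, E) => V.comp γ) (pointwiseApplyCLM α E (A.comp γ)) γ := by
  rw [hasFDerivAt_iff_isLittleO, Asymptotics.isLittleO_iff]
  intro ε hε
  obtain ⟨δ, hδ, hAδ⟩ := Metric.uniformContinuous_iff.1 hA ε hε
  filter_upwards [Metric.ball_mem_nhds γ hδ] with η hη
  rw [Metric.mem_ball, dist_eq_norm] at hη
  refine (ContinuousMap.norm_le _ (by positivity)).2 fun t => ?_
  have h1 : ‖η t - γ t‖ ≤ ‖η - γ‖ := (η - γ).norm_coe_le_norm t
  have h2 := (convex_ball (γ t) δ).norm_image_sub_le_of_norm_hasFDerivWithin_le'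
    (f := V) (f' := fun x => A x) (φ := A (γ t)) (C := ε) (x := γ t) (y := η t)
    (fun x _ => (hV x).hasFDerivWithinAt)
    (fun x hx => by
      rw [← dist_eq_norm]; exact (hAδ hx).le)
    (Metric.mem_ball_self hδ) (by rw [Metric.mem_ball, dist_eq_norm]; exact h1.trans_lt hη)
  exact h2.trans (mul_le_mul_of_nonneg_left h1 hε.le)

theorem contDiff_postcomp {α : Type*} [TopologicalSpace α] [CompactSpace α]
    {V : C(E, E)} {A : C(E, E →L[ℝ] E)} (hV : ∀ x, HasFDerivAt V (A x) x)
    (hA : UniformContinuous A) :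
    ContDiff ℝ 1 (fun γ : C(α, E) => V.comp γ) :=
  contDiff_one_iff_hasFDerivAt.2 ⟨fun γ => pointwiseApplyCLM α E (A.comp γ),
    (pointwiseApplyCLM α E).continuous.comp (ContinuousMap.continuous_postcomp A),
    hasFDerivAt_postcomp hV hA⟩

/-- The primitive vanishing at `0` of a continuous function on `[-a, a]`. -/
def primitiveCLM (E : Type*) [NormedAddCommGroup E] [NormedSpace ℝ E] {a : ℝ} (ha : 0 ≤ a) :
    C(Icc (-a) a, E) →L[ℝ] C(Icc (-a) a, E) :=
  LinearMap.mkContinuous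
    { toFun := fun γ => ⟨fun t => ∫ x in (0 : ℝ)..t, IccExtend (neg_le_self ha) γ x, by
        have : Continuous (IccExtend (neg_le_self ha) γ) := γ.continuous.Icc_extend'
        exact (intervalIntegral.continuous_primitive
          (fun _ _ => this.intervalIntegrable _ _) 0).comp continuous_subtype_val⟩
      map_add' := fun γ η => by
        ext t
        exact intervalIntegral.integral_add
          ((γ.continuous.Icc_extend' (h := neg_le_self ha)).intervalIntegrable _ _)
          ((η.continuous.Icc_extend' (h := neg_le_self ha)).intervalIntegrable _ _)
      map_smul' := fun c γ => by
        ext t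
        exact intervalIntegral.integral_smul c _ } a
    (fun γ => by
      refine (ContinuousMap.norm_le _ (by positivity)).2 fun t => ?_
      have h := intervalIntegral.norm_integral_le_of_norm_le_const (a := 0) (b := (t : ℝ))
        (f := IccExtend (neg_le_self ha) γ) (C := ‖γ‖) (fun x _ => γ.norm_coe_le_norm _)
      refine h.trans ?_
      rw [mul_comm, sub_zero]
      exact mul_le_mul_of_nonneg_right (abs_le.2 t.2) (norm_nonneg _))

theorem primitiveCLM_apply {a : ℝ} (ha : 0 ≤ a) (γ : C(Icc (-a) a, E)) (t : Icc (-a) a) :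
    primitiveCLM E ha γ t = ∫ x in (0 : ℝ)..t, IccExtend (neg_le_self ha) γ x := rfl

theorem norm_primitiveCLM_apply_le {a : ℝ} (ha : 0 ≤ a) (γ : C(Icc (-a) a, E)) :
    ‖primitiveCLM E ha γ‖ ≤ a * ‖γ‖ :=
  LinearMap.mkContinuous_norm_le _ ha _ |> fun h =>
    ((primitiveCLM E ha).le_opNorm γ).trans (mul_le_mul_of_nonneg_right h (norm_nonneg _))

/-- A continuous solution of an integral equation solves the differential equation. -/
theorem hasDerivAt_of_eq_add_primitiveCLM [CompleteSpace E] {a : ℝ} (ha : 0 ≤ a)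
    {h k : C(Icc (-a) a, E)} {c : E} (hk : ∀ t, h t = c + primitiveCLM E ha k t)
    {t : ℝ} (ht : t ∈ Ioo (-a) a) :
    HasDerivAt (IccExtend (neg_le_self ha) h) (IccExtend (neg_le_self ha) k t) t := by
  have hc : Continuous (IccExtend (neg_le_self ha) k) := k.continuous.Icc_extend'
  have h1 := ((intervalIntegral.integral_hasDerivAt_right (hc.intervalIntegrable 0 t)
    (hc.stronglyMeasurableAtFilter _ _) hc.continuousAt).const_add c)
  refine h1.congr_of_eventuallyEq ?_
  filter_upwards [isOpen_Ioo.mem_nhds ht] with x hx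
  rw [IccExtend_of_mem _ _ (Ioo_subset_Icc_self hx), hk, primitiveCLM_apply]

/-- Local flow of a `C¹` vector field with uniformly continuous bounded derivative, together with
its derivative with respect to the initial condition. -/
theorem exists_local_flow [FiniteDimensional ℝ E] {V : E → E} {A : E → E →L[ℝ] E}
    (hV : ∀ x, HasFDerivAt V (A x) x) (hA : UniformContinuous A) {K : NNReal}
    (hK : ∀ x, ‖A x‖ ≤ K) {a : ℝ} (ha : 0 < a) (haK : a * K < 1) :
    ∃ (φ : E → ℝ → E) (D : E → ℝ → E →L[ℝ] E), Continuous ↿φ ∧ Continuous ↿D ∧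
      (∀ z, φ z 0 = z) ∧ (∀ z b, D z 0 b = b) ∧
      (∀ z, ∀ t ∈ Ioo (-a) a, HasDerivAt (φ z) (V (φ z t)) t) ∧
      (∀ z, ∀ t, HasFDerivAt (fun x => φ x t) (D z t) z) ∧
      (∀ z b, ∀ t ∈ Ioo (-a) a, HasDerivAt (fun s => D z s b) (A (φ z t) (D z t b)) t) := by
  have := FiniteDimensional.complete ℝ E
  have hVc : Continuous V := continuous_iff_continuousAt.2 fun x => (hV x).continuousAt
  have hlip : LipschitzWith K V := lipschitzWith_of_nnnorm_fderiv_le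
    (fun x => (hV x).differentiableAt) (fun x => by rw [(hV x).fderiv]; exact_mod_cast hK x)
  let X := C(Icc (-a) a, E)
  let V' : C(E, E) := ⟨V, hVc⟩
  let A' : C(E, E →L[ℝ] E) := ⟨A, hA.continuous⟩
  let P := primitiveCLM E ha.le
  let S := pointwiseApplyCLM (Icc (-a) a) E
  let F : X → X := fun γ => γ - P (V'.comp γ)
  let L : X → X →L[ℝ] X := fun γ => P.comp (S (A'.comp γ))
  have hF : ∀ γ, HasFDerivAt F (ContinuousLinearMap.id ℝ X - L γ) γ := fun γ =>
    (hasFDerivAt_id γ).sub (P.hasFDerivAt.comp γ (hasFDerivAt_postcomp (V := V') (A := A') hV hA γ))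
  have hF1 : ContDiff ℝ 1 F :=
    contDiff_id.sub (P.contDiff.comp (contDiff_postcomp (V := V') (A := A') hV hA))
  have hP : ‖P‖ ≤ a := LinearMap.mkContinuous_norm_le _ ha.le _
  have hL : ∀ γ, ‖L γ‖ < 1 := fun γ => by
    refine lt_of_le_of_lt (ContinuousLinearMap.opNorm_le_bound _ (by positivity) fun h => ?_) haK
    refine (norm_primitiveCLM_apply_le ha.le _).trans ?_
    rw [mul_assoc]
    refine mul_le_mul_of_nonneg_left ?_ ha.le
    refine (ContinuousMap.norm_le _ (by positivity)).2 fun t => ?_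
    exact ((A (γ t)).le_opNorm (h t)).trans
      (mul_le_mul (hK _) (h.norm_coe_le_norm t) (norm_nonneg _) K.2)
  let e : X → X ≃L[ℝ] X := fun γ =>
    ContinuousLinearEquiv.unitsEquiv ℝ X (Units.oneSub (L γ) (hL γ))
  have hFe : ∀ γ, HasFDerivAt F (e γ : X →L[ℝ] X) γ := fun γ => hF γ
  have happrox : ApproximatesLinearOn F ((ContinuousLinearEquiv.refl ℝ X : X ≃L[ℝ] X) : X →L[ℝ] X)
      univ (⟨a, ha.le⟩ * K) := by
    intro γ _ η _
    have : F γ - F η - (γ - η) = - P (V'.comp γ - V'.comp η) := by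
      simp only [F, map_sub]; abel
    change ‖F γ - F η - (γ - η)‖ ≤ a * K * ‖γ - η‖
    rw [this, norm_neg]
    refine (norm_primitiveCLM_apply_le ha.le _).trans ?_
    rw [mul_assoc]
    refine mul_le_mul_of_nonneg_left ?_ ha.le
    refine (ContinuousMap.norm_le _ (by positivity)).2 fun t => ?_
    have h1 := hlip.dist_le_mul (γ t) (η t)
    rw [dist_eq_norm, dist_eq_norm] at h1
    exact h1.trans (mul_le_mul_of_nonneg_left ((γ - η).norm_coe_le_norm t) K.2)
  have hc : Subsingleton X ∨ (⟨a, ha.le⟩ * K : NNReal) <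
      ‖((ContinuousLinearEquiv.refl ℝ X).symm : X →L[ℝ] X)‖₊⁻¹ := by
    rcases subsingleton_or_nontrivial X with h | h
    · exact Or.inl h
    · right
      have : ‖((ContinuousLinearEquiv.refl ℝ X).symm : X →L[ℝ] X)‖₊ = 1 := by
        ext
        exact ContinuousLinearMap.norm_id
      rw [this, inv_one]
      exact_mod_cast haK
  let Fh : X ≃ₜ X := happrox.toHomeomorph F hc
  have hFh : ∀ γ, Fh γ = F γ := fun γ => rfl
  have hsymm : ContDiff ℝ 1 Fh.symm := Fh.contDiff_symm (f₀' := e) hFe hF1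
  let C : E →L[ℝ] X := ContinuousLinearMap.mk
    { toFun := fun z => ContinuousMap.const _ z, map_add' := fun _ _ => rfl,
      map_smul' := fun _ _ => rfl } ContinuousMap.continuous_const'
  let Γ : E → X := fun z => Fh.symm (C z)
  have hΓ : ContDiff ℝ 1 Γ := hsymm.comp C.contDiff
  have hΓd : ∀ z, HasFDerivAt Γ (fderiv ℝ Γ z) z := fun z =>
    ((hΓ.differentiable one_ne_zero) z).hasFDerivAt
  have hFΓ : ∀ z, F (Γ z) = C z := fun z => Fh.apply_symm_apply (C z)
  have hΓeq : ∀ z t, Γ z t = z + P (V'.comp (Γ z)) t := fun z t => by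
    have := congrArg (fun γ : X => γ t) (hFΓ z)
    simp only [F, C] at this
    exact sub_eq_iff_eq_add.1 this
  have hDeq : ∀ z b t, fderiv ℝ Γ z b t = b + P (S (A'.comp (Γ z)) (fderiv ℝ Γ z b)) t := by
    intro z b t
    have h1 : HasFDerivAt (fun z => F (Γ z)) _ z := (hF (Γ z)).comp z (hΓd z)
    have h2 : HasFDerivAt (fun z => F (Γ z)) C z := by
      simp only [hFΓ]; exact C.hasFDerivAt
    have h3 := congrArg (fun B : E →L[ℝ] X => B b t) (h1.unique h2)
    exact sub_eq_iff_eq_add.1 h3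
  have h0 : ∀ k : X, P k ⟨0, by constructor <;> linarith⟩ = 0 := fun k => by
    simp [P, primitiveCLM_apply]
  have hmem0 : (0 : ℝ) ∈ Icc (-a) a := by constructor <;> linarith
  let pr : ℝ → Icc (-a) a := projIcc (-a) a (neg_le_self ha.le)
  have hpr : Continuous pr := continuous_projIcc
  let ev : Icc (-a) a → X →L[ℝ] E := fun t => ContinuousMap.evalCLM ℝ t
  refine ⟨fun z t => Γ z (pr t), fun z t => (ev (pr t)).comp (fderiv ℝ Γ z), ?_, ?_, ?_, ?_, ?_,
    ?_, ?_⟩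
  · exact continuous_eval.comp ((hΓ.continuous.comp continuous_fst).prodMk
      (hpr.comp continuous_snd))
  · refine continuous_clm_apply.2 fun b => ?_
    exact continuous_eval.comp ((((hΓ.continuous_fderiv one_ne_zero).clm_apply
      continuous_const).comp continuous_fst).prodMk (hpr.comp continuous_snd))
  · intro z
    have : pr 0 = ⟨0, hmem0⟩ := projIcc_of_mem _ hmem0
    change Γ z (pr 0) = z
    rw [this, hΓeq, h0, add_zero]
  · intro z b
    have : pr 0 = ⟨0, hmem0⟩ := projIcc_of_mem _ hmem0
    change fderiv ℝ Γ z b (pr 0) = b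
    rw [this, hDeq, h0, add_zero]
  · intro z t ht
    exact hasDerivAt_of_eq_add_primitiveCLM ha.le (hΓeq z) ht
  · intro z t
    exact (ev (pr t)).hasFDerivAt.comp z (hΓd z)
  · intro z b t ht
    exact hasDerivAt_of_eq_add_primitiveCLM ha.le (hDeq z b) ht

end Flow

section CutoffVectorField

open Set Filter Topology

variable {E : Type*} [NormedAddCommGroup E] [NormedSpace ℝ E] [FiniteDimensional ℝ E]

open scoped Manifold in
theorem exists_contDiff_bump_of_isCompact {M W : Set E} (hM : IsCompact M) (hW : IsOpen W)
    (hMW : M ⊆ W) : ∃ (f : E → ℝ) (N : Set E), ContDiff ℝ ∞ f ∧ HasCompactSupport f ∧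
      tsupport f ⊆ W ∧ IsOpen N ∧ M ⊆ N ∧ N ⊆ W ∧ ∀ x ∈ N, f x = 1 := by
  obtain ⟨R, hR⟩ := hM.isBounded.subset_ball 0
  obtain ⟨f, hf0, hf1, -⟩ := exists_contMDiffMap_zero_one_nhds_of_isClosed 𝓘(ℝ, E) (n := ⊤)
    (s := (W ∩ Metric.ball 0 R)ᶜ) (t := M) (hW.inter Metric.isOpen_ball).isClosed_compl
    hM.isClosed (disjoint_compl_left_iff_subset.2 (subset_inter hMW hR))
  have hts : tsupport f ⊆ W ∩ Metric.ball 0 R := by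
    intro x hx
    by_contra hxs
    have : ∀ᶠ y in 𝓝 x, f y = 0 := hf0.filter_mono (nhds_le_nhdsSet hxs)
    exact (notMem_tsupport_iff_eventuallyEq.2 this) hx
  obtain ⟨N, hN, hMN, hN1⟩ := mem_nhdsSet_iff_exists.1 hf1
  refine ⟨f, N ∩ W, f.contMDiff.contDiff, ?_, fun x hx => (hts hx).1, hN.inter hW,
    subset_inter hMN hMW, inter_subset_right, fun x hx => hN1 hx.1⟩
  exact (isCompact_closedBall (0 : E) R).of_isClosed_subset (isClosed_tsupport _)
    fun x hx => Metric.ball_subset_closedBall (hts hx).2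

/-- Extension of a transverse vector field to a compactly supported one pointing in the direction
in which the defining function grows. -/
theorem exists_cutoff_vectorField {g : E → ℝ} {Y : E → E} {U : Set E} (hg : ContDiff ℝ ∞ g)
    (hM : IsCompact (g ⁻¹' {0})) (hU : IsOpen U) (hMU : g ⁻¹' {0} ⊆ U) (hY : ContDiffOn ℝ ∞ Y U)
    (htr : ∀ x ∈ g ⁻¹' {0}, fderiv ℝ g x (Y x) ≠ 0) :
    ∃ (V : E → E) (σ : E → ℝ) (N : Set E), ContDiff ℝ ∞ V ∧ HasCompactSupport V ∧ IsOpen N ∧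
      g ⁻¹' {0} ⊆ N ∧ N ⊆ U ∧ ContinuousOn σ N ∧
      ∀ x ∈ N, (σ x = 1 ∨ σ x = -1) ∧ V =ᶠ[𝓝 x] (fun y => σ x • Y y) ∧ 0 < fderiv ℝ g x (V x) := by
  let d : E → ℝ := fun x => fderiv ℝ g x (Y x)
  have hd : ContinuousOn d U := (hg.continuous_fderiv (by simp)).continuousOn.clm_apply
    hY.continuousOn
  let W := U ∩ d ⁻¹' {0}ᶜ
  have hW : IsOpen W := hd.isOpen_inter_preimage hU isOpen_compl_singleton
  obtain ⟨f, N, hf, hfc, hfW, hN, hMN, hNW, hf1⟩ := exists_contDiff_bump_of_isCompact hM hW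
    (fun x hx => ⟨hMU hx, htr x hx⟩)
  let σ : E → ℝ := fun x => if 0 < d x then 1 else -1
  have hσ : ∀ x ∈ W, ∀ᶠ y in 𝓝 x, σ y = σ x := by
    intro x hx
    have hdx : ContinuousAt d x := hd.continuousAt (hU.mem_nhds hx.1)
    rcases lt_or_gt_of_ne (show d x ≠ 0 from hx.2) with h | h
    · filter_upwards [hdx.eventually_lt continuousAt_const h] with y hy
      simp only [σ, if_neg hy.not_gt, if_neg h.not_gt]
    · filter_upwards [continuousAt_const.eventually_lt hdx h] with y hy
      simp only [σ, if_pos hy, if_pos h]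
  have hσd : ∀ x ∈ W, 0 < σ x * d x := by
    intro x hx
    rcases lt_or_gt_of_ne (show d x ≠ 0 from hx.2) with h | h
    · simp only [σ, if_neg h.not_gt]; linarith
    · simp only [σ, if_pos h]; linarith
  have hVN : ∀ x ∈ N, (fun y => f y • σ y • Y y) =ᶠ[𝓝 x] (fun y => σ x • Y y) := by
    intro x hx
    filter_upwards [hN.mem_nhds hx, hσ x (hNW hx)] with y hy hy'
    rw [hf1 y hy, hy', one_smul]
  refine ⟨fun x => f x • σ x • Y x, σ, N, ?_, ?_, hN, hMN, hNW.trans inter_subset_left, ?_, ?_⟩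
  · refine contDiff_iff_contDiffAt.2 fun x => ?_
    by_cases hx : x ∈ tsupport f
    swap
    · refine (contDiffAt_const (c := (0 : E))).congr_of_eventuallyEq ?_
      filter_upwards [notMem_tsupport_iff_eventuallyEq.1 hx] with y hy
      rw [hy, Pi.zero_apply, zero_smul]
    have hxW : x ∈ W := hfW hx
    refine hf.contDiffAt.smul (ContDiffAt.congr_of_eventuallyEq
      (contDiffAt_const.smul (hY.contDiffAt (hU.mem_nhds hxW.1)) :
        ContDiffAt ℝ ∞ (fun y => σ x • Y y) x) ?_)
    filter_upwards [hσ x hxW] with y hy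
    exact congrArg (· • Y y) hy
  · exact hfc.smul_right
  · intro x hx
    exact (continuousAt_const.congr (Filter.EventuallyEq.symm (hσ x (hNW hx)))).continuousWithinAt
  · intro x hx
    refine ⟨?_, hVN x hx, ?_⟩
    · by_cases h : 0 < d x <;> simp [σ, h]
    · rw [(hVN x hx).self_of_nhds, map_smul]
      exact hσd x (hNW hx)

end CutoffVectorField

section CompactlySupportedFlow

open Set Filter Topology

/-- Local flow of a smooth compactly supported vector field. -/
theorem exists_local_flow_of_hasCompactSupport
    {E : Type*} [NormedAddCommGroup E] [NormedSpace ℝ E] [FiniteDimensional ℝ E]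
    {V : E → E} (hV : ContDiff ℝ ∞ V) (hc : HasCompactSupport V) :
    ∃ (a B : ℝ) (φ : E → ℝ → E) (D : E → ℝ → E →L[ℝ] E), 0 < a ∧ 0 < B ∧
      Continuous ↿φ ∧ Continuous ↿D ∧ (∀ z, φ z 0 = z) ∧ (∀ z b, D z 0 b = b) ∧
      (∀ z, ∀ t ∈ Ioo (-a) a, HasDerivAt (φ z) (V (φ z t)) t) ∧
      (∀ z, ∀ t, HasFDerivAt (fun x => φ x t) (D z t) z) ∧
      (∀ z b, ∀ t ∈ Ioo (-a) a, HasDerivAt (fun s => D z s b) (fderiv ℝ V (φ z t) (D z t b)) t) ∧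
      (∀ z, ∀ t ∈ Ioo (-a) a, D z t (V z) = V (φ z t)) ∧
      (∀ z, ∀ t ∈ Ioo (-a) a, ‖φ z t - z‖ ≤ B * |t|) := by
  have hA : HasCompactSupport (fderiv ℝ V) := hc.fderiv ℝ
  have hAc : Continuous (fderiv ℝ V) := hV.continuous_fderiv (by simp)
  obtain ⟨K, hK⟩ := hA.exists_bound_of_continuous hAc
  obtain ⟨B, hB⟩ := hc.exists_bound_of_continuous hV.continuous
  have hK0 : 0 ≤ K := (norm_nonneg _).trans (hK 0)
  have hB0 : 0 ≤ B := (norm_nonneg _).trans (hB 0)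
  have hVd : ∀ x, HasFDerivAt V (fderiv ℝ V x) x := fun x =>
    (hV.differentiable (by simp) x).hasFDerivAt
  have ha : 0 < 1 / (K + 1) := by positivity
  obtain ⟨φ, D, hφ, hD, hφ0, hD0, hφt, hφz, hDt⟩ := exists_local_flow (K := ⟨K, hK0⟩) hVd
    (hA.uniformContinuous_of_continuous hAc) hK ha (by
      change 1 / (K + 1) * K < 1
      rw [one_div, inv_mul_lt_iff₀ (by positivity)]; linarith)
  refine ⟨1 / (K + 1), B + 1, φ, D, ha, by positivity, hφ, hD, hφ0, hD0, hφt, hφz, hDt, ?_, ?_⟩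
  · intro z
    refine ODE_solution_unique_of_mem_Ioo (v := fun t x => fderiv ℝ V (φ z t) x)
      (s := fun _ => univ) (K := ⟨K, hK0⟩) (t₀ := 0) ?_ ⟨by linarith, ha⟩ ?_ ?_ ?_
    · intro t _
      exact ((fderiv ℝ V (φ z t)).lipschitz.weaken (hK _)).lipschitzOnWith
    · exact fun t ht => ⟨hDt z (V z) t ht, mem_univ _⟩
    · exact fun t ht => ⟨(hVd (φ z t)).comp_hasDerivAt t (hφt z t ht), mem_univ _⟩
    · rw [hD0, hφ0]
  · intro z t ht
    have h := (convex_Ioo (-(1 / (K + 1))) (1 / (K + 1))).norm_image_sub_le_of_norm_hasDerivWithin_le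
      (f := φ z) (x := 0) (y := t) (C := B) (fun s hs => (hφt z s hs).hasDerivWithinAt)
      (fun s _ => hB _) ⟨by linarith, ha⟩ ht
    rw [hφ0, sub_zero, Real.norm_eq_abs] at h
    exact h.trans (mul_le_mul_of_nonneg_right (by linarith) (abs_nonneg t))

/-- The linearized flow of a conformally symplectic vector field rescales the symplectic form. -/
theorem inner_complexStructure_linearized_flow
    {E : Type*} [NormedAddCommGroup E] [InnerProductSpace ℝ E] {J : E →L[ℝ] E}
    {A : ℝ → E →L[ℝ] E} {σ r : ℝ} {u v : ℝ → E}
    (hu : ∀ t ∈ Ioo (-r) r, HasDerivAt u (A t (u t)) t)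
    (hv : ∀ t ∈ Ioo (-r) r, HasDerivAt v (A t (v t)) t)
    (hA : ∀ t ∈ Ioo (-r) r, ∀ x y : E,
      inner ℝ (J (A t x)) y + inner ℝ (J x) (A t y) = σ * inner ℝ (J x) y)
    {t : ℝ} (ht : t ∈ Ioo (-r) r) :
    inner ℝ (J (u t)) (v t) = exp (σ * t) * inner ℝ (J (u 0)) (v 0) := by
  have h0 : (0 : ℝ) ∈ Ioo (-r) r := by
    have := ht.1.trans ht.2
    constructor <;> linarith
  have key : ∀ s ∈ Ioo (-r) r,
      HasDerivAt (fun s => exp (-(σ * s)) * inner ℝ (J (u s)) (v s)) 0 s := by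
    intro s hs
    have h1 : HasDerivAt (fun s => exp (-(σ * s))) (exp (-(σ * s)) * (-(σ * 1))) s :=
      (((hasDerivAt_id s).const_mul σ).neg).exp
    have h2 := ((J.hasFDerivAt.comp_hasDerivAt s (hu s hs)).inner ℝ (hv s hs))
    convert! h1.mul h2 using 1
    have := hA s hs (u s) (v s)
    simp only [Function.comp_apply]
    rw [add_comm (inner ℝ (J (u s)) _), this]
    ring
  have hconst := (convex_Ioo (-r) r).norm_image_sub_le_of_norm_hasDerivWithin_le (C := 0)
    (fun s hs => (key s hs).hasDerivWithinAt) (fun s _ => by simp) h0 ht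
  rw [zero_mul, norm_le_zero_iff, sub_eq_zero] at hconst
  simp only [mul_zero, neg_zero, exp_zero, one_mul] at hconst
  rw [← hconst, ← mul_assoc, ← exp_add]
  simp

end CompactlySupportedFlow

section CollarTime

open Set Filter Topology

theorem exists_slope_eq_hasDerivAt {q q' : ℝ → ℝ} {r : ℝ}
    (hq : ∀ t ∈ Ioo (-r) r, HasDerivAt q (q' t) t) {x y : ℝ} (hx : x ∈ Ioo (-r) r)
    (hy : y ∈ Ioo (-r) r) : ∃ z ∈ Ioo (-r) r, q y - q x = q' z * (y - x) := by
  wlog hxy : x ≤ y generalizing x y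
  · obtain ⟨z, hz, h⟩ := this hy hx (le_of_not_ge hxy)
    exact ⟨z, hz, by linarith⟩
  rcases hxy.eq_or_lt with rfl | hlt
  · exact ⟨x, hx, by simp⟩
  obtain ⟨z, hz, h⟩ := exists_hasDerivAt_eq_slope q q' hlt
    (fun t ht => (hq t ⟨hx.1.trans_le ht.1, ht.2.trans_lt hy.2⟩).continuousAt.continuousWithinAt)
    (fun t ht => hq t ⟨hx.1.trans ht.1, ht.2.trans hy.2⟩)
  refine ⟨z, ⟨hx.1.trans hz.1, hz.2.trans hy.2⟩, ?_⟩
  rw [h, div_mul_cancel₀ _ (by linarith)]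

theorem exists_zero_of_deriv_ge {q q' : ℝ → ℝ} {c r : ℝ} (hr : 0 < r)
    (hq : ∀ t ∈ Ioo (-r) r, HasDerivAt q (q' t) t) (hq' : ∀ t ∈ Ioo (-r) r, c ≤ q' t)
    (h0 : |q 0| < c * (r / 2)) : ∃ t ∈ Ioo (-r) r, q t = 0 := by
  have m0 : (0 : ℝ) ∈ Ioo (-r) r := by constructor <;> linarith
  have m1 : (r / 2 : ℝ) ∈ Ioo (-r) r := by constructor <;> linarith
  have m2 : (-(r / 2) : ℝ) ∈ Ioo (-r) r := by constructor <;> linarith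
  obtain ⟨x, hx, hx'⟩ := exists_slope_eq_hasDerivAt hq m0 m1
  obtain ⟨y, hy, hy'⟩ := exists_slope_eq_hasDerivAt hq m2 m0
  have hx2 := mul_le_mul_of_nonneg_right (hq' x hx) (show 0 ≤ r / 2 by linarith)
  have hy2 := mul_le_mul_of_nonneg_right (hq' y hy) (show 0 ≤ r / 2 by linarith)
  have habs := abs_lt.1 h0
  rw [sub_zero] at hx'
  have hy3 : q 0 - q (-(r / 2)) = q' y * (r / 2) := by rw [hy']; ring
  obtain ⟨t, ht, h⟩ := intermediate_value_Icc (f := q) (show -(r / 2) ≤ r / 2 by linarith)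
    (fun t ht => (hq t ⟨by linarith [ht.1], by linarith [ht.2]⟩).continuousAt.continuousWithinAt)
    (show (0 : ℝ) ∈ Icc (q (-(r / 2))) (q (r / 2)) by constructor <;> linarith)
  exact ⟨t, ⟨by linarith [ht.1], by linarith [ht.2]⟩, h⟩

theorem eq_of_deriv_pos {q q' : ℝ → ℝ} {r : ℝ}
    (hq : ∀ t ∈ Ioo (-r) r, HasDerivAt q (q' t) t) (hq' : ∀ t ∈ Ioo (-r) r, 0 < q' t)
    {x y : ℝ} (hx : x ∈ Ioo (-r) r) (hy : y ∈ Ioo (-r) r) (hxy : q x = q y) : x = y := by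
  obtain ⟨z, hz, h⟩ := exists_slope_eq_hasDerivAt hq hx hy
  rw [hxy, sub_self] at h
  rcases mul_eq_zero.1 h.symm with h | h
  · exact absurd h (hq' z hz).ne'
  · linarith

/-- Sublevels of a function that is positive at infinity concentrate around its zero set. -/
theorem exists_sublevel_subset {E : Type*} [NormedAddCommGroup E] [NormedSpace ℝ E]
    [FiniteDimensional ℝ E] {g : E → ℝ} (hg : Continuous g) {R : ℝ} (hR : ∀ z, R ≤ ‖z‖ → 1 ≤ g z)
    {W : Set E} (hW : IsOpen W) (hMW : g ⁻¹' {0} ⊆ W) :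
    ∃ ε, 0 < ε ∧ ∀ z, |g z| < ε → z ∈ W := by
  have hK : IsCompact (Metric.closedBall (0 : E) R \ W) := (isCompact_closedBall 0 R).diff hW
  rcases (Metric.closedBall (0 : E) R \ W).eq_empty_or_nonempty with h | h
  · refine ⟨1, one_pos, fun z hz => ?_⟩
    by_contra hzW
    have : ‖z‖ < R := by
      by_contra! h'
      exact absurd (hR z h') (not_le.2 ((le_abs_self _).trans_lt hz))
    exact (eq_empty_iff_forall_notMem.1 h z) ⟨by simpa using this.le, hzW⟩
  · obtain ⟨x, hx, hmin⟩ := hK.exists_isMinOn h hg.abs.continuousOn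
    have hx0 : 0 < |g x| := abs_pos.2 fun h0 => hx.2 (hMW h0)
    refine ⟨min 1 |g x|, lt_min one_pos hx0, fun z hz => ?_⟩
    by_contra hzW
    have : ‖z‖ < R := by
      by_contra! h'
      exact absurd (hR z h') (not_le.2 ((le_abs_self _).trans_lt (hz.trans_le (min_le_left _ _))))
    have h2 := hmin (show z ∈ _ from ⟨by simpa using this.le, hzW⟩)
    exact absurd (hz.trans_le (min_le_right _ _)) (not_lt.2 h2)

variable {E : Type*} [NormedAddCommGroup E] [InnerProductSpace ℝ E] [FiniteDimensional ℝ E]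

/-- The collar of a regular level set defined by the flow of a transverse vector field: the time
`s` needed to reach a point from the level set. -/
theorem exists_collar_time {g : E → ℝ} (hg : ContDiff ℝ ∞ g) (hM : IsCompact (g ⁻¹' {0}))
    (hMne : (g ⁻¹' {0}).Nonempty) {ε₀ : ℝ} (hε₀ : 0 < ε₀) {R : ℝ} (hR : ∀ z, R ≤ ‖z‖ → 1 ≤ g z)
    {V : E → E} (hV : ContDiff ℝ ∞ V)
    {N : Set E} (hN : IsOpen N) (hMN : g ⁻¹' {0} ⊆ N) (hgV : ∀ x ∈ N, 0 < fderiv ℝ g x (V x))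
    {a B : ℝ} {φ : E → ℝ → E} {D : E → ℝ → E →L[ℝ] E} (ha : 0 < a) (hB : 0 < B)
    (hφ : Continuous ↿φ) (hD : Continuous ↿D) (hφ0 : ∀ z, φ z 0 = z)
    (hφt : ∀ z, ∀ t ∈ Ioo (-a) a, HasDerivAt (φ z) (V (φ z t)) t)
    (hφz : ∀ z, ∀ t, HasFDerivAt (fun x => φ x t) (D z t) z)
    (hφB : ∀ z, ∀ t ∈ Ioo (-a) a, ‖φ z t - z‖ ≤ B * |t|) :
    ∃ (r ε L : ℝ) (s : E → ℝ) (S : E → E), 0 < r ∧ r ≤ a ∧ 0 < ε ∧ ε ≤ ε₀ ∧ ε ≤ 1 ∧ 0 < L ∧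
      ContinuousOn S {z | |g z| < ε} ∧ ∀ z, |g z| < ε →
        (∀ t ∈ Ioo (-r) r, φ z t ∈ N) ∧ -s z ∈ Ioo (-r) r ∧ g (φ z (-s z)) = 0 ∧
        (∃ κ, 0 < κ ∧ κ ≤ L ∧ g z = κ * s z) ∧ HasGradientAt s (S z) z ∧
        ∀ b, inner ℝ (S z) b * fderiv ℝ g (φ z (-s z)) (V (φ z (-s z))) =
          fderiv ℝ g (φ z (-s z)) (D z (-s z) b) := by
  have hgd : ∀ x, HasFDerivAt g (fderiv ℝ g x) x := fun x =>
    (hg.differentiable (by simp) x).hasFDerivAt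
  have hgc : Continuous (fderiv ℝ g) := hg.continuous_fderiv (by simp)
  let d : E → ℝ := fun x => fderiv ℝ g x (V x)
  have hd : Continuous d := hgc.clm_apply hV.continuous
  obtain ⟨η, hη, hηN⟩ := hM.exists_cthickening_subset_open hN hMN
  have hKc : IsCompact (Metric.cthickening η (g ⁻¹' {0})) := hM.cthickening
  have hKne : (Metric.cthickening η (g ⁻¹' {0})).Nonempty :=
    hMne.mono (Metric.self_subset_cthickening _)
  obtain ⟨x₀, hx₀, hmin⟩ := hKc.exists_isMinOn hKne hd.continuousOn
  obtain ⟨x₁, hx₁, hmax⟩ := hKc.exists_isMaxOn hKne hd.continuousOn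
  have hc0 : 0 < d x₀ := hgV _ (hηN hx₀)
  have hc1 : 0 < d x₁ := hgV _ (hηN hx₁)
  set r := min a (η / (2 * B)) with hr_def
  have hr : 0 < r := lt_min ha (by positivity)
  have hra : Ioo (-r) r ⊆ Ioo (-a) a := Ioo_subset_Ioo (neg_le_neg (min_le_left _ _))
    (min_le_left _ _)
  obtain ⟨ε₁, hε₁, hε₁W⟩ := exists_sublevel_subset hg.continuous hR
    (Metric.isOpen_thickening (δ := η / 2) (E := g ⁻¹' {0}))
    (Metric.self_subset_thickening (by positivity) _)
  set ε := min (min ε₀ 1) (min ε₁ (d x₀ * (r / 2))) with hε_def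
  have hε : 0 < ε := lt_min (lt_min hε₀ one_pos) (lt_min hε₁ (by positivity))
  have hthick : ∀ z, |g z| < ε → ∀ t ∈ Ioo (-r) r,
      φ z t ∈ Metric.cthickening η (g ⁻¹' {0}) := by
    intro z hz t ht
    obtain ⟨x, hx, hxz⟩ := Metric.mem_thickening_iff.1
      (hε₁W z (hz.trans_le ((min_le_right _ _).trans (min_le_left _ _))))
    refine Metric.mem_cthickening_of_dist_le _ x _ _ hx ?_
    have h1 := hφB z t (hra ht)
    have h2 : |t| < η / (2 * B) := (abs_lt.2 ht).trans_le (min_le_right _ _)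
    have h3 : B * |t| ≤ η / 2 := by
      calc B * |t| ≤ B * (η / (2 * B)) := mul_le_mul_of_nonneg_left h2.le hB.le
        _ = η / 2 := by field_simp
    have h4 := dist_triangle (φ z t) z x
    rw [← dist_eq_norm] at h1
    linarith
  have hq : ∀ z, ∀ t ∈ Ioo (-r) r, HasDerivAt (fun t => g (φ z t)) (d (φ z t)) t := fun z t ht =>
    (hgd (φ z t)).comp_hasDerivAt t (hφt z t (hra ht))
  have hzero : ∀ z, ∃ t, |g z| < ε → t ∈ Ioo (-r) r ∧ g (φ z t) = 0 := by
    intro z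
    by_cases hz : |g z| < ε
    · obtain ⟨t, ht, h⟩ := exists_zero_of_deriv_ge (c := d x₀) hr (hq z)
        (fun t ht => hmin (hthick z hz t ht)) (by
          simp only [hφ0]
          exact hz.trans_le ((min_le_right _ _).trans (min_le_right _ _)))
      exact ⟨t, fun _ => ⟨ht, h⟩⟩
    · exact ⟨0, fun h => absurd h hz⟩
  choose τ hτ using hzero
  let s : E → ℝ := fun z => -τ z
  have hs : ∀ z, -s z = τ z := fun z => neg_neg _
  let p : E → E := fun z => φ z (τ z)
  have hp : ∀ z, |g z| < ε → 0 < d (p z) := fun z hz =>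
    hgV _ (hηN (hthick z hz _ (hτ z hz).1))
  let S' : E → E →L[ℝ] ℝ := fun z => (d (p z))⁻¹ • (fderiv ℝ g (p z)).comp (D z (τ z))
  let S : E → E := fun z => (InnerProductSpace.toDual ℝ E).symm (S' z)
  have hopen : IsOpen {z | |g z| < ε} := isOpen_lt hg.continuous.abs continuous_const
  have hτd : ∀ z, |g z| < ε → HasFDerivAt τ (-(S' z)) z := by
    intro z hz
    have hmem := (hτ z hz).1
    have hda : ∀ᶠ v : E × ℝ in 𝓝 (z, τ z), v.2 ∈ Ioo (-r) r :=
      continuousAt_snd.eventually (isOpen_Ioo.mem_nhds hmem)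
    have hstrict : HasStrictFDerivAt ↿φ _ (z, τ z) := hasStrictFDerivAt_uncurry_coprod
      (f := φ) (f₁ := D) (f₂ := fun z t => ContinuousLinearMap.toSpanSingleton ℝ (V (φ z t)))
      (Eventually.of_forall fun v => hφz v.1 v.2)
      (hda.mono fun v hv => (hφt v.1 v.2 (hra hv)).hasFDerivAt)
      hD.continuousAt
      (by
        have : Continuous fun v : E × ℝ => ContinuousLinearMap.toSpanSingleton ℝ (V (φ v.1 v.2)) :=
          (ContinuousLinearMap.toSpanSingletonCLE (𝕜 := ℝ) (E := E)).continuous.comp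
            (hV.continuous.comp hφ)
        exact this.continuousAt)
    have hgs : HasStrictFDerivAt g (fderiv ℝ g (p z)) (p z) :=
      hg.contDiffAt.hasStrictFDerivAt (by simp)
    have hk := HasStrictFDerivAt.comp (g := g) (f := ↿φ) (z, τ z) hgs hstrict
    have hinv : (((fderiv ℝ g (p z)).comp ((D z (τ z)).coprod
        (ContinuousLinearMap.toSpanSingleton ℝ (V (φ z (τ z)))))) ∘L
          ContinuousLinearMap.inr ℝ E ℝ).IsInvertible := by
      refine ⟨ContinuousLinearEquiv.unitsEquivAut ℝ (Units.mk0 (d (p z)) (hp z hz).ne'), ?_⟩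
      ext
      simp [d, p]
    have hψ1 := hk.hasStrictFDerivAt_implicitFunctionOfProdDomain hinv
    have hψ2 := hk.tendsto_implicitFunctionOfProdDomain hinv
    have hψ3 := hk.eventually_apply_implicitFunctionOfProdDomain hinv
    set ψ := hk.implicitFunctionOfProdDomain hinv
    have heq : τ =ᶠ[𝓝 z] ψ := by
      filter_upwards [hopen.mem_nhds hz, hψ2 (isOpen_Ioo.mem_nhds hmem), hψ3] with x hx hx1 hx2
      refine eq_of_deriv_pos (hq x) (fun t ht => hgV _ (hηN (hthick x hx t ht)))
        (hτ x hx).1 hx1 ?_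
      rw [(hτ x hx).2]
      exact ((hx2.trans (hτ z hz).2)).symm
    have hτ1 : HasFDerivAt τ _ z := hψ1.hasFDerivAt.congr_of_eventuallyEq heq
    have hτ2 : HasFDerivAt τ (fderiv ℝ τ z) z := hτ1.differentiableAt.hasFDerivAt
    have hcomp := hk.hasFDerivAt.comp (f := fun x => (x, τ x)) z ((hasFDerivAt_id z).prodMk hτ2)
    have hconst : HasFDerivAt (fun x => g (φ x (τ x))) (0 : E →L[ℝ] ℝ) z := by
      refine (hasFDerivAt_const (0 : ℝ) z).congr_of_eventuallyEq ?_
      filter_upwards [hopen.mem_nhds hz] with x hx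
      exact (hτ x hx).2
    have huniq := hcomp.unique hconst
    have : fderiv ℝ τ z = -(S' z) := by
      ext b
      have h1 := congrArg (fun A : E →L[ℝ] ℝ => A b) huniq
      have h2 : fderiv ℝ g (p z) (D z (τ z) b + fderiv ℝ τ z b • V (p z)) = 0 := h1
      rw [map_add, map_smul, smul_eq_mul] at h2
      have h3 : fderiv ℝ τ z b * d (p z) = - fderiv ℝ g (p z) (D z (τ z) b) := by
        simp only [d]; linarith
      change _ = -((d (p z))⁻¹ * fderiv ℝ g (p z) (D z (τ z) b))
      have := (hp z hz).ne'
      field_simp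
      linarith
    rw [← this]
    exact hτ2
  have hsd : ∀ z, |g z| < ε → HasGradientAt s (S z) z := by
    intro z hz
    have h := (hτd z hz).neg
    rw [neg_neg] at h
    change HasFDerivAt s (InnerProductSpace.toDual ℝ E (S z)) z
    rw [LinearIsometryEquiv.apply_symm_apply]
    exact h
  have hτc : ContinuousOn τ {z | |g z| < ε} := fun z hz =>
    (hτd z hz).continuousAt.continuousWithinAt
  have hpair : ContinuousOn (fun z => (z, τ z)) {z | |g z| < ε} := continuousOn_id.prodMk hτc
  have hpc : ContinuousOn p {z | |g z| < ε} := hφ.comp_continuousOn hpair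
  refine ⟨r, ε, d x₁, s, S, hr, min_le_left _ _, hε, (min_le_left _ _).trans (min_le_left _ _),
    (min_le_left _ _).trans (min_le_right _ _), hc1, ?_, fun z hz => ?_⟩
  · refine (InnerProductSpace.toDual ℝ E).symm.continuous.comp_continuousOn ?_
    exact ((hd.comp_continuousOn hpc).inv₀ fun z hz => (hp z hz).ne').smul
      ((hgc.comp_continuousOn hpc).clm_comp (hD.comp_continuousOn hpair))
  · rw [hs]
    refine ⟨fun t ht => hηN (hthick z hz t ht), (hτ z hz).1, (hτ z hz).2, ?_, hsd z hz, ?_⟩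
    · obtain ⟨ξ, hξ, h⟩ := exists_slope_eq_hasDerivAt (hq z) (hτ z hz).1
        (show (0 : ℝ) ∈ Ioo (-r) r by constructor <;> linarith)
      rw [(hτ z hz).2, hφ0] at h
      refine ⟨d (φ z ξ), hgV _ (hηN (hthick z hz ξ hξ)), hmax (hthick z hz ξ hξ), ?_⟩
      simp only [s]
      linarith
    · intro b
      have h1 : inner ℝ (S z) b = S' z b := InnerProductSpace.toDual_symm_apply
      rw [h1]
      change (d (p z))⁻¹ * fderiv ℝ g (p z) (D z (τ z) b) * d (p z) =
        fderiv ℝ g (p z) (D z (τ z) b)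
      have := (hp z hz).ne'
      field_simp

end CollarTime

section CollarHamiltonian

open Set Filter Topology

variable {E : Type*} [NormedAddCommGroup E] [InnerProductSpace ℝ E] [FiniteDimensional ℝ E]

theorem HasGradientAt.eq_zero_of_extr {H : E → ℝ} {G z : E}
    (h : HasGradientAt H G z) (hz : IsLocalExtr H z) : G = 0 := by
  have h1 := hz.hasFDerivAt_eq_zero h.hasFDerivAt
  exact (InnerProductSpace.toDual ℝ E).map_eq_zero_iff.1 h1

/-- A function on the whole space which is a function of the collar time near a level set, and
which is constant on both sides of the collar. -/
theorem exists_collar_function {g : E → ℝ} (hg : Continuous g) {ε L : ℝ} (hε : 0 < ε)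
    (hL : 0 < L) {s : E → ℝ} {S : E → E} (hS : ContinuousOn S {z | |g z| < ε})
    (hs : ∀ z, |g z| < ε → (∃ κ, 0 < κ ∧ κ ≤ L ∧ g z = κ * s z) ∧ HasGradientAt s (S z) z) :
    ∃ (H : E → ℝ) (G : E → E) (k : ℝ → ℝ), (∀ z, HasGradientAt H (G z) z) ∧ Continuous G ∧
      (∀ z, 0 ≤ H z) ∧ (∀ z, H z ≤ 1) ∧ (∀ z, ε ≤ g z → H z = 1) ∧ (∀ z, g z ≤ -ε → H z = 0) ∧
      ∀ z, |g z| < ε → G z = k (s z) • S z := by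
  let δ : ℝ := ε / (2 * L)
  have hδ : 0 < δ := by positivity
  let f : ℝ → ℝ := fun t => Real.smoothTransition ((t / δ + 1) / 2)
  have hf : ContDiff ℝ 1 f := Real.smoothTransition.contDiff.comp (by fun_prop)
  have hfd : ∀ t, HasDerivAt f (deriv f t) t := fun t =>
    (hf.differentiable one_ne_zero t).hasDerivAt
  have hfc : Continuous (deriv f) := hf.continuous_deriv le_rfl
  have hf1 : ∀ t, δ ≤ t → f t = 1 := fun t ht => Real.smoothTransition.one_of_one_le (by
    have := (one_le_div hδ).2 ht
    linarith)
  have hf0 : ∀ t, t ≤ -δ → f t = 0 := fun t ht => Real.smoothTransition.zero_of_nonpos (by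
    have : t / δ ≤ -1 := by rw [div_le_iff₀ hδ]; linarith
    linarith)
  have hfd0 : ∀ t, δ < |t| → deriv f t = 0 := by
    intro t ht
    rcases lt_abs.1 ht with h | h
    · have : f =ᶠ[𝓝 t] fun _ => 1 := by
        filter_upwards [lt_mem_nhds h] with x hx using hf1 x hx.le
      rw [this.deriv_eq, deriv_const]
    · have : f =ᶠ[𝓝 t] fun _ => 0 := by
        filter_upwards [gt_mem_nhds (show t < -δ by linarith)] with x hx using hf0 x hx.le
      rw [this.deriv_eq, deriv_const]
  have hsg : ∀ z, |g z| < ε → ε / 2 < g z → δ < s z := by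
    intro z hz h
    obtain ⟨κ, hκ, hκL, he⟩ := (hs z hz).1
    have hs0 : 0 < s z := by
      by_contra! h'
      have := mul_nonpos_of_nonneg_of_nonpos hκ.le h'
      linarith
    have := mul_le_mul_of_nonneg_right hκL hs0.le
    rw [div_lt_iff₀ (by positivity)]
    linarith
  have hsg' : ∀ z, |g z| < ε → g z < -(ε / 2) → s z < -δ := by
    intro z hz h
    obtain ⟨κ, hκ, hκL, he⟩ := (hs z hz).1
    have hs0 : s z < 0 := by
      by_contra! h'
      have := mul_nonneg hκ.le h'
      linarith
    have := mul_le_mul_of_nonneg_right hκL (neg_nonneg.2 hs0.le)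
    have : ε / (2 * L) < - s z := by
      rw [div_lt_iff₀ (by positivity)]
      linarith
    linarith
  let H : E → ℝ := fun z => if |g z| < ε then f (s z) else if 0 < g z then 1 else 0
  let G : E → E := fun z => if |g z| < ε then deriv f (s z) • S z else 0
  have hopen : IsOpen {z | |g z| < ε} := isOpen_lt hg.abs continuous_const
  have hH1 : ∀ z, ε / 2 < g z → H z = 1 := by
    intro z hz
    by_cases h : |g z| < ε
    · simp only [H, if_pos h]
      exact hf1 _ (hsg z h hz).le
    · simp only [H, if_neg h, if_pos (show 0 < g z by linarith)]
  have hH0 : ∀ z, g z < -(ε / 2) → H z = 0 := by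
    intro z hz
    by_cases h : |g z| < ε
    · simp only [H, if_pos h]
      exact hf0 _ (hsg' z h hz).le
    · simp only [H, if_neg h, if_neg (show ¬ 0 < g z by linarith)]
  have hG0 : ∀ z, ε / 2 < |g z| → G z = 0 := by
    intro z hz
    by_cases h : |g z| < ε
    · have : deriv f (s z) = 0 := by
        refine hfd0 _ (lt_abs.2 ?_)
        rcases lt_abs.1 hz with h' | h'
        · exact Or.inl (hsg z h h')
        · right
          linarith [hsg' z h (by linarith)]
      simp only [G, if_pos h, this, zero_smul]
    · simp only [G, if_neg h]
  refine ⟨H, G, deriv f, fun z => ?_, ?_, fun z => ?_, fun z => ?_, fun z hz => hH1 z (by linarith),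
    fun z hz => hH0 z (by linarith), fun z hz => if_pos hz⟩
  · by_cases h : |g z| < ε
    · have h1 : H =ᶠ[𝓝 z] f ∘ s := by
        filter_upwards [hopen.mem_nhds h] with x hx using if_pos hx
      have h2 := (hfd (s z)).comp_hasFDerivAt z (hs z h).2.hasFDerivAt
      have h3 : HasFDerivAt H (InnerProductSpace.toDual ℝ E (G z)) z := by
        refine (h2.congr_of_eventuallyEq h1).congr_fderiv ?_
        simp only [G, if_pos h, map_smul]
      exact h3
    · have hz : ε / 2 < |g z| := by linarith [not_lt.1 h]
      rw [hG0 z hz]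
      rcases lt_abs.1 hz with h' | h'
      · have : H =ᶠ[𝓝 z] fun _ => 1 := by
          filter_upwards [continuousAt_const.eventually_lt hg.continuousAt h'] with x hx
            using hH1 x hx
        exact (hasGradientAt_const z (1 : ℝ)).congr_of_eventuallyEq this
      · have : H =ᶠ[𝓝 z] fun _ => 0 := by
          filter_upwards [hg.continuousAt.eventually_lt continuousAt_const
            (show g z < -(ε / 2) by linarith)] with x hx using hH0 x hx
        exact (hasGradientAt_const z (0 : ℝ)).congr_of_eventuallyEq this
  · refine continuous_iff_continuousAt.2 fun z => ?_
    by_cases h : |g z| < ε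
    · have h1 : G =ᶠ[𝓝 z] fun z => deriv f (s z) • S z := by
        filter_upwards [hopen.mem_nhds h] with x hx using if_pos hx
      refine ContinuousAt.congr ?_ h1.symm
      exact (hfc.continuousAt.comp (hs z h).2.continuousAt).smul (hS.continuousAt (hopen.mem_nhds h))
    · have h1 : G =ᶠ[𝓝 z] fun _ => 0 := by
        filter_upwards [continuousAt_const.eventually_lt hg.abs.continuousAt
          (show ε / 2 < |g z| by linarith [not_lt.1 h])] with x hx using hG0 x hx
      exact continuousAt_const.congr h1.symm
  · simp only [H]
    split_ifs
    · exact Real.smoothTransition.nonneg _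
    · exact zero_le_one
    · exact le_rfl
  · simp only [H]
    split_ifs
    · exact Real.smoothTransition.le_one _
    · exact le_rfl
    · exact zero_le_one

theorem hasDerivAt_max_zero_sq (t : ℝ) : HasDerivAt (fun t : ℝ => max t 0 ^ 2 / 2) (max t 0) t := by
  rcases lt_trichotomy t 0 with h | rfl | h
  · rw [max_eq_right h.le]
    refine (hasDerivAt_const t (0 : ℝ)).congr_of_eventuallyEq ?_
    filter_upwards [gt_mem_nhds h] with x hx
    rw [max_eq_right hx.le]; norm_num
  · rw [max_self, hasDerivAt_iff_isLittleO]
    simp only [max_self, sub_zero, smul_zero]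
    refine Asymptotics.isLittleO_iff.2 fun c hc => ?_
    filter_upwards [Metric.ball_mem_nhds (0 : ℝ) hc] with x hx
    rw [Metric.mem_ball, dist_zero_right] at hx
    have h1 : max x 0 ^ 2 ≤ ‖x‖ ^ 2 := by
      rw [Real.norm_eq_abs]
      exact pow_le_pow_left₀ (le_max_right _ _) (max_le (le_abs_self _) (abs_nonneg _)) 2
    have h2 : 0 ≤ max x 0 ^ 2 := sq_nonneg _
    rw [Real.norm_eq_abs (_ - _), abs_of_nonneg (by nlinarith)]
    nlinarith [norm_nonneg x]
  · rw [max_eq_left h.le]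
    have : HasDerivAt (fun t : ℝ => t ^ 2 / 2) t t := by
      convert! (hasDerivAt_pow 2 t).div_const 2 using 1
      norm_num
    refine this.congr_of_eventuallyEq ?_
    filter_upwards [lt_mem_nhds h] with x hx
    rw [max_eq_left hx.le]

end CollarHamiltonian

section PlateauOrbit

open Set Filter Topology

theorem exists_exterior_profile : ∃ k k' : ℝ → ℝ, (∀ t, HasDerivAt k (k' t) t) ∧ Continuous k' ∧
    (∀ t, 0 ≤ k t) ∧ (∀ t, t ≤ 0 → k t = 0 ∧ k' t = 0) ∧ (∀ t, 1 ≤ t → k' t = 1) ∧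
    (∀ t, 0 ≤ k' t) ∧ (∀ t, k' t ≤ 1) ∧ (∀ t, t - 1 ≤ k t) ∧ (∀ t, k t ≤ max t 0) ∧
    ∀ t, k' t * t ≤ k t + 1 := by
  refine ⟨fun t => max t 0 ^ 2 / 2 - max (t - 1) 0 ^ 2 / 2, fun t => max t 0 - max (t - 1) 0,
    fun t => ?_, by fun_prop, fun t => ?_, fun t ht => ?_, fun t ht => ?_, fun t => ?_, fun t => ?_,
    fun t => ?_, fun t => ?_, fun t => ?_⟩
  · refine (hasDerivAt_max_zero_sq t).sub ?_
    have := (hasDerivAt_max_zero_sq (t - 1)).comp t ((hasDerivAt_id t).sub_const 1)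
    simpa [Function.comp_def] using this
  all_goals
    dsimp only
    rcases le_total t 0 with h0 | h0 <;> rcases le_total (t - 1) 0 with h1 | h1 <;>
    simp only [max_eq_left h0, max_eq_left h1, max_eq_right h0, max_eq_right h1] <;>
    first | nlinarith | (constructor <;> nlinarith)

variable {E : Type*} [NormedAddCommGroup E] [InnerProductSpace ℝ E] [FiniteDimensional ℝ E]
  [Nontrivial E]

theorem exists_periodic_orbit_of_plateau_at_zero {J : E →L[ℝ] E} (hJ : ∀ x, J (J x) = -x)
    (hJs : ∀ x y, inner ℝ (J x) y = -inner ℝ x (J y)) {H₀ : E → ℝ} {G₀ : E → E}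
    (hH₀ : ∀ z, HasGradientAt H₀ (G₀ z) z) (hG₀ : Continuous G₀) (h0 : ∀ z, 0 ≤ H₀ z)
    (h1 : ∀ z, H₀ z ≤ 1) {r R : ℝ} (hr : 0 < r) (hHr : ∀ z, ‖z‖ ≤ r → H₀ z = 0)
    (hHR : ∀ z, R ≤ ‖z‖ → H₀ z = 1) :
    ∃ (m : ℝ) (x : ℝ → E), 0 < m ∧ Function.Periodic x 1 ∧
      (∀ t, HasDerivAt x (m • J (G₀ (x t))) t) ∧ (∀ t, 0 < H₀ (x t) ∧ H₀ (x t) < 1) ∧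
      ∃ t, G₀ (x t) ≠ 0 := by
  obtain ⟨k, k', hk, hk'c, hk0, hkn, hk'1, hk'0, hk'le, hkge, hkle, hkk⟩ := exists_exterior_profile
  obtain ⟨ρ, hρr, hρR⟩ : ∃ ρ, r ≤ ρ ∧ R ≤ ρ := ⟨max r R, le_max_left _ _, le_max_right _ _⟩
  have hρ : 0 < ρ := hr.trans_le hρr
  obtain ⟨q, hq1, hq2⟩ : ∃ q, π < q ∧ q < 2 * π := ⟨3 * π / 2, by linarith [pi_pos], by
    linarith [pi_pos]⟩
  have hq : 0 < q := pi_pos.trans hq1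
  obtain ⟨m, hm⟩ : ∃ m, m = q * (ρ ^ 2 + 1) := ⟨_, rfl⟩
  have hm0 : 0 < m := by rw [hm]; positivity
  have hGe : ∀ z, H₀ z = 0 ∨ H₀ z = 1 → G₀ z = 0 := by
    intro z hz
    refine (hH₀ z).eq_zero_of_extr ?_
    rcases hz with hz | hz
    · exact Or.inl (Eventually.of_forall fun x => by rw [hz]; exact h0 x)
    · exact Or.inr (Eventually.of_forall fun x => by rw [hz]; exact h1 x)
  let H : E → ℝ := fun z => m * H₀ z + q * k (‖z‖ ^ 2 - ρ ^ 2)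
  let F : E → E := fun z => m • G₀ z + (2 * q * (k' (‖z‖ ^ 2 - ρ ^ 2) - 1)) • z
  let G : E → E := fun z => m • G₀ z + (2 * q * k' (‖z‖ ^ 2 - ρ ^ 2)) • z
  have hGF : ∀ z, G z = F z + (2 * q) • z := fun z => by
    simp only [G, F]
    module
  have hFc : Continuous F := by fun_prop
  have hFs : HasCompactSupport F := by
    refine HasCompactSupport.intro (isCompact_closedBall (0 : E) (ρ + 1)) fun z hz => ?_
    have hz' : ρ + 1 < ‖z‖ := by simpa using hz
    have e1 : G₀ z = 0 := hGe z (Or.inr (hHR z (by linarith)))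
    have e2 : k' (‖z‖ ^ 2 - ρ ^ 2) = 1 := hk'1 _ (by nlinarith)
    simp [F, e1, e2]
  obtain ⟨C₁, hC₁⟩ := hFs.exists_bound_of_continuous hFc
  have hC₁0 : 0 ≤ C₁ := (norm_nonneg _).trans (hC₁ 0)
  have hH : ∀ z, HasGradientAt H (G z) z := by
    intro z
    have e1 : HasFDerivAt (fun z : E => ‖z‖ ^ 2 - ρ ^ 2) (2 • innerSL ℝ z) z :=
      ((hasStrictFDerivAt_norm_sq z).hasFDerivAt).sub_const _
    have e2 := ((hH₀ z).hasFDerivAt.const_mul m).add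
      (((hk (‖z‖ ^ 2 - ρ ^ 2)).comp_hasFDerivAt z e1).const_mul q)
    have e3 : HasFDerivAt H (InnerProductSpace.toDual ℝ E (G z)) z := by
      refine e2.congr_fderiv ?_
      ext v
      simp only [G, map_add, map_smul, add_apply,
        smul_apply, InnerProductSpace.toDual_apply_apply, innerSL_apply_apply,
        smul_eq_mul, nsmul_eq_mul]
      push_cast
      ring
    exact e3
  have hnorm : ∀ z : E, H₀ z ≠ 1 → ‖z‖ < ρ := fun z hz => by
    by_contra! h
    exact hz (hHR z (by linarith))
  have hin : ∀ z : E, ‖z‖ ≤ ρ → k (‖z‖ ^ 2 - ρ ^ 2) = 0 ∧ k' (‖z‖ ^ 2 - ρ ^ 2) = 0 := fun z hz =>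
    hkn _ (by nlinarith [norm_nonneg z])
  obtain ⟨C, hC⟩ : ∃ C, C = m / r ^ 2 + q + q * (ρ ^ 2 + 1) + C₁ := ⟨_, rfl⟩
  have p1 : 0 < m / r ^ 2 := by positivity
  have p2 : 0 < q * (ρ ^ 2 + 1) := by positivity
  obtain ⟨y, hy1, hyd, hyA⟩ := exists_periodic_orbit_of_hamiltonian hJ hJs hH (G := G)
    (by
      have : G = fun z => F z + (2 * q) • z := funext hGF
      rw [this]
      exact (hFs.uniformContinuous_of_continuous hFc).add
        (ContinuousLinearMap.uniformContinuous ((2 * q) • ContinuousLinearMap.id ℝ E)))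
    (fun z => add_nonneg (mul_nonneg hm0.le (h0 z)) (mul_nonneg hq.le (hk0 _))) hr
    (show 0 ≤ C by rw [hC]; positivity)
    (fun z hz => by simp only [H, hHr z hz, (hin z (hz.trans hρr)).1, mul_zero, add_zero])
    (fun z => by
      simp only [H]
      rcases le_total ‖z‖ r with hz | hz
      · rw [hHr z hz, (hin z (hz.trans hρr)).1, mul_zero, mul_zero, add_zero]
        rw [hC]; positivity
      · have a1 : m * H₀ z ≤ m / r ^ 2 * ‖z‖ ^ 2 := by
          rw [div_mul_eq_mul_div, le_div_iff₀ (by positivity)]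
          have := pow_le_pow_left₀ hr.le hz 2
          exact mul_le_mul (mul_le_of_le_one_right hm0.le (h1 z)) this (by positivity) hm0.le
        have a2 : q * k (‖z‖ ^ 2 - ρ ^ 2) ≤ q * ‖z‖ ^ 2 :=
          mul_le_mul_of_nonneg_left ((hkle _).trans (max_le (by nlinarith) (by positivity))) hq.le
        have a3 : 0 ≤ (q * (ρ ^ 2 + 1) + C₁) * ‖z‖ ^ 2 := by positivity
        rw [hC]
        linarith)
    hq1 hq2
    (fun z => by
      have a1 := mul_nonneg hm0.le (h0 z)
      have a2 := mul_le_mul_of_nonneg_left (hkge (‖z‖ ^ 2 - ρ ^ 2)) hq.le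
      simp only [H]
      rw [hC]
      linarith)
    (fun z => by
      rw [hGF, add_sub_cancel_right]
      refine (hC₁ z).trans ?_
      rw [hC]
      linarith)
  have hcons : ∀ t s, H (y t) = H (y s) := by
    have hd : ∀ t, HasDerivAt (fun t => H (y t)) 0 t := by
      intro t
      have e := (hH (y t)).hasFDerivAt.comp_hasDerivAt t (hyd t)
      rw [InnerProductSpace.toDual_apply_apply] at e
      have e2 := hJs (G (y t)) (G (y t))
      rw [real_inner_comm] at e2
      have e3 : inner ℝ (G (y t)) (J (G (y t))) = (0 : ℝ) := by linarith
      rwa [e3] at e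
    exact fun t s => is_const_of_deriv_eq_zero (fun t => (hd t).differentiableAt)
      (fun t => (hd t).deriv) t s
  obtain ⟨t₀, ht₀⟩ : ∃ t, 0 < (1 / 2 : ℝ) * inner ℝ (G (y t)) (y t) - H (y t) := by
    by_contra! h
    have := intervalIntegral.integral_nonneg (μ := MeasureTheory.volume)
      (f := fun t => -((1 / 2 : ℝ) * inner ℝ (G (y t)) (y t) - H (y t)))
      (show (0 : ℝ) ≤ 1 by norm_num) (fun t _ => neg_nonneg.2 (h t))
    rw [intervalIntegral.integral_neg] at this
    linarith
  have hne1 : H₀ (y t₀) ≠ 1 := by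
    intro h
    simp only [G, H, hGe _ (Or.inr h), h, smul_zero, zero_add, inner_smul_left,
      real_inner_self_eq_norm_sq, conj_trivial] at ht₀
    have a1 := hkk (‖y t₀‖ ^ 2 - ρ ^ 2)
    have a2 := hk'le (‖y t₀‖ ^ 2 - ρ ^ 2)
    have a3 := hk'0 (‖y t₀‖ ^ 2 - ρ ^ 2)
    generalize k (‖y t₀‖ ^ 2 - ρ ^ 2) = A at *
    generalize k' (‖y t₀‖ ^ 2 - ρ ^ 2) = B at *
    have a4 : B * ‖y t₀‖ ^ 2 - A ≤ ρ ^ 2 + 1 := by nlinarith [sq_nonneg ρ]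
    have a5 := mul_le_mul_of_nonneg_left a4 hq.le
    rw [hm] at ht₀
    linarith
  have hlow : ∀ z, H₀ z ≠ 1 → H z = m * H₀ z ∧ G z = m • G₀ z := by
    intro z hz
    have := hin z (hnorm z hz).le
    simp [H, G, this.1, this.2]
  have hne0 : H₀ (y t₀) ≠ 0 := by
    intro h
    rw [(hlow _ hne1).1, (hlow _ hne1).2, h, hGe _ (Or.inl h)] at ht₀
    simp at ht₀
  have hpos : 0 < H₀ (y t₀) := lt_of_le_of_ne (h0 _) (Ne.symm hne0)
  have hlt : H₀ (y t₀) < 1 := lt_of_le_of_ne (h1 _) hne1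
  have hall : ∀ t, 0 < H₀ (y t) ∧ H₀ (y t) < 1 := by
    intro t
    have e := hcons t t₀
    rw [(hlow _ hne1).1] at e
    have hn1 : H₀ (y t) ≠ 1 := by
      intro h
      have := mul_nonneg hq.le (hk0 (‖y t‖ ^ 2 - ρ ^ 2))
      simp only [H, h] at e
      nlinarith
    rw [(hlow _ hn1).1] at e
    rw [mul_left_cancel₀ hm0.ne' e]
    exact ⟨hpos, hlt⟩
  refine ⟨m, y, hm0, hy1, fun t => ?_, hall, t₀, fun h => ?_⟩
  · have := hyd t
    rwa [(hlow _ (hall t).2.ne).2, map_smul] at this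
  · rw [(hlow _ hne1).1, (hlow _ hne1).2, h] at ht₀
    have := mul_pos hm0 hpos
    simp at ht₀
    linarith

/-- Existence of a closed orbit of a Hamiltonian equal to `0` on an open set and to `1` at infinity,
up to rescaling the Hamiltonian. -/
theorem exists_periodic_orbit_of_plateau {J : E →L[ℝ] E} (hJ : ∀ x, J (J x) = -x)
    (hJs : ∀ x y, inner ℝ (J x) y = -inner ℝ x (J y)) {H : E → ℝ} {G : E → E}
    (hH : ∀ z, HasGradientAt H (G z) z) (hG : Continuous G) (h0 : ∀ z, 0 ≤ H z)
    (h1 : ∀ z, H z ≤ 1) {p : E} (hp : ∀ᶠ z in 𝓝 p, H z = 0) {R : ℝ}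
    (hHR : ∀ z, R ≤ ‖z‖ → H z = 1) :
    ∃ (m : ℝ) (x : ℝ → E), 0 < m ∧ Function.Periodic x 1 ∧
      (∀ t, HasDerivAt x (m • J (G (x t))) t) ∧ (∀ t, 0 < H (x t) ∧ H (x t) < 1) ∧
      ∃ t, G (x t) ≠ 0 := by
  obtain ⟨r, hr, hpr⟩ := Metric.nhds_basis_closedBall.eventually_iff.1 hp
  obtain ⟨m, x, hm, hx1, hxd, hxH, t, ht⟩ := exists_periodic_orbit_of_plateau_at_zero hJ hJs
    (H₀ := fun z => H (z + p)) (G₀ := fun z => G (z + p))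
    (fun z => by
      have := (hH (z + p)).hasFDerivAt.comp z ((hasFDerivAt_id z).add_const p)
      exact this)
    (by fun_prop) (fun z => h0 _) (fun z => h1 _) hr
    (fun z hz => hpr (by simpa [mem_closedBall_iff_norm] using hz))
    (R := R + ‖p‖) (fun z hz => hHR _ (by
      have := norm_sub_norm_le z (-p)
      rw [norm_neg, sub_neg_eq_add] at this
      linarith))
  exact ⟨m, fun t => x t + p, hm, fun t => by simp [hx1 t], fun t => (hxd t).add_const p, hxH, t, ht⟩

/-- Existence of a closed Hamiltonian orbit on some level of the collar time. -/
theorem exists_periodic_orbit_of_collar {J : E →L[ℝ] E} (hJ : ∀ x, J (J x) = -x)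
    (hJs : ∀ x y, inner ℝ (J x) y = -inner ℝ x (J y)) {g : E → ℝ} (hg : Continuous g) {ε L R : ℝ}
    (hε : 0 < ε) (hε1 : ε ≤ 1) (hL : 0 < L) (hR : ∀ z, R ≤ ‖z‖ → 1 ≤ g z) {p : E} (hp : g p < -ε)
    {s : E → ℝ} {S : E → E} (hS : ContinuousOn S {z | |g z| < ε})
    (hs : ∀ z, |g z| < ε → (∃ κ, 0 < κ ∧ κ ≤ L ∧ g z = κ * s z) ∧ HasGradientAt s (S z) z) :
    ∃ (c s₀ : ℝ) (x : ℝ → E), c ≠ 0 ∧ Function.Periodic x 1 ∧ (∀ t, |g (x t)| < ε) ∧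
      (∀ t, s (x t) = s₀) ∧ ∀ t, HasDerivAt x (c • J (S (x t))) t := by
  obtain ⟨H, G, k, hH, hG, h0, h1, hgt, hlt, hk⟩ := exists_collar_function hg hε hL hS hs
  obtain ⟨m, x, hm, hx1, hxd, hxH, t₀, ht₀⟩ := exists_periodic_orbit_of_plateau hJ hJs hH hG h0 h1
    (p := p) (by
      filter_upwards [hg.continuousAt.eventually_lt continuousAt_const hp] with z hz
        using hlt z hz.le)
    (fun z hz => hgt z (hε1.trans (hR z hz)))
  have hxg : ∀ t, |g (x t)| < ε := by
    intro t
    rw [abs_lt]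
    constructor
    · by_contra! h
      exact (hxH t).1.ne' (hlt _ h)
    · by_contra! h
      exact (hxH t).2.ne (hgt _ h)
  have hsc : ∀ t t', s (x t) = s (x t') := by
    have hd : ∀ t, HasDerivAt (fun t => s (x t)) 0 t := by
      intro t
      have e := ((hs _ (hxg t)).2).hasFDerivAt.comp_hasDerivAt t (hxd t)
      rw [InnerProductSpace.toDual_apply_apply, hk _ (hxg t), map_smul, inner_smul_right,
        inner_smul_right] at e
      have e2 := hJs (S (x t)) (S (x t))
      rw [real_inner_comm] at e2
      have e3 : inner ℝ (S (x t)) (J (S (x t))) = (0 : ℝ) := by linarith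
      rwa [e3, mul_zero, mul_zero] at e
    exact fun t t' => is_const_of_deriv_eq_zero (fun t => (hd t).differentiableAt)
      (fun t => (hd t).deriv) t t'
  refine ⟨m * k (s (x t₀)), s (x t₀), x, mul_ne_zero hm.ne' fun h => ht₀ ?_, hx1, hxg,
    fun t => hsc t t₀, fun t => ?_⟩
  · rw [hk _ (hxg t₀), h, zero_smul]
  · have := hxd t
    rwa [hk _ (hxg t), map_smul, smul_smul, hsc t t₀] at this

end PlateauOrbit

section DefiningFunction

open Set Filter Topology Metric

theorem isPreconnected_setOf_lt_norm {E : Type*} [NormedAddCommGroup E] [NormedSpace ℝ E]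
    (h : 1 < Module.rank ℝ E) {ρ : ℝ} (hρ : 0 ≤ ρ) : IsPreconnected {z : E | ρ < ‖z‖} := by
  have h1 := ((isPreconnected_Ioi (a := ρ)).prod (isPreconnected_sphere h (0 : E) 1)).image
    (fun p : ℝ × E => p.1 • p.2) (by fun_prop)
  convert! h1
  ext z
  constructor
  · intro hz
    have hz' : ρ < ‖z‖ := hz
    have h0 : ‖z‖ ≠ 0 := (hρ.trans_lt hz').ne'
    refine ⟨(‖z‖, ‖z‖⁻¹ • z), ⟨hz, ?_⟩, ?_⟩
    · simp [norm_smul, h0]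
    · simp [smul_smul, h0]
  · rintro ⟨⟨t, u⟩, ⟨ht, hu⟩, rfl⟩
    have htρ : ρ < t := ht
    have hu1 : ‖u‖ = 1 := by simpa using hu
    simp [norm_smul, hu1, abs_of_pos (hρ.trans_lt htρ), htρ]

/-- A compact regular level set in dimension at least two has a defining function which is
positive and bounded below at infinity. -/
theorem exists_proper_defining_function {E : Type*} [NormedAddCommGroup E] [InnerProductSpace ℝ E]
    [FiniteDimensional ℝ E] (hE : 1 < Module.rank ℝ E) {g : E → ℝ} (hg : ContDiff ℝ ∞ g)
    (hM : IsCompact (g ⁻¹' {0})) (hMne : (g ⁻¹' {0}).Nonempty)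
    (hreg : ∀ x ∈ g ⁻¹' {0}, fderiv ℝ g x ≠ 0) :
    ∃ (f : E → ℝ) (σ R : ℝ) (p : E), ContDiff ℝ ∞ f ∧ f ⁻¹' {0} = g ⁻¹' {0} ∧ σ ≠ 0 ∧
      (∀ z, R ≤ ‖z‖ → 1 ≤ f z) ∧ f p < 0 ∧ ∀ x ∈ g ⁻¹' {0}, fderiv ℝ f x = σ • fderiv ℝ g x := by
  obtain ⟨ρ, hρ0, hρ⟩ := hM.isBounded.subset_ball_lt 0 0
  have hne : ∀ z, ρ < ‖z‖ → g z ≠ 0 := by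
    intro z hz h
    have := hρ (show z ∈ g ⁻¹' {0} from h)
    rw [mem_ball_zero_iff] at this
    linarith
  obtain ⟨σ, hσ, hpos⟩ : ∃ σ : ℝ, σ ≠ 0 ∧ ∀ z, ρ < ‖z‖ → 0 < σ * g z := by
    have hpre := (isPreconnected_setOf_lt_norm hE hρ0.le).image g hg.continuous.continuousOn
    by_cases h : ∃ z, ρ < ‖z‖ ∧ 0 < g z
    · obtain ⟨z, hz, hgz⟩ := h
      refine ⟨1, one_ne_zero, fun w hw => ?_⟩
      rw [one_mul]
      by_contra! hgw
      obtain ⟨x, hx, hx0⟩ := hpre.ordConnected.out ⟨w, hw, rfl⟩ ⟨z, hz, rfl⟩ ⟨hgw, hgz.le⟩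
      exact hne x hx hx0
    · push Not at h
      refine ⟨-1, by norm_num, fun w hw => ?_⟩
      have := lt_of_le_of_ne (h w hw) (hne w hw)
      linarith
  let b : ContDiffBump (0 : E) := ⟨ρ + 1, ρ + 2, by linarith, by linarith⟩
  let f : E → ℝ := fun z => σ * g z + (1 - b z)
  have hf : ContDiff ℝ ∞ f := (contDiff_const.mul hg).add (contDiff_const.sub b.contDiff)
  have hfin : ∀ z, ‖z‖ ≤ ρ + 1 → f z = σ * g z := fun z hz => by
    have : b z = 1 := b.one_of_mem_closedBall (by simpa using hz)
    simp [f, this]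
  have hfout : ∀ z, ρ < ‖z‖ → 0 < f z := fun z hz => by
    have := b.le_one (x := z)
    have := hpos z hz
    simp only [f]
    linarith
  have hzero : f ⁻¹' {0} = g ⁻¹' {0} := by
    ext z
    simp only [mem_preimage, mem_singleton_iff]
    rcases le_or_gt ‖z‖ ρ with hz | hz
    · rw [hfin z (by linarith)]
      simp [hσ]
    · simp [(hfout z hz).ne', hne z hz]
  have hfd : ∀ x ∈ g ⁻¹' {0}, fderiv ℝ f x = σ • fderiv ℝ g x := by
    intro x hx
    have h1 : f =ᶠ[𝓝 x] fun z => σ * g z := by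
      filter_upwards [isOpen_ball.mem_nhds (hρ hx)] with z hz
      exact hfin z (by rw [mem_ball_zero_iff] at hz; linarith)
    rw [h1.fderiv_eq, fderiv_const_mul (hg.differentiable (by simp) x)]
  obtain ⟨p, hp⟩ : ∃ p, f p < 0 := by
    by_contra! h
    obtain ⟨x, hx⟩ := hMne
    have hx' : f x = 0 := by rw [← hzero] at hx; exact hx
    have hmin : IsLocalMin f x := Eventually.of_forall fun z => by rw [hx']; exact h z
    have := hmin.fderiv_eq_zero
    rw [hfd x hx] at this
    exact (smul_ne_zero hσ (hreg x hx)) this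
  refine ⟨f, σ, ρ + 2, p, hf, hzero, hσ, fun z hz => ?_, hp, hfd⟩
  have h1 : b z = 0 := b.zero_of_le_dist (by simpa using hz)
  have := hpos z (by linarith)
  simp only [f, h1]
  linarith

end DefiningFunction

section ClosedCharacteristic

open Set Filter Topology

variable {E : Type*} [NormedAddCommGroup E] [InnerProductSpace ℝ E] [FiniteDimensional ℝ E]

theorem surjective_of_inner_complexStructure_conformal {J D : E →L[ℝ] E} (hJ : ∀ x, J (J x) = -x)
    {c : ℝ} (hc : c ≠ 0) (hD : ∀ u v, inner ℝ (J (D u)) (D v) = c * inner ℝ (J u) v) :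
    Function.Surjective D := by
  have hinj : Function.Injective D.toLinearMap := by
    refine (injective_iff_map_eq_zero _).2 fun v hv => ?_
    have h := hD (J v) v
    rw [show D v = 0 from hv, inner_zero_right, hJ, inner_neg_left] at h
    have h' : inner ℝ v v = (0 : ℝ) := by
      rcases mul_eq_zero.1 h.symm with h | h
      · exact absurd h hc
      · linarith
    exact inner_self_eq_zero.1 h'
  exact LinearMap.surjective_of_injective hinj

/-- A compact hypersurface of contact type carries a closed characteristic. -/
theorem exists_closed_characteristic (hE : 1 < Module.rank ℝ E) {J : E →L[ℝ] E}
    (hJ : ∀ x, J (J x) = -x) (hJs : ∀ x y, inner ℝ (J x) y = -inner ℝ x (J y)) {g : E → ℝ}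
    (hg : ContDiff ℝ ∞ g) (hM : IsCompact (g ⁻¹' {0})) (hMne : (g ⁻¹' {0}).Nonempty)
    {U : Set E} (hU : IsOpen U) (hMU : g ⁻¹' {0} ⊆ U) {Y : E → E} (hY : ContDiffOn ℝ ∞ Y U)
    (hL : ∀ x ∈ U, ∀ u v, inner ℝ (J (fderiv ℝ Y x u)) v + inner ℝ (J u) (fderiv ℝ Y x v) =
      inner ℝ (J u) v)
    (htr : ∀ x ∈ g ⁻¹' {0}, fderiv ℝ g x (Y x) ≠ 0) :
    ∃ (c : ℝ) (y y' : ℝ → E), c ≠ 0 ∧ Function.Periodic y 1 ∧ (∀ t, g (y t) = 0) ∧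
      (∀ t, HasDerivAt y (y' t) t) ∧
      (∀ t v, fderiv ℝ g (y t) v = 0 → inner ℝ (J (y' t)) v = 0) ∧
      ∀ t, inner ℝ (J (Y (y t))) (y' t) = c := by
  have : Nontrivial E := rank_pos_iff_nontrivial.1 (zero_lt_one.trans hE)
  obtain ⟨f, ς, R, p, hf, hfg, hς, hR, hp, hfd⟩ := exists_proper_defining_function hE hg hM hMne
    (fun x hx h => htr x hx (by rw [h]; rfl))
  rw [← hfg] at hM hMne hMU htr hfd
  have hfY : ∀ x ∈ f ⁻¹' {0}, fderiv ℝ f x (Y x) ≠ 0 := fun x hx => by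
    rw [hfd x hx]
    exact mul_ne_zero hς (htr x hx)
  obtain ⟨V, σ, N, hV, hVc, hN, hMN, hNU, hσc, hσ⟩ := exists_cutoff_vectorField hf hM hU hMU hY hfY
  obtain ⟨a, B, φ, D, ha, hB, hφc, hDc, hφ0, hD0, hφt, hφz, hDt, hDV, hφB⟩ :=
    exists_local_flow_of_hasCompactSupport hV hVc
  obtain ⟨r, ε, L, s, S, hr, hra, hε, hεp, hε1, hLpos, hSc, hs⟩ := exists_collar_time hf hM hMne
    (half_pos (neg_pos.2 hp)) hR hV hN hMN (fun x hx => (hσ x hx).2.2) ha hB hφc hDc hφ0 hφt hφz hφB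
  obtain ⟨c, s₀, x, hc, hx1, hxf, hxs, hxd⟩ := exists_periodic_orbit_of_collar hJ hJs hf.continuous
    hε hε1 hLpos hR (p := p) (by linarith) hSc
    (fun z hz => ⟨(hs z hz).2.2.2.1, (hs z hz).2.2.2.2.1⟩)
  have hxc : Continuous x := continuous_iff_continuousAt.2 fun t => (hxd t).continuousAt
  have hφN : ∀ t, ∀ τ ∈ Ioo (-r) r, φ (x t) τ ∈ N := fun t => (hs _ (hxf t)).1
  have hsub : Ioo (-r) r ⊆ Ioo (-a) a := Ioo_subset_Ioo (by linarith) hra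
  obtain ⟨σ₀, hσ₀, hσφ⟩ : ∃ σ₀ : ℝ, σ₀ * σ₀ = 1 ∧ ∀ t, ∀ τ ∈ Ioo (-r) r, σ (φ (x t) τ) = σ₀ := by
    have hpre := (isPreconnected_univ (α := ℝ)).prod (isPreconnected_Ioo (a := -r) (b := r))
    have hmaps : MapsTo (fun q : ℝ × ℝ => φ (x q.1) q.2) (univ ×ˢ Ioo (-r) r) N :=
      fun q hq => hφN _ _ hq.2
    have hcont : ContinuousOn (fun q : ℝ × ℝ => σ (φ (x q.1) q.2)) (univ ×ˢ Ioo (-r) r) :=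
      hσc.comp (hφc.comp (by fun_prop : Continuous fun q : ℝ × ℝ => (x q.1, q.2))).continuousOn hmaps
    rcases hpre.eq_or_eq_neg_of_sq_eq hcont (continuousOn_const (c := (1 : ℝ)))
      (fun q hq => by
        rcases (hσ _ (hmaps hq)).1 with h | h <;> simp at h <;> simp [h])
      (fun _ => one_ne_zero) with h | h
    · exact ⟨1, by norm_num, fun t τ hτ => h (x := (t, τ)) ⟨mem_univ _, hτ⟩⟩
    · exact ⟨-1, by norm_num, fun t τ hτ => h (x := (t, τ)) ⟨mem_univ _, hτ⟩⟩
  have hτ₀ : -s₀ ∈ Ioo (-r) r := by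
    have := (hs _ (hxf 0)).2.1
    rwa [hxs] at this
  have hconf : ∀ t u v, inner ℝ (J (D (x t) (-s₀) u)) (D (x t) (-s₀) v) =
      exp (σ₀ * -s₀) * inner ℝ (J u) v := by
    intro t u v
    have := inner_complexStructure_linearized_flow (J := J) (σ := σ₀) (r := r)
      (A := fun τ => fderiv ℝ V (φ (x t) τ)) (u := fun τ => D (x t) τ u) (v := fun τ => D (x t) τ v)
      (fun τ hτ => hDt _ u τ (hsub hτ)) (fun τ hτ => hDt _ v τ (hsub hτ))
      (fun τ hτ w z => by
        have hw := hφN t τ hτ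
        have hYd : DifferentiableAt ℝ Y (φ (x t) τ) :=
          (hY.contDiffAt (hU.mem_nhds (hNU hw))).differentiableAt (by simp)
        rw [(hσ _ hw).2.1.fderiv_eq, hσφ t τ hτ, fderiv_fun_const_smul hYd]
        simp only [smul_apply, map_smul, inner_smul_left, inner_smul_right, conj_trivial]
        rw [← mul_add, hL _ (hNU hw)]) hτ₀
    rwa [hD0, hD0] at this
  have hexp := (exp_pos (σ₀ * -s₀)).ne'
  have hσ₀n : σ₀ ≠ 0 := fun h => by simp [h] at hσ₀
  have hzero : ∀ t, φ (x t) (-s₀) ∈ f ⁻¹' {0} := fun t => by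
    have := (hs _ (hxf t)).2.2.1
    rwa [hxs] at this
  have hpos : ∀ t, 0 < fderiv ℝ f (φ (x t) (-s₀)) (V (φ (x t) (-s₀))) := fun t =>
    (hσ _ (hφN t _ hτ₀)).2.2
  have hgrad : ∀ t b, inner ℝ (S (x t)) b * fderiv ℝ f (φ (x t) (-s₀)) (V (φ (x t) (-s₀))) =
      fderiv ℝ f (φ (x t) (-s₀)) (D (x t) (-s₀) b) := fun t b => by
    have := (hs _ (hxf t)).2.2.2.2.2 b
    rwa [hxs] at this
  have hchar : ∀ t b, inner ℝ (J (D (x t) (-s₀) (c • J (S (x t))))) (D (x t) (-s₀) b) =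
      -(exp (σ₀ * -s₀) * c) * inner ℝ (S (x t)) b := fun t b => by
    rw [hconf, map_smul, hJ, smul_neg, inner_neg_left, inner_smul_left, conj_trivial]
    ring
  refine ⟨σ₀ * (exp (σ₀ * -s₀) * c), fun t => φ (x t) (-s₀),
    fun t => D (x t) (-s₀) (c • J (S (x t))), mul_ne_zero hσ₀n (mul_ne_zero hexp hc),
    fun t => ?_, fun t => ?_, fun t => (hφz _ _).comp_hasDerivAt t (hxd t), fun t v hv => ?_,
    fun t => ?_⟩
  · simp only [hx1 t]
  · have := hzero t
    rw [hfg] at this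
    exact this
  · obtain ⟨b, rfl⟩ := surjective_of_inner_complexStructure_conformal hJ hexp (hconf t) v
    have h1 := hgrad t b
    rw [hfd _ (hzero t), smul_apply, smul_apply, hv, smul_zero] at h1
    have h2 : inner ℝ (S (x t)) b = (0 : ℝ) := by
      refine (mul_eq_zero.1 h1).resolve_right fun h => ?_
      have h3 := hpos t
      rw [hfd _ (hzero t), smul_apply, h] at h3
      exact lt_irrefl _ h3
    rw [hchar, h2, mul_zero]
  · have h1 := hgrad t (V (x t))
    rw [hDV _ _ (hsub hτ₀)] at h1
    have h2 : inner ℝ (S (x t)) (V (x t)) = (1 : ℝ) :=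
      mul_right_cancel₀ (hpos t).ne' (by rw [h1, one_mul])
    have h3 := hchar t (V (x t))
    rw [h2, hDV _ _ (hsub hτ₀), (hσ _ (hφN t _ hτ₀)).2.1.eq_of_nhds, hσφ t _ hτ₀,
      inner_smul_right] at h3
    rw [hJs, real_inner_comm]
    generalize inner ℝ (J (D (x t) (-s₀) (c • J (S (x t))))) (Y (φ (x t) (-s₀))) = Q at *
    have h4 : σ₀ * (σ₀ * Q) = Q := by rw [← mul_assoc, hσ₀, one_mul]
    rw [← h4, h3]
    ring

end ClosedCharacteristic

section ReebOrbit

open Set Filter Topology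

/-- An integral curve of a vector field which is smooth along the curve is smooth. -/
theorem contDiff_of_hasDerivAt_of_contDiffAt {E : Type*} [NormedAddCommGroup E] [NormedSpace ℝ E]
    {X : E → E} {γ : ℝ → E}
    (hγ : ∀ t, HasDerivAt γ (X (γ t)) t) (hX : ∀ t, ContDiffAt ℝ ∞ X (γ t)) :
    ContDiff ℝ ∞ γ := by
  have hd : deriv γ = fun t => X (γ t) := funext fun t => (hγ t).deriv
  refine contDiff_infty.2 fun n => ?_
  induction n with
  | zero => exact contDiff_zero.2 (continuous_iff_continuousAt.2 fun t => (hγ t).continuousAt)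
  | succ n ih =>
    rw [Nat.cast_succ, contDiff_succ_iff_deriv]
    refine ⟨fun t => (hγ t).differentiableAt, fun h => by simp at h, ?_⟩
    rw [hd]
    exact contDiff_iff_contDiffAt.2 fun t =>
      ((hX t).of_le (by exact_mod_cast le_top)).comp t ih.contDiffAt

theorem eq_smul_of_inner_eq_zero {E : Type*} [NormedAddCommGroup E] [InnerProductSpace ℝ E] {J : E →L[ℝ] E} (hJ : ∀ x, J (J x) = -x) {w u : E}
    (h : ∀ v, inner ℝ w v = (0 : ℝ) → inner ℝ (J u) v = (0 : ℝ)) : ∃ l : ℝ, u = l • J w := by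
  have h1 : J u ∈ (ℝ ∙ w)ᗮᗮ := by
    intro v hv
    rw [real_inner_comm]
    exact h v (Submodule.mem_orthogonal_singleton_iff_inner_right.1 hv)
  rw [Submodule.orthogonal_orthogonal, Submodule.mem_span_singleton] at h1
  obtain ⟨l, hl⟩ := h1
  refine ⟨-l, ?_⟩
  rw [neg_smul, ← map_smul, hl, hJ, neg_neg]

/-- A compact hypersurface of contact type carries a closed Reeb orbit. -/
theorem exists_closed_reeb_orbit {E : Type*} [NormedAddCommGroup E] [InnerProductSpace ℝ E]
    [FiniteDimensional ℝ E] (hE : 1 < Module.rank ℝ E) {J : E →L[ℝ] E}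
    (hJ : ∀ x, J (J x) = -x) (hJs : ∀ x y, inner ℝ (J x) y = -inner ℝ x (J y)) {g : E → ℝ}
    (hg : ContDiff ℝ ∞ g) (hM : IsCompact (g ⁻¹' {0})) (hMne : (g ⁻¹' {0}).Nonempty)
    {U : Set E} (hU : IsOpen U) (hMU : g ⁻¹' {0} ⊆ U) {Y : E → E} (hY : ContDiffOn ℝ ∞ Y U)
    (hL : ∀ x ∈ U, ∀ u v, inner ℝ (J (fderiv ℝ Y x u)) v + inner ℝ (J u) (fderiv ℝ Y x v) =
      inner ℝ (J u) v)
    (htr : ∀ x ∈ g ⁻¹' {0}, fderiv ℝ g x (Y x) ≠ 0) :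
    ∃ (T : ℝ) (γ : ℝ → E), 0 < T ∧ ContDiff ℝ ∞ γ ∧ (∀ t, g (γ t) = 0) ∧
      Function.Periodic γ T ∧ (∀ t, fderiv ℝ g (γ t) (deriv γ t) = 0) ∧
      (∀ t v, fderiv ℝ g (γ t) v = 0 → inner ℝ (J (deriv γ t)) v = 0) ∧
      ∀ t, inner ℝ (J (Y (γ t))) (deriv γ t) = 1 := by
  obtain ⟨c, y, y', hc, hy1, hyg, hyd, hych, hyY⟩ :=
    exists_closed_characteristic hE hJ hJs hg hM hMne hU hMU hY hL htr
  let grad : E → E := fun x => (InnerProductSpace.toDual ℝ E).symm (fderiv ℝ g x)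
  have hgr : ∀ x v, inner ℝ (grad x) v = fderiv ℝ g x v := fun x v =>
    InnerProductSpace.toDual_symm_apply
  have hJJ : ∀ u v, inner ℝ (J u) (J v) = (inner ℝ u v : ℝ) := fun u v => by
    rw [hJs, hJ, inner_neg_right, neg_neg]
  have hJ0 : ∀ u, inner ℝ u (J u) = (0 : ℝ) := fun u => by
    have := hJs u u
    rw [real_inner_comm] at this
    linarith
  let X : E → E := fun x => (fderiv ℝ g x (Y x))⁻¹ • J (grad x)
  have hX : ∀ t, c⁻¹ • y' t = X (y t) := by
    intro t
    obtain ⟨l, hl⟩ := eq_smul_of_inner_eq_zero hJ (w := grad (y t)) (u := y' t)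
      (fun v hv => hych t v (by rwa [hgr] at hv))
    have h1 := hyY t
    rw [hl, inner_smul_right, hJJ, real_inner_comm, hgr] at h1
    have h2 : fderiv ℝ g (y t) (Y (y t)) ≠ 0 := fun h => hc (by rw [← h1, h, mul_zero])
    simp only [X]
    rw [hl, smul_smul, ← h1]
    congr 1
    have h3 : l ≠ 0 := fun h => hc (by rw [← h1, h, zero_mul])
    field_simp
  let γ : ℝ → E := fun t => y (c⁻¹ * t)
  have hγ : ∀ t, HasDerivAt γ (X (γ t)) t := by
    intro t
    rw [← hX]
    have h1 : HasDerivAt (fun t => c⁻¹ * t) c⁻¹ t := by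
      simpa using (hasDerivAt_id t).const_mul c⁻¹
    exact (hyd (c⁻¹ * t)).scomp t h1
  have hgd : ContDiff ℝ ∞ (fderiv ℝ g) := hg.fderiv_right (by simp)
  have hXs : ∀ t, ContDiffAt ℝ ∞ X (γ t) := by
    intro t
    have hm : γ t ∈ g ⁻¹' {0} := hyg _
    have h1 : ContDiffAt ℝ ∞ Y (γ t) := hY.contDiffAt (hU.mem_nhds (hMU hm))
    have h2 : ContDiff ℝ ∞ grad :=
      (InnerProductSpace.toDual ℝ E).symm.toContinuousLinearEquiv.contDiff.comp hgd
    exact ((hgd.contDiffAt.clm_apply h1).inv (htr _ hm)).smul (J.contDiff.comp h2).contDiffAt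
  have hc0 := abs_pos.2 hc
  refine ⟨|c|, γ, hc0, contDiff_of_hasDerivAt_of_contDiffAt hγ hXs, fun t => hyg _, fun t => ?_,
    fun t => ?_, fun t v hv => ?_, fun t => ?_⟩
  · simp only [γ]
    rw [mul_add]
    rcases abs_choice c with h | h <;> rw [h]
    · rw [inv_mul_cancel₀ hc]
      exact hy1 _
    · rw [mul_neg, inv_mul_cancel₀ hc, ← sub_eq_add_neg]
      exact hy1.sub_eq _
  · rw [(hγ t).deriv, ← hgr]
    simp only [X]
    rw [inner_smul_right, hJ0, mul_zero]
  · rw [(hγ t).deriv, ← hX, map_smul, inner_smul_left, hych _ v hv, mul_zero]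
  · rw [(hγ t).deriv, ← hX, inner_smul_right, hyY, inv_mul_cancel₀ hc]

end ReebOrbit

/-- Viterbo: on a compact hypersurface M = g⁻¹(0) ⊂ ℝ⁴ of contact type, with
Liouville vector field Y defined near and transverse to M, the induced contact
form α = (ι_Y ω_st)|TM has a closed Reeb orbit. -/
theorem contact_type_hypersurface_reeb_orbit
    (g : R4 → ℝ) (hg : ContDiff ℝ ∞ g)
    (M : Set R4) (hM : M = g ⁻¹' {0})
    (hMne : M.Nonempty) (hMcpt : IsCompact M)
    (hreg : ∀ x ∈ M, fderiv ℝ g x ≠ 0)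
    (U : Set R4) (hU : IsOpen U) (hMU : M ⊆ U)
    (Y : R4 → R4) (hY : ContDiffOn ℝ ∞ Y U)
    (hLiou : ∀ x ∈ U, ∀ u v : R4,
      omegaSt (fderiv ℝ Y x u) v + omegaSt u (fderiv ℝ Y x v) = omegaSt u v)
    (htrans : ∀ x ∈ M, fderiv ℝ g x (Y x) ≠ 0) :
    ∃ (T : ℝ) (γ : ℝ → R4), 0 < T ∧ ContDiff ℝ ∞ γ ∧ (∃ t s, γ t ≠ γ s) ∧
      (∀ t, γ t ∈ M) ∧ (∀ t, γ (t + T) = γ t) ∧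
      -- γ′(t) is tangent to M:
      (∀ t, fderiv ℝ g (γ t) (deriv γ t) = 0) ∧
      -- γ′(t) lies in the kernel of ω_st restricted to T_{γ(t)}M:
      (∀ t, ∀ v : R4, fderiv ℝ g (γ t) v = 0 → omegaSt (deriv γ t) v = 0) ∧
      -- normalisation α(γ′) = ω_st(Y, γ′) = 1:
      (∀ t, omegaSt (Y (γ t)) (deriv γ t) = 1) := by
  let J₀ : R4 →ₗ[ℝ] R4 :=
    { toFun := fun u => !₂[-u 1, u 0, -u 3, u 2]
      map_add' := fun u v => by
        ext i
        fin_cases i <;> simp <;> ring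
      map_smul' := fun a u => by
        ext i
        fin_cases i <;> simp }
  let J : R4 →L[ℝ] R4 := LinearMap.toContinuousLinearMap J₀
  have hJω : ∀ u v, omegaSt u v = inner ℝ (J u) v := fun u v => by
    simp [omegaSt, J, J₀, PiLp.inner_apply, Fin.sum_univ_four]
    ring
  have hJ : ∀ x, J (J x) = -x := fun x => by
    ext i
    fin_cases i <;> simp [J, J₀]
  have hJs : ∀ x y, inner ℝ (J x) y = -inner ℝ x (J y) := fun x y => by
    rw [real_inner_comm (J y) x, ← hJω, ← hJω]
    simp only [omegaSt]
    ring
  subst hM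
  simp only [hJω] at hLiou ⊢
  obtain ⟨T, γ, hT, hγ, hγg, hγT, h1, h2, h3⟩ := exists_closed_reeb_orbit
    (by rw [rank_eq_card_basis (EuclideanSpace.basisFun (Fin 4) ℝ).toBasis]; norm_num)
    hJ hJs hg hMcpt hMne hU hMU hY hLiou htrans
  refine ⟨T, γ, hT, hγ, ?_, hγg, hγT, h1, h2, h3⟩
  by_contra! h
  have hconst : γ = fun _ => γ 0 := funext fun t => h t 0
  have hd := h3 0
  rw [hconst, deriv_const, inner_zero_right] at hd
  exact zero_ne_one hd
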